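/- Let L_0, L_1 and L_∞ be three distinct rays emanating from the origin. If the three rays are not equally spaced, then there is no transcendental meromorphic function f on ℂ such that all but finitely many zeros of f lie on L_0, all but finitely many 1-points of f lie on L_1, and all but finitely many poles of f lie on L_∞. -/

import Mathlib

open Complex Filter Set Topology

noncomputable section

/-- The open ray emanating from the origin with direction angle `θ`. -/
def Ray (θ : ℝ) : Set ℂ :=
  {z : ℂ | ∃ t : ℝ, 0 < t ∧ z = (t : ℂ) * Complex.exp ((θ : ℂ) * Complex.I)}

/-- Three rays are equally spaced if their direction angles differ pairwise by `2π/3` mod `2π`. -/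
def EquallySpaced (L₀ L₁ L₂ : Set ℂ) : Prop :=
  ∃ θ : ℝ, ({L₀, L₁, L₂} : Set (Set ℂ)) =
    {Ray θ, Ray (θ + 2 * Real.pi / 3), Ray (θ + 4 * Real.pi / 3)}

/-- `f` is meromorphic on the open set `U` with pole set `P`: it is analytic on `U \ P`,
blows up at each point of `P`, and `P` has no accumulation point in `U`. -/
def MeromOn (f : ℂ → ℂ) (P : Set ℂ) (U : Set ℂ) : Prop :=
  P ⊆ U ∧ AnalyticOnNhd ℂ f (U \ P) ∧
    (∀ p ∈ P, Tendsto (fun z => ‖f z‖) (𝓝[≠] p) atTop) ∧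
    ∀ z ∈ U, ¬ AccPt z (𝓟 P)

/-- `f` (meromorphic on `ℂ` with pole set `P`) is a rational function. -/
def IsRationalFn (f : ℂ → ℂ) (P : Set ℂ) : Prop :=
  ∃ p q : Polynomial ℂ, q ≠ 0 ∧ ∀ z ∉ P, q.eval z ≠ 0 → f z = p.eval z / q.eval z

open scoped ComplexConjugate

/-- holomorphic logarithm on an open convex set -/
lemma exists_holo_log {U : Set ℂ} (hc : Convex ℝ U) (ho : IsOpen U) {g : ℂ → ℂ}
    (hg : DifferentiableOn ℂ g U) (h0 : ∀ z ∈ U, g z ≠ 0) :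
    ∃ h : ℂ → ℂ, DifferentiableOn ℂ h U ∧ ∀ z ∈ U, exp (h z) = g z := by
  rcases U.eq_empty_or_nonempty with rfl | hne
  · exact ⟨0, by simp, by simp⟩
  have := hc.contractibleSpace hne
  have hs : IsSimplyConnected U := by
    unfold IsSimplyConnected; infer_instance
  obtain ⟨h, hhc, hh⟩ := Complex.exists_continuousOn_eqOn_exp_comp hs ho hg.continuousOn
    (by rintro ⟨z, hz, hz0⟩; exact h0 z hz hz0)
  refine ⟨h, ?_, fun z hz => hh hz⟩
  intro w hw
  have hcw : ContinuousAt h w := hhc.continuousAt (ho.mem_nhds hw)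
  have hgw : DifferentiableAt ℂ g w := hg.differentiableAt (ho.mem_nhds hw)
  have h1 : ∀ᶠ z in 𝓝 w, h z = h w + log (g z / g w) := by
    have h2 : ∀ᶠ z in 𝓝 w, ‖h z - h w‖ < 1 := by
      have : Tendsto (fun z => ‖h z - h w‖) (𝓝 w) (𝓝 0) := by
        have := (hcw.sub (continuousAt_const (y := h w))).norm
        simpa [ContinuousAt] using this
      exact this.eventually (gt_mem_nhds one_pos)
    filter_upwards [h2, ho.mem_nhds hw] with z hz hzU
    have e1 : exp (h z) = g z := hh hzU
    have e2 : exp (h w) = g w := hh hw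
    rw [← e1, ← e2, ← Complex.exp_sub, Complex.log_exp]
    · ring
    · have := abs_le.1 (Complex.abs_im_le_norm (h z - h w))
      linarith [Real.pi_gt_three]
    · have := abs_le.1 (Complex.abs_im_le_norm (h z - h w))
      linarith [Real.pi_gt_three]
  have h3 : DifferentiableAt ℂ (fun z => h w + log (g z / g w)) w := by
    refine (DifferentiableAt.clog (hgw.div_const _) ?_).const_add _
    rw [div_self (h0 w hw)]; simp
  exact (h3.congr_of_eventuallyEq h1).differentiableWithinAt

lemma bloch_aux {g : ℂ → ℂ} {p : ℂ} {t m : ℝ} (ht : 0 < t) (hm : 0 < m)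
    (hg : DifferentiableOn ℂ g (Metric.ball p t)) (hp : ‖deriv g p‖ = m)
    (hb : ∀ z ∈ Metric.ball p t, ‖deriv g z‖ ≤ 2 * m) :
    Metric.ball (g p) (m * t / 32) ⊆ g '' Metric.closedBall p (t / 8) := by
  have hdg : DifferentiableOn ℂ (deriv g) (Metric.ball p t) := hg.deriv Metric.isOpen_ball
  have hsub : Metric.closedBall p (t/8) ⊆ Metric.ball p t :=
    Metric.closedBall_subset_ball (by linarith)
  have h1 : ∀ z ∈ Metric.closedBall p (t/8), ‖deriv g z - deriv g p‖ ≤ m / 2 := by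
    intro z hz
    have := Complex.dist_le_div_mul_dist_of_mapsTo_ball (R₂ := 3 * m) hdg ?_ (hsub hz)
    · rw [dist_eq_norm] at this
      refine this.trans ?_
      have hz' : dist z p ≤ t / 8 := hz
      calc 3 * m / t * dist z p ≤ 3 * m / t * (t/8) := by gcongr
        _ = 3 * m / 8 := by field_simp
        _ ≤ m / 2 := by linarith
    · intro z hz
      rw [mem_closedBall_iff_norm]
      calc _ ≤ ‖deriv g z‖ + ‖deriv g p‖ := norm_sub_le _ _
        _ ≤ 2 * m + m := by linarith [hb z hz]
        _ = 3 * m := by ring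
  have h2 : ∀ z ∈ Metric.closedBall p (t/8), ‖(g z - deriv g p * z) - (g p - deriv g p * p)‖ ≤ m/2 * ‖z - p‖ := by
    intro z hz
    refine (convex_closedBall p (t/8)).norm_image_sub_le_of_norm_hasDerivWithin_le
      (f := fun z => g z - deriv g p * z) (f' := fun z => deriv g z - deriv g p) ?_ h1 
      (Metric.mem_closedBall_self (by linarith)) hz
    intro x hx
    have : DifferentiableAt ℂ g x := hg.differentiableAt (Metric.isOpen_ball.mem_nhds (hsub hx))
    have h3 := this.hasDerivAt.fun_sub ((hasDerivAt_id x).const_mul (deriv g p))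
    simpa using h3.hasDerivWithinAt
  have h3 : ∀ z ∈ Metric.closedBall p (t/8), m / 2 * ‖z - p‖ ≤ ‖g z - g p‖ := by
    intro z hz
    have e : deriv g p * (z - p) = (g z - g p) - ((g z - deriv g p * z) - (g p - deriv g p * p)) := by ring
    have h4 : m * ‖z - p‖ ≤ ‖g z - g p‖ + m/2 * ‖z - p‖ := by
      rw [← hp, ← norm_mul, e, hp]
      exact (norm_sub_le _ _).trans (by gcongr; exact h2 z hz)
    linarith
  have h5 := DiffContOnCl.ball_subset_image_closedBall (f := g) (z₀ := p) (r := t/8) (ε := m*t/16)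
    ?_ (by linarith) ?_ ?_
  · convert h5 using 2; ring
  · refine DifferentiableOn.diffContOnCl (hg.mono ?_)
    exact (Metric.closure_ball_subset_closedBall).trans hsub
  · intro z hz
    have := h3 z (Metric.sphere_subset_closedBall hz)
    rw [mem_sphere_iff_norm.1 hz] at this
    linarith
  · have : ∀ᶠ z in 𝓝[≠] p, g z ≠ g p := by
      have hh : ∀ᶠ z in 𝓝[≠] p, z ∈ Metric.closedBall p (t/8) :=
        mem_nhdsWithin_of_mem_nhds (Metric.closedBall_mem_nhds p (by linarith))
      filter_upwards [hh, self_mem_nhdsWithin] with z hz hne hcon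
      have := h3 z hz
      rw [hcon] at this
      have h6 : 0 < ‖z - p‖ := norm_pos_iff.2 (sub_ne_zero.2 hne)
      simp at this
      nlinarith
    exact this.frequently.filter_mono nhdsWithin_le_nhds

lemma bloch {g : ℂ → ℂ} {c : ℂ} {R : ℝ} (hg : DifferentiableOn ℂ g (Metric.ball c R))
    (hno : ∀ w : ℂ, ∃ x ∈ Metric.ball w 3, x ∉ g '' Metric.ball c R) (hR : 0 < R) :
    R * ‖deriv g c‖ ≤ 192 := by
  have hdg : DifferentiableOn ℂ (deriv g) (Metric.ball c R) := hg.deriv Metric.isOpen_ball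
  have key : ∀ R', 0 < R' → R' < R → R' * ‖deriv g c‖ ≤ 192 := by
    intro R' hR' hlt
    have hsub : Metric.closedBall c R' ⊆ Metric.ball c R := Metric.closedBall_subset_ball hlt
    have hcont : ContinuousOn (fun z => (R' - dist z c) * ‖deriv g z‖) (Metric.closedBall c R') := by
      refine ContinuousOn.mul (by fun_prop) ?_
      exact (hdg.continuousOn.mono hsub).norm
    obtain ⟨p, hp, hmax⟩ := (isCompact_closedBall c R').exists_isMaxOn
      ⟨c, Metric.mem_closedBall_self hR'.le⟩ hcont
    have hc := hmax (Metric.mem_closedBall_self hR'.le)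
    simp only [mem_ofPred_eq, dist_self, sub_zero] at hc
    refine hc.trans ?_
    by_contra hcon
    push Not at hcon
    have hpd : dist p c ≤ R' := hp
    set m := ‖deriv g p‖ with hm
    have hm0 : 0 < m := by
      rcases (norm_nonneg (deriv g p)).lt_or_eq with h | h
      · exact h
      · rw [hm, ← h] at hcon; norm_num at hcon
    have ht0 : 0 < R' - dist p c := by
      by_contra h
      have : R' - dist p c = 0 := by linarith
      rw [this] at hcon; norm_num at hcon
    set t := (R' - dist p c) / 2 with ht
    have htpos : 0 < t := by linarith
    have hbs : Metric.ball p t ⊆ Metric.closedBall c R' := by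
      intro z hz
      have : dist z p < t := hz
      have := dist_triangle z p c
      rw [Metric.mem_closedBall]; linarith
    have h1 := bloch_aux (g := g) (p := p) htpos hm0 (hg.mono (hbs.trans hsub)) rfl ?_
    · obtain ⟨x, hx, hxn⟩ := hno (g p)
      apply hxn
      have hmt : (3:ℝ) ≤ m * t / 32 := by
        have : (R' - dist p c) * m = 2 * (m * t) := by rw [ht]; ring
        linarith
      have := h1 (Metric.ball_subset_ball hmt hx)
      refine image_mono ?_ this
      exact (Metric.closedBall_subset_ball (by linarith)).trans (hbs.trans hsub)
    · intro z hz
      have h2 := hmax (hbs hz)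
      simp only [mem_ofPred_eq] at h2
      have h3 : dist z p < t := hz
      have h4 := dist_triangle z p c
      have h5 : t ≤ R' - dist z c := by linarith
      have h6 : t * ‖deriv g z‖ ≤ t * (2 * m) := by
        calc _ ≤ (R' - dist z c) * ‖deriv g z‖ := by gcongr
          _ ≤ _ := h2
          _ = _ := by rw [ht]; ring
      exact le_of_mul_le_mul_left h6 htpos
  have hlim : Tendsto (fun R' : ℝ => R' * ‖deriv g c‖) (𝓝[<] R) (𝓝 (R * ‖deriv g c‖)) :=
    ((continuous_id.mul continuous_const).tendsto R).mono_left nhdsWithin_le_nhds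
  refine le_of_tendsto hlim ?_
  filter_upwards [Ioo_mem_nhdsLT hR] with x hx
  exact key x hx.1 hx.2

/-- every disc of radius 3 contains a point whose cosh is an integer -/
lemma exists_cosh_int (w : ℂ) : ∃ x ∈ Metric.ball w 3, ∃ n : ℤ, Complex.cosh x = n := by
  have hr : ∀ a : ℝ, ∃ b : ℝ, |b - a| ≤ 2 ∧ ∃ n : ℤ, Real.cosh b = n := by
    have hpos : ∀ a : ℝ, 0 ≤ a → ∃ b : ℝ, |b - a| ≤ 2 ∧ ∃ n : ℤ, Real.cosh b = n := by
      intro a ha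
      have h1 : Real.cosh a + 1 ≤ Real.cosh (a + 2) := by
        rw [Real.cosh_add]
        have : (2:ℝ) ≤ Real.cosh 2 := by
          rw [Real.cosh_eq]
          have := Real.add_one_le_exp 1
          have h2 : Real.exp 2 = Real.exp 1 * Real.exp 1 := by rw [← Real.exp_add]; norm_num
          have := Real.exp_pos (-2)
          nlinarith
        have h3 : 0 ≤ Real.sinh a := Real.sinh_nonneg_iff.2 ha
        have h4 : 0 ≤ Real.sinh 2 := Real.sinh_nonneg_iff.2 (by norm_num)
        have := Real.one_le_cosh a
        nlinarith [mul_nonneg h3 h4]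
      have hm : ((⌈Real.cosh a⌉ : ℤ) : ℝ) ∈ Icc (Real.cosh a) (Real.cosh (a+2)) :=
        ⟨Int.le_ceil _, by linarith [Int.ceil_lt_add_one (Real.cosh a)]⟩
      obtain ⟨b, hb, hbe⟩ := intermediate_value_Icc (by linarith : a ≤ a + 2)
        Real.continuous_cosh.continuousOn hm
      exact ⟨b, by rw [abs_le]; constructor <;> linarith [hb.1, hb.2], _, hbe⟩
    intro a
    rcases le_total 0 a with ha | ha
    · exact hpos a ha
    · obtain ⟨b, hb, n, hn⟩ := hpos (-a) (by linarith)
      refine ⟨-b, ?_, n, by rw [Real.cosh_neg]; exact hn⟩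
      rw [abs_le] at hb ⊢; constructor <;> linarith [hb.1, hb.2]
  obtain ⟨b, hb, n, hn⟩ := hr w.re
  set m := round (w.im / Real.pi) with hm
  have h1 : |w.im / Real.pi - m| ≤ 1 / 2 := abs_sub_round _
  have h2 : |w.im - m * Real.pi| ≤ 2 := by
    have hp := Real.pi_pos
    have : w.im - m * Real.pi = (w.im / Real.pi - m) * Real.pi := by field_simp
    rw [this, abs_mul, abs_of_pos hp]
    nlinarith [Real.pi_lt_four]
  refine ⟨(b : ℂ) + (m * Real.pi : ℝ) * I, ?_, ?_⟩
  · rw [Metric.mem_ball, dist_eq_norm]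
    have : ‖(b : ℂ) + (m * Real.pi : ℝ) * I - w‖ ^ 2 = (b - w.re)^2 + (w.im - m * Real.pi)^2 := by
      rw [Complex.sq_norm, Complex.normSq_apply]
      simp; ring
    have h3 : (b - w.re)^2 ≤ 4 := by rw [← sq_abs]; nlinarith [abs_nonneg (b - w.re)]
    have h4 : (w.im - m * Real.pi)^2 ≤ 4 := by rw [← sq_abs]; nlinarith [abs_nonneg (w.im - m * Real.pi)]
    by_contra hcon
    push Not at hcon
    nlinarith
  · rw [Complex.cosh_add, Complex.cosh_mul_I, Complex.sinh_mul_I, ← Complex.ofReal_sin, ← Complex.ofReal_cos, Real.sin_int_mul_pi, Real.cos_int_mul_pi, ← Complex.ofReal_cosh, hn]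
    refine ⟨n * (if Even m then 1 else -1), ?_⟩
    split_ifs with h
    · simp [h.neg_one_zpow]
    · rw [Int.not_even_iff_odd] at h
      simp [h.neg_one_zpow]

lemma schottky_int {k : ℂ → ℂ} {c : ℂ} {R : ℝ} (hR : 0 < R) (hk : DifferentiableOn ℂ k (Metric.ball c R))
    (hom : ∀ z ∈ Metric.ball c R, ∀ n : ℤ, k z ≠ n) :
    ∀ w ∈ Metric.ball c (R / 2), ‖k w‖ ≤ Real.exp 192 * (2 * ‖k c‖ + 1) := by
  have hconv := convex_ball c R
  have hopen : IsOpen (Metric.ball c R) := Metric.isOpen_ball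
  obtain ⟨l, hl, hle⟩ := exists_holo_log hconv hopen (g := fun z => k z ^ 2 - 1) ((hk.pow 2).sub_const 1) (by
    intro z hz h0
    have : (k z - 1) * (k z + 1) = 0 := by linear_combination h0
    rcases mul_eq_zero.1 this with h | h
    · exact hom z hz 1 (by push_cast; linear_combination h)
    · exact hom z hz (-1) (by push_cast; linear_combination h))
  set q : ℂ → ℂ := fun z => exp (l z / 2) with hq
  have hq2 : ∀ z ∈ Metric.ball c R, q z ^ 2 = k z ^ 2 - 1 := by
    intro z hz
    rw [← hle z hz, hq]; simp only
    rw [← Complex.exp_nat_mul]; congr 1; push_cast; ring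
  have hprod : ∀ z ∈ Metric.ball c R, (k z + q z) * (k z - q z) = 1 := by
    intro z hz; linear_combination - hq2 z hz
  obtain ⟨G, hG, hGe⟩ := exists_holo_log hconv hopen (g := fun z => k z + q z)
    (hk.add ((hl.div_const 2).cexp)) (by
      intro z hz h0
      have := hprod z hz
      rw [h0] at this; simp at this)
  have hcosh : ∀ z ∈ Metric.ball c R, Complex.cosh (G z) = k z := by
    intro z hz
    have h1 := hGe z hz
    have h2 : exp (-G z) = k z - q z := by
      rw [Complex.exp_neg, h1]
      exact inv_eq_of_mul_eq_one_right (hprod z hz)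
    rw [Complex.cosh, h1, h2]; ring
  have hder : ∀ w ∈ Metric.ball c (R/2), ‖deriv G w‖ ≤ 384 / R := by
    intro w hw
    have hsub : Metric.ball w (R/2) ⊆ Metric.ball c R := by
      apply Metric.ball_subset_ball'
      have : dist w c < R/2 := hw
      linarith
    have := bloch (hG.mono hsub) (fun v => ?_) (by linarith)
    · rw [le_div_iff₀ hR]; linarith
    · obtain ⟨x, hx, n, hn⟩ := exists_cosh_int v
      refine ⟨x, hx, ?_⟩
      rintro ⟨z, hz, rfl⟩
      exact hom z (hsub hz) n (by rw [← hcosh z (hsub hz), hn])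
  intro w hw
  have hcc : c ∈ Metric.ball c (R/2) := Metric.mem_ball_self (by linarith)
  have hss : Metric.ball c (R/2) ⊆ Metric.ball c R := Metric.ball_subset_ball (by linarith)
  have h1 : ‖G w - G c‖ ≤ 384 / R * ‖w - c‖ :=
    (convex_ball c (R/2)).norm_image_sub_le_of_norm_deriv_le
      (fun x hx => hG.differentiableAt (hopen.mem_nhds (hss hx))) hder hcc hw
  have h2 : ‖G w - G c‖ ≤ 192 := by
    refine h1.trans ?_
    have : ‖w - c‖ ≤ R / 2 := by rw [← dist_eq_norm]; exact (show dist w c < R/2 from hw).le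
    calc 384 / R * ‖w - c‖ ≤ 384 / R * (R/2) := by gcongr
      _ = 192 := by field_simp; norm_num
  have h3 : |(G w).re| ≤ 192 + |(G c).re| := by
    have := (Complex.abs_re_le_norm (G w - G c)).trans h2
    rw [Complex.sub_re] at this
    have := abs_sub_abs_le_abs_sub (G w).re (G c).re
    linarith
  have h4 : Real.exp |(G c).re| ≤ 2 * ‖k c‖ + 1 := by
    rw [← hcosh c (hss hcc), Complex.cosh]
    have e1 : |‖exp (G c)‖ - ‖exp (-G c)‖| ≤ ‖exp (G c) + exp (-G c)‖ := by
      have := abs_norm_sub_norm_le (exp (G c)) (-exp (-G c))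
      simpa using this
    rw [Complex.norm_exp, Complex.norm_exp, Complex.neg_re] at e1
    rw [norm_div]
    simp only [Complex.norm_ofNat]
    rcases abs_cases (G c).re with ⟨h, h'⟩ | ⟨h, h'⟩
    · rw [h]
      have := Real.exp_le_one_iff.2 (show -(G c).re ≤ 0 by linarith)
      have := (abs_le.1 e1).2
      linarith [neg_abs_le (Real.exp (G c).re - Real.exp (-(G c).re)), le_abs_self (Real.exp (G c).re - Real.exp (-(G c).re))]
    · rw [h]
      have := Real.exp_le_one_iff.2 (show (G c).re ≤ 0 by linarith)
      linarith [neg_abs_le (Real.exp (G c).re - Real.exp (-(G c).re)), le_abs_self (Real.exp (G c).re - Real.exp (-(G c).re))]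
  rw [← hcosh w (hss hw)]
  have h5 : ‖Complex.cosh (G w)‖ ≤ Real.exp |(G w).re| := by
    rw [Complex.cosh, norm_div]
    simp only [Complex.norm_ofNat]
    rw [div_le_iff₀ (by norm_num)]
    refine (norm_add_le _ _).trans ?_
    rw [Complex.norm_exp, Complex.norm_exp, Complex.neg_re]
    have a1 := Real.exp_le_exp.2 (le_abs_self (G w).re)
    have a2 := Real.exp_le_exp.2 (neg_le_abs (G w).re)
    linarith
  refine h5.trans ?_
  calc Real.exp |(G w).re| ≤ Real.exp (192 + |(G c).re|) := Real.exp_le_exp.2 h3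
    _ = Real.exp 192 * Real.exp |(G c).re| := Real.exp_add _ _
    _ ≤ _ := by gcongr

/-- constant in Schottky -/
def CS : ℝ := 10 * Real.exp 192

lemma CS_pos : 0 < CS := by unfold CS; positivity
lemma one_le_CS : 1 ≤ CS := by unfold CS; linarith [Real.add_one_le_exp 192]

lemma schottky {h : ℂ → ℂ} {c : ℂ} {R : ℝ} (hR : 0 < R) (hh : DifferentiableOn ℂ h (Metric.ball c R))
    (hom : ∀ z ∈ Metric.ball c R, ∀ n : ℤ, h z ≠ n * (2 * Real.pi * I)) :
    ∀ w ∈ Metric.ball c (R / 2), ‖h w - (h c).im * I‖ ≤ 2 * CS * (1 + |(h c).re|) := by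
  intro w hw
  have hp := Real.pi_pos
  have hpi : (2 * Real.pi * I : ℂ) ≠ 0 := by simp [Real.pi_ne_zero]
  set n := round ((h c).im / (2 * Real.pi)) with hn
  have hn2 : |(h c).im / (2 * Real.pi) - n| ≤ 1/2 := abs_sub_round _
  set k : ℂ → ℂ := fun z => h z / (2 * Real.pi * I) - n with hk
  have h1 := schottky_int (k := k) hR ((hh.div_const _).sub_const _) (by
    intro z hz m hm
    apply hom z hz (m + n)
    simp only [hk] at hm
    rw [sub_eq_iff_eq_add, div_eq_iff hpi] at hm
    rw [hm]; push_cast; ring) w hw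
  have e : ∀ z, h z - (h c).im * I = (2 * Real.pi * I) * (k z - ((h c).im / (2 * Real.pi) - n : ℝ)) := by
    intro z
    simp only [hk]; push_cast
    have : (Real.pi : ℂ) ≠ 0 := by simp [Real.pi_ne_zero]
    field_simp
    ring
  have hnorm : ‖(2 * Real.pi * I : ℂ)‖ = 2 * Real.pi := by
    simp [abs_of_pos hp]
  have hkc : 2 * Real.pi * ‖k c‖ ≤ |(h c).re| + Real.pi := by
    have e2 := e c
    have : h c - (h c).im * I = ((h c).re : ℂ) := by
      apply Complex.ext <;> simp
    rw [this] at e2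
    have e3 : (2 * Real.pi * I) * k c = ((h c).re : ℂ) + (2 * Real.pi * I) * ((h c).im / (2 * Real.pi) - n : ℝ) := by
      rw [e2]; ring
    rw [← hnorm, ← norm_mul, e3]
    refine (norm_add_le _ _).trans ?_
    rw [norm_mul, hnorm, Complex.norm_real, Complex.norm_real, Real.norm_eq_abs, Real.norm_eq_abs]
    nlinarith
  rw [e w, norm_mul, hnorm]
  have h6 : ‖k w - ((h c).im / (2 * Real.pi) - n : ℝ)‖ ≤ ‖k w‖ + 1/2 := by
    refine (norm_sub_le _ _).trans ?_
    rw [Complex.norm_real, Real.norm_eq_abs]; linarith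
  have hE : 1 ≤ Real.exp 192 := by linarith [Real.add_one_le_exp 192]
  have hp4 := Real.pi_lt_four
  unfold CS
  set E := Real.exp 192
  calc 2 * Real.pi * ‖k w - ((h c).im / (2 * Real.pi) - n : ℝ)‖ ≤ 2 * Real.pi * (E * (2 * ‖k c‖ + 1) + 1/2) := by
        gcongr; linarith
    _ = E * (2 * (2 * Real.pi * ‖k c‖) + 2 * Real.pi) + Real.pi := by ring
    _ ≤ E * (2 * (|(h c).re| + Real.pi) + 2 * Real.pi) + E * Real.pi := by
        gcongr; nlinarith
    _ ≤ 2 * (10 * E) * (1 + |(h c).re|) := by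
        nlinarith [abs_nonneg (h c).re, mul_nonneg (by linarith : 0 ≤ E) (abs_nonneg (h c).re)]

/-- omitting the lattice -/
def Omit (h : ℂ → ℂ) (z : ℂ) : Prop := ∀ n : ℤ, h z ≠ n * (2 * Real.pi * I)

def KS : ℝ := 2 * CS + 1
lemma one_le_KS : 1 ≤ KS := by unfold KS; linarith [CS_pos]

lemma schottky_re {h : ℂ → ℂ} {c : ℂ} {R : ℝ} (hR : 0 < R) (hh : DifferentiableOn ℂ h (Metric.ball c R))
    (hom : ∀ z ∈ Metric.ball c R, Omit h z) :
    ∀ w ∈ Metric.ball c (R / 2), 1 + |(h w).re| ≤ KS * (1 + |(h c).re|) := by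
  intro w hw
  have h1 := schottky hR hh hom w hw
  have h2 := (Complex.abs_re_le_norm (h w - (h c).im * I)).trans h1
  simp at h2
  unfold KS
  nlinarith [abs_nonneg (h c).re]

lemma schottky_deriv {h : ℂ → ℂ} {c : ℂ} {R : ℝ} (hR : 0 < R) (hh : DifferentiableOn ℂ h (Metric.ball c R))
    (hom : ∀ z ∈ Metric.ball c R, Omit h z) :
    ‖deriv h c‖ ≤ 4 * KS * (1 + |(h c).re|) / R := by
  have h1 := schottky hR hh hom
  have h2 : ‖deriv (fun z => h z - (h c).im * I) c‖ ≤ KS * (1 + |(h c).re|) / (R / 4) := by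
    refine Complex.norm_deriv_le_of_forall_mem_sphere_norm_le (by linarith) ?_ ?_
    · refine DifferentiableOn.diffContOnCl ?_
      refine (hh.sub_const _).mono ?_
      exact Metric.closure_ball_subset_closedBall.trans (Metric.closedBall_subset_ball (by linarith))
    · intro z hz
      refine (h1 z (Metric.sphere_subset_closedBall.trans (Metric.closedBall_subset_ball (by linarith)) hz)).trans ?_
      unfold KS
      nlinarith [abs_nonneg (h c).re]
  rw [deriv_sub_const] at h2
  convert h2 using 1
  field_simp

lemma crossing_half {h : ℂ → ℂ} {κ : ℕ} (hκ : KS ≤ (3/2:ℝ)^κ) (hh : DifferentiableOn ℂ h (Metric.ball 0 3))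
    (hom : ∀ z ∈ Metric.ball (0:ℂ) 3, z.im ≠ 0 → Omit h z) (x y : ℝ) (hx : |x| < 1/2) (hy : 0 < y) (hy1 : y ≤ 1) :
    ‖deriv h (x + y * I)‖ * y ^ (κ+1) ≤ 4 * KS * (KS * (KS * (1 + |(h I).re|))) := by
  have hball : ∀ y : ℝ, 0 < y → y ≤ 1 → ∀ x : ℝ, |x| < 1/2 → Metric.ball (x + y * I : ℂ) y ⊆ Metric.ball 0 3 := by
    intro y hy hy1 x hx
    apply Metric.ball_subset_ball'
    rw [dist_zero_right]
    have := norm_add_le (x:ℂ) (y * I)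
    simp [abs_of_pos hy] at this
    linarith
  have hpos : ∀ y : ℝ, ∀ x : ℝ, ∀ z ∈ Metric.ball (x + y * I : ℂ) y, 0 < z.im := by
    intro y x z hz
    have h1 := (Complex.abs_im_le_norm (z - (x + y * I)))
    rw [mem_ball_iff_norm] at hz
    simp at h1
    have := (abs_le.1 (h1.trans hz.le)).1
    have := (abs_lt.1 (lt_of_le_of_lt h1 hz)).1
    linarith
  have hs : ∀ y : ℝ, 0 < y → y ≤ 1 → ∀ x : ℝ, |x| < 1/2 → DifferentiableOn ℂ h (Metric.ball (x + y * I) y)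
      ∧ ∀ z ∈ Metric.ball (x + y * I : ℂ) y, Omit h z := by
    intro y hy hy1 x hx
    exact ⟨hh.mono (hball y hy hy1 x hx), fun z hz => hom z (hball y hy hy1 x hx hz) (hpos y x z hz).ne'⟩
  have hK := one_le_KS
  have key : ∀ n : ℕ, ∀ y : ℝ, (2/3:ℝ)^(n+1) ≤ y → y ≤ 1 → (1 + |(h (x + y * I)).re|) * y^κ ≤ KS * (KS * (1 + |(h I).re|)) := by
    intro n
    induction n with
    | zero =>
      intro y hy hy1
      have hy : 2/3 ≤ y := by simpa using hy
      have h1 := hs 1 one_pos le_rfl 0 (by norm_num)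
      have h2 := schottky_re one_pos h1.1 h1.2 (x + (1:ℝ) * I) (by
        rw [mem_ball_iff_norm]; simpa using hx)
      have h1 := hs 1 one_pos le_rfl x hx
      have h3 := schottky_re (by linarith) h1.1 h1.2 (x + y * I) (by
        rw [mem_ball_iff_norm]
        have : (x + y * I : ℂ) - (x + (1 : ℝ) * I) = ((y - 1 : ℝ) : ℂ) * I := by
          push_cast; ring
        rw [this, norm_mul, Complex.norm_real]; simp; rw [abs_lt]; constructor <;> linarith)
      have h4 : y^κ ≤ 1 := pow_le_one₀ (by linarith) hy1
      calc (1 + |(h (x + y * I)).re|) * y^κ ≤ (1 + |(h (x + y * I)).re|) * 1 := by gcongr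
        _ ≤ KS * (1 + |(h (x + (1:ℝ) * I)).re|) := by linarith
        _ ≤ _ := by
          gcongr; simpa using h2
    | succ n ih =>
      intro y hy hy1
      rcases le_or_gt ((2/3:ℝ)^(n+1)) y with hc | hc
      · exact ih y hc hy1
      · have hy0 : 0 < y := lt_of_lt_of_le (by positivity) hy
        have hle : (2/3:ℝ)^n ≤ 1 := pow_le_one₀ (by norm_num) (by norm_num)
        have hbig : 3/2 * y ≤ 1 := by rw [pow_succ] at hc; linarith
        have h2 := ih (3/2 * y) (by rw [pow_succ] at hy; linarith) hbig
        have h1 := hs (3/2*y) (by linarith) hbig x hx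
        have h3 := schottky_re (by linarith) h1.1 h1.2 (x + y * I) (by
          rw [mem_ball_iff_norm]
          have : (x + y * I : ℂ) - (x + (3/2*y : ℝ) * I) = ((- (y/2) : ℝ) : ℂ) * I := by
            push_cast; ring
          rw [this, norm_mul, Complex.norm_real]; simp; rw [abs_of_pos hy0]; linarith)
        calc (1 + |(h (x + y * I)).re|) * y^κ ≤ ((3/2:ℝ)^κ * (1 + |(h (x + (3/2*y:ℝ) * I)).re|)) * y^κ := by
              gcongr; exact h3.trans (by gcongr)
          _ = (1 + |(h (x + (3/2*y:ℝ) * I)).re|) * (3/2 * y)^κ := by rw [mul_pow]; ring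
          _ ≤ _ := h2
  obtain ⟨n, hn⟩ := exists_pow_lt_of_lt_one hy (show (2/3:ℝ) < 1 by norm_num)
  have hn' : (2/3:ℝ)^(n+1) ≤ y := by
    rw [pow_succ]; nlinarith [show 0 < (2/3:ℝ)^n by positivity]
  have h2 := key n y hn' hy1
  have h1 := hs y hy hy1 x hx
  have h3 := schottky_deriv hy h1.1 h1.2
  calc ‖deriv h (x + y * I)‖ * y ^ (κ+1) ≤ (4 * KS * (1 + |(h (x + y * I)).re|) / y) * y^(κ+1) := by gcongr
    _ = 4 * KS * ((1 + |(h (x + y * I)).re|) * y^κ) := by rw [pow_succ]; field_simp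
    _ ≤ _ := by gcongr

lemma crossing0 : ∃ C : ℝ, 0 < C ∧ ∀ h : ℂ → ℂ, DifferentiableOn ℂ h (Metric.ball 0 3) →
    (∀ z ∈ Metric.ball (0:ℂ) 3, z.im ≠ 0 → Omit h z) →
    ∀ z ∈ Metric.ball (0:ℂ) (1/4), ‖deriv h z‖ ≤ C * (1 + |(h I).re| + |(h (-I)).re|) := by
  obtain ⟨κ, hκ⟩ := pow_unbounded_of_one_lt KS (show (1:ℝ) < 3/2 by norm_num)
  have hK := one_le_KS
  refine ⟨4 * KS * (KS * KS) * (16/3)^(κ+1), by positivity, ?_⟩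
  intro h hh hom z hz
  set M := 1 + |(h I).re| + |(h (-I)).re| with hM
  have hM1 : 1 + |(h I).re| ≤ M := by linarith [abs_nonneg (h (-I)).re]
  have hM2 : 1 + |(h (-I)).re| ≤ M := by linarith [abs_nonneg (h I).re]
  set F : ℂ → ℂ := fun z => deriv h z * (z^2 - 1/4)^(κ+1) with hF
  have hsub : Metric.closedBall (0:ℂ) (1/2) ⊆ Metric.ball 0 3 := Metric.closedBall_subset_ball (by norm_num)
  have hFd : DifferentiableOn ℂ F (Metric.ball 0 3) := by
    refine (hh.deriv Metric.isOpen_ball).mul ?_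
    fun_prop
  have hcirc : ∀ z : ℂ, ‖z‖ = 1/2 → ‖z^2 - 1/4‖ = |z.im| := by
    intro z hz
    have h1 : z.re^2 + z.im^2 = 1/4 := by
      have := Complex.sq_norm z
      rw [hz, Complex.normSq_apply] at this
      linarith
    rw [← abs_norm, ← sq_eq_sq_iff_abs_eq_abs, Complex.sq_norm, Complex.normSq_apply]
    have e1 : (z^2 - 1/4).re = z.re^2 - z.im^2 - 1/4 := by
      rw [pow_two]; simp; ring
    have e2 : (z^2 - 1/4).im = 2 * z.re * z.im := by
      rw [pow_two]; simp; ring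
    rw [e1, e2]
    have : z.re^2 = 1/4 - z.im^2 := by linarith
    have e3 : (z.re^2 - z.im^2 - 1/4) = -2 * z.im^2 := by linarith
    rw [e3]
    linear_combination 4 * z.im^2 * h1
  have hbd : ∀ z : ℂ, ‖z‖ = 1/2 → ‖F z‖ ≤ 4 * KS * (KS * KS) * M := by
    intro z hz
    simp only [hF]
    rw [norm_mul, norm_pow, hcirc z hz]
    have h1 : z.re^2 + z.im^2 = 1/4 := by
      have := Complex.sq_norm z
      rw [hz, Complex.normSq_apply] at this
      linarith
    have him : |z.im| ≤ 1 := by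
      have := Complex.abs_im_le_norm z; linarith
    rcases lt_trichotomy z.im 0 with hi | hi | hi
    · have hre : |-z.re| < 1/2 := by
        rw [abs_lt]; constructor <;> nlinarith
      have h2 := crossing_half (h := fun z => h (-z)) hκ.le (hh.comp (by fun_prop) (by
        intro z hz; simpa using hz)) (by
        intro z hz hz2 n
        exact hom (-z) (by simpa using hz) (by simpa using hz2) n) (-z.re) (-z.im) hre (by linarith) (by
        rw [abs_of_neg hi] at him; exact him)
      rw [deriv_comp_neg] at h2
      have e : -(((-z.re : ℝ) : ℂ) + (-z.im : ℝ) * I) = z := by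
        push_cast
        conv_rhs => rw [← Complex.re_add_im z]
        ring
      rw [e, norm_neg] at h2
      rw [abs_of_neg hi]
      refine h2.trans ?_
      rw [mul_assoc (4 * KS) (KS * KS) M, mul_assoc KS KS M]
      gcongr
    · rw [hi]; simp; positivity
    · have hre : |z.re| < 1/2 := by
        rw [abs_lt]; constructor <;> nlinarith
      have h2 := crossing_half (h := h) hκ.le hh hom z.re z.im hre hi (by
        rw [abs_of_pos hi] at him; exact him)
      rw [Complex.re_add_im] at h2
      rw [abs_of_pos hi]
      refine h2.trans ?_
      rw [mul_assoc (4 * KS) (KS * KS) M, mul_assoc KS KS M]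
      gcongr
  have hmax : ‖F z‖ ≤ 4 * KS * (KS * KS) * M := by
    refine Complex.norm_le_of_forall_mem_frontier_norm_le (U := Metric.ball 0 (1/2)) Metric.isBounded_ball ?_ ?_ ?_
    · refine DifferentiableOn.diffContOnCl (hFd.mono ?_)
      exact Metric.closure_ball_subset_closedBall.trans hsub
    · intro w hw
      rw [frontier_ball _ (by norm_num)] at hw
      exact hbd w (by simpa using hw)
    · apply subset_closure
      exact Metric.ball_subset_ball (by norm_num) hz
  have hz' : ‖z‖ < 1/4 := by simpa using hz
  have hlow : 3/16 ≤ ‖z^2 - 1/4‖ := by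
    have h1 := norm_sub_norm_le (1/4 : ℂ) (z^2)
    rw [norm_sub_rev, norm_pow] at h1
    have : ‖(1/4:ℂ)‖ = 1/4 := by norm_num
    nlinarith [norm_nonneg z]
  simp only [hF] at hmax
  rw [norm_mul, norm_pow] at hmax
  have h7 : (3/16:ℝ)^(κ+1) ≤ ‖z^2 - 1/4‖^(κ+1) := by gcongr
  have h8 : ‖deriv h z‖ * (3/16:ℝ)^(κ+1) ≤ 4 * KS * (KS * KS) * M :=
    le_trans (by gcongr) hmax
  have h9 : (16/3:ℝ)^(κ+1) * (3/16:ℝ)^(κ+1) = 1 := by rw [← mul_pow]; norm_num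
  calc ‖deriv h z‖ = (‖deriv h z‖ * (3/16:ℝ)^(κ+1)) * (16/3:ℝ)^(κ+1) := by
        rw [mul_assoc, mul_comm ((3/16:ℝ)^(κ+1)), h9, mul_one]
    _ ≤ (4 * KS * (KS * KS) * M) * (16/3:ℝ)^(κ+1) := by gcongr
    _ = _ := by ring

/-- crossing lemma for a disc centered on the line -/
lemma crossing : ∃ C : ℝ, 0 < C ∧ ∀ (h : ℂ → ℂ) (c : ℂ) (r : ℝ), 0 < r → DifferentiableOn ℂ h (Metric.ball c (3*r)) →
    (∀ z ∈ Metric.ball c (3*r), z.im ≠ c.im → Omit h z) →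
    ∀ z ∈ Metric.ball c (r/4), ‖deriv h z‖ ≤ C / r * (1 + |(h (c + r * I)).re| + |(h (c - r * I)).re|) := by
  obtain ⟨C, hC, H⟩ := crossing0
  refine ⟨C, hC, ?_⟩
  intro h c r hr hh hom z hz
  have hrc : (r:ℂ) ≠ 0 := by exact_mod_cast hr.ne'
  have hmap : ∀ w : ℂ, ∀ s : ℝ, w ∈ Metric.ball (0:ℂ) s → c + r * w ∈ Metric.ball c (s*r) := by
    intro w s hw
    rw [mem_ball_iff_norm] at hw ⊢
    simp [abs_of_pos hr] at hw ⊢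
    nlinarith
  have h1 := H (fun w => h (c + r * w)) (hh.comp (by fun_prop) (fun w hw => hmap w 3 hw)) (by
    intro w hw hwi n
    refine hom _ (hmap w 3 hw) ?_ n
    simp [hr.ne', hwi]) ((z - c) / r) (by
    rw [mem_ball_iff_norm] at hz ⊢
    rw [sub_zero, norm_div, Complex.norm_real, Real.norm_eq_abs, abs_of_pos hr, div_lt_iff₀ hr]
    linarith)
  have hd : DifferentiableAt ℂ h z := hh.differentiableAt (Metric.isOpen_ball.mem_nhds
    (Metric.ball_subset_ball (by linarith) hz))
  have hez : c + r * ((z - c) / r) = z := by field_simp; ring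
  have h2 : HasDerivAt (fun w => h (c + r * w)) (deriv h z * r) ((z - c) / r) := by
    have h3 : HasDerivAt (fun w : ℂ => c + r * w) (r : ℂ) ((z - c) / r) := by
      simpa using ((hasDerivAt_id ((z-c)/r)).const_mul (r:ℂ)).const_add c
    have h4 : HasDerivAt h (deriv h z) (c + r * ((z - c) / r)) := by rw [hez]; exact hd.hasDerivAt
    exact HasDerivAt.comp (h := fun w : ℂ => c + r * w) _ h4 h3
  rw [h2.deriv, norm_mul, Complex.norm_real, Real.norm_eq_abs, abs_of_pos hr] at h1
  have e : c + r * -I = c - r * I := by ring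
  rw [e] at h1
  rw [div_mul_eq_mul_div, le_div_iff₀ hr]
  exact h1

/-- eventually (along `l`) locally bounded holomorphic family -/
def LocBdd {ι : Type*} (l : Filter ι) (φ : ι → ℂ → ℂ) (U : Set ℂ) : Prop :=
  ∀ z ∈ U, ∃ r > 0, ∃ B : ℝ, Metric.ball z r ⊆ U ∧
    ∀ᶠ s in l, DifferentiableOn ℂ (φ s) (Metric.ball z r) ∧ ∀ w ∈ Metric.ball z r, ‖φ s w‖ ≤ B

lemma montel {ι : Type*} (l : Ultrafilter ι) {φ : ι → ℂ → ℂ} {U : Set ℂ}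
    (hb : LocBdd (l : Filter ι) φ U) :
    ∃ L : ℂ → ℂ, DifferentiableOn ℂ L U ∧ TendstoLocallyUniformlyOn φ L l U ∧
      (∀ z ∈ U, Tendsto (fun s => φ s z) l (𝓝 (L z))) ∧
      ∀ z ∈ U, Tendsto (fun s => deriv (φ s) z) l (𝓝 (deriv L z)) := by
  have hpt : ∀ z : ℂ, ∃ y, z ∈ U → Tendsto (fun s => φ s z) l (𝓝 y) := by
    intro z
    by_cases hz : z ∈ U
    · obtain ⟨r, hr, B, -, hB⟩ := hb z hz
      have h1 : ((l.map (fun s => φ s z) : Ultrafilter ℂ) : Filter ℂ) ≤ 𝓟 (Metric.closedBall 0 B) := by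
        rw [le_principal_iff]
        refine Filter.mem_map.2 ?_
        filter_upwards [hB] with s hs
        simpa using hs.2 z (Metric.mem_ball_self hr)
      obtain ⟨y, -, hy⟩ := (isCompact_closedBall (0:ℂ) B).ultrafilter_le_nhds _ h1
      exact ⟨y, fun _ => hy⟩
    · exact ⟨0, fun h => absurd h hz⟩
  choose L hL using hpt
  have hloc : TendstoLocallyUniformlyOn φ L l U := by
    rw [Metric.tendstoLocallyUniformlyOn_iff]
    intro ε hε x hx
    obtain ⟨r, hr, B, hsub, hB⟩ := hb x hx
    set K : ℝ := 2 * |B| / (r) with hK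
    have hK0 : 0 ≤ K := by positivity
    have hlip : ∀ᶠ s in (l : Filter ι), ∀ w ∈ Metric.ball x r, dist (φ s w) (φ s x) ≤ K * dist w x := by
      filter_upwards [hB] with s hs w hw
      refine Complex.dist_le_div_mul_dist_of_mapsTo_ball hs.1 ?_ hw
      intro v hv
      rw [Metric.mem_closedBall, dist_eq_norm]
      have h1 := hs.2 v hv
      have h2 := hs.2 x (Metric.mem_ball_self hr)
      have h3 := norm_sub_le (φ s v) (φ s x)
      have := le_abs_self B
      linarith
    have hlipL : ∀ w ∈ Metric.ball x r, dist (L w) (L x) ≤ K * dist w x := by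
      intro w hw
      refine le_of_tendsto ((hL w (hsub hw)).dist (hL x hx)) ?_
      filter_upwards [hlip] with s hs using hs w hw
    obtain ⟨δ, hδ, hδr, hδK⟩ : ∃ δ > 0, δ ≤ r ∧ K * δ ≤ ε / 4 := by
      refine ⟨min r (ε / 4 / (K + 1)), by positivity, min_le_left _ _, ?_⟩
      calc K * min r (ε/4/(K+1)) ≤ (K+1) * (ε/4/(K+1)) := by
            gcongr
            · linarith
            · exact min_le_right _ _
        _ = ε/4 := by field_simp
    refine ⟨Metric.ball x δ, mem_nhdsWithin_of_mem_nhds (Metric.ball_mem_nhds x hδ), ?_⟩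
    have hx' := Metric.tendsto_nhds.1 (hL x hx) (ε/4) (by linarith)
    filter_upwards [hlip, hx'] with s h1 h2 w hw
    have hwr := Metric.ball_subset_ball hδr hw
    have h3 := h1 w hwr
    have h4 := hlipL w hwr
    have h5 : K * dist w x ≤ ε / 4 := le_trans (by gcongr; exact (show dist w x < δ from hw).le) hδK
    have := dist_triangle (L w) (L x) (φ s w)
    have := dist_triangle (L x) (φ s x) (φ s w)
    rw [dist_comm (φ s x) (φ s w), dist_comm (L x) (φ s x)] at this
    linarith
  refine ⟨L, ?_, hloc, fun z hz => hL z hz, ?_⟩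
  · intro z hz
    obtain ⟨r, hr, B, hsub, hB⟩ := hb z hz
    have := (hloc.mono hsub).differentiableOn (by filter_upwards [hB] with s hs using hs.1) Metric.isOpen_ball
    exact (this.differentiableAt (Metric.ball_mem_nhds z hr)).differentiableWithinAt
  · intro z hz
    obtain ⟨r, hr, B, hsub, hB⟩ := hb z hz
    have := (hloc.mono hsub).deriv (by filter_upwards [hB] with s hs using hs.1) Metric.isOpen_ball
    exact this.tendsto_at (Metric.mem_ball_self hr)

/-- local version of uniform convergence -/
lemma TendstoLocallyUniformlyOn.exists_ball {ι : Type*} {l : Filter ι} {φ : ι → ℂ → ℂ} {L : ℂ → ℂ} {U : Set ℂ}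
    (h : TendstoLocallyUniformlyOn φ L l U) (hU : IsOpen U) (hL : ContinuousOn L U) {z : ℂ} (hz : z ∈ U) {ε : ℝ} (hε : 0 < ε) :
    ∃ r > 0, Metric.ball z r ⊆ U ∧ ∀ᶠ s in l, ∀ w ∈ Metric.ball z r, ‖φ s w - L z‖ < ε := by
  obtain ⟨t, ht, htt⟩ := Metric.tendstoLocallyUniformlyOn_iff.1 h (ε/2) (by linarith) z hz
  rw [hU.nhdsWithin_eq hz] at ht
  have h1 := Metric.tendsto_nhds.1 (hL.continuousAt (hU.mem_nhds hz)) (ε/2) (by linarith)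
  obtain ⟨r, hr, hrs⟩ := Metric.mem_nhds_iff.1 (inter_mem (inter_mem ht (hU.mem_nhds hz)) h1)
  refine ⟨r, hr, fun w hw => (hrs hw).1.2, ?_⟩
  filter_upwards [htt] with s hs w hw
  have h2 := hs w (hrs hw).1.1
  have h3 : dist (L w) (L z) < ε/2 := (hrs hw).2
  rw [← dist_eq_norm]
  have := dist_triangle (φ s w) (L w) (L z)
  rw [dist_comm (φ s w) (L w)] at this
  linarith

def Str (α β : ℝ) : Set ℂ := {w | α < w.im ∧ w.im < β}

lemma isOpen_Str (α β : ℝ) : IsOpen (Str α β) :=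
  (isOpen_lt continuous_const Complex.continuous_im).inter (isOpen_lt Complex.continuous_im continuous_const)

lemma convex_Str (α β : ℝ) : Convex ℝ (Str α β) :=
  (convex_halfSpace_im_gt α).inter (convex_halfSpace_im_lt β)

lemma preconn_Str (α β : ℝ) : IsPreconnected (Str α β) := (convex_Str α β).isPreconnected

lemma Str_mono {α β α' β' : ℝ} (h1 : α' ≤ α) (h2 : β ≤ β') : Str α β ⊆ Str α' β' :=
  fun _ hw => ⟨lt_of_le_of_lt h1 hw.1, lt_of_lt_of_le hw.2 h2⟩

lemma exists_ball_Str {α β : ℝ} {w : ℂ} (hw : w ∈ Str α β) : ∃ r > 0, Metric.ball w r ⊆ Str α β :=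
  Metric.isOpen_iff.1 (isOpen_Str α β) w hw

lemma add_real_mem_Str {α β : ℝ} {w : ℂ} {s : ℝ} : w + s ∈ Str α β ↔ w ∈ Str α β := by
  simp [Str]

structure Strip (h : ℂ → ℂ) (tm t tp s0 : ℝ) : Prop where
  lt1 : tm < t
  lt2 : t < tp
  diff : DifferentiableOn ℂ h {w | s0 < w.re ∧ w ∈ Str tm tp}
  om : ∀ w, s0 < w.re → w ∈ Str tm tp → w.im ≠ t → Omit h w

namespace Strip
variable {h : ℂ → ℂ} {tm t tp s0 : ℝ}

lemma isOpen_dom : IsOpen {w : ℂ | s0 < w.re ∧ w ∈ Str tm tp} :=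
  (isOpen_lt continuous_const Complex.continuous_re).inter (isOpen_Str tm tp)

lemma ball_shift {z w : ℂ} {r : ℝ} {s : ℝ} : z ∈ Metric.ball (w + s) r ↔ z - s ∈ Metric.ball w r := by
  rw [mem_ball_iff_norm, mem_ball_iff_norm]
  have : z - (w + s) = z - s - w := by ring
  rw [this]

lemma ball_shift' {z w : ℂ} {r : ℝ} {s : ℝ} : z + s ∈ Metric.ball (w + s) r ↔ z ∈ Metric.ball w r := by
  rw [ball_shift]; simp

lemma ev_dom {w : ℂ} {r : ℝ} (hs : Metric.ball w r ⊆ Str tm tp) :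
    ∀ᶠ s : ℝ in atTop, Metric.ball (w + s) r ⊆ {w | s0 < w.re ∧ w ∈ Str tm tp} := by
  filter_upwards [eventually_gt_atTop (s0 + r - w.re)] with s hs' z hz
  rw [ball_shift] at hz
  constructor
  · rw [mem_ball_iff_norm] at hz
    have := (Complex.abs_re_le_norm _).trans_lt hz
    have := (abs_lt.1 this).1
    simp at this
    linarith
  · have := hs hz
    rw [← add_real_mem_Str (s := s)] at this
    simpa using this

lemma cmp_sub (H : Strip h tm t tp s0) {l : Filter ℝ} (hl : l ≤ atTop) {α β : ℝ} (hα : tm ≤ α) (hβ : β ≤ tp)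
    (ht : t ≤ α ∨ β ≤ t) {x y : ℂ} (hx : x ∈ Str α β) (hy : y ∈ Str α β) :
    ∃ K : ℝ, 0 < K ∧ ∀ᶠ s : ℝ in l, 1 + |(h (x + s)).re| ≤ K * (1 + |(h (y + s)).re|) := by
  have hK := one_le_KS
  refine (preconn_Str α β).induction₂' (fun x y => ∃ K : ℝ, 0 < K ∧ ∀ᶠ s : ℝ in l, 1 + |(h (x + s)).re| ≤ K * (1 + |(h (y + s)).re|))
    ?_ ?_ hx hy
  · intro x hx
    obtain ⟨r, hr, hrs⟩ := exists_ball_Str hx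
    have hne : ∀ z ∈ Str α β, z.im ≠ t := by
      intro z hz hzt
      rcases ht with h1 | h1
      · exact absurd hz.1 (by rw [hzt]; linarith)
      · exact absurd hz.2 (by rw [hzt]; linarith)
    have hdo := hl (ev_dom (s0 := s0) (hrs.trans (Str_mono hα hβ)))
    have hom : ∀ᶠ s : ℝ in l, DifferentiableOn ℂ h (Metric.ball (x+s) r) ∧ ∀ z ∈ Metric.ball (x + s) r, Omit h z := by
      filter_upwards [hdo] with s hs
      refine ⟨H.diff.mono hs, fun z hz => H.om z (hs hz).1 (hs hz).2 ?_⟩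
      have := hne _ (hrs (ball_shift.1 hz))
      simpa using this
    refine mem_nhdsWithin_of_mem_nhds ?_
    filter_upwards [Metric.ball_mem_nhds x (show 0 < r/4 by linarith)] with y hy
    have hyd : dist y x < r/4 := hy
    refine ⟨⟨KS, by linarith, ?_⟩, ⟨KS, by linarith, ?_⟩⟩
    · filter_upwards [hom] with s hs
      have hsub : Metric.ball (y + s) (r/2) ⊆ Metric.ball (x+s) r := by
        apply Metric.ball_subset_ball'
        rw [dist_add_right]; linarith
      refine schottky_re (by linarith : 0 < r/2) (hs.1.mono hsub) (fun z hz => hs.2 z (hsub hz)) _ ?_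
      rw [Metric.mem_ball, dist_add_right, dist_comm]; linarith
    · filter_upwards [hom] with s hs
      refine schottky_re hr (hs.1) hs.2 _ ?_
      rw [Metric.mem_ball, dist_add_right]; linarith
  · rintro x y z - - - ⟨K1, hK1, h1⟩ ⟨K2, hK2, h2⟩
    refine ⟨K1 * K2, by positivity, ?_⟩
    filter_upwards [h1, h2] with s h1 h2
    rw [mul_assoc]
    exact h1.trans (by gcongr)

/-- local derivative bound -/
def DBd (h : ℂ → ℂ) (l : Filter ℝ) (W : ℝ → ℝ) (α β : ℝ) : Prop :=
  ∀ w ∈ Str α β, ∃ r > 0, ∃ B : ℝ, 0 ≤ B ∧ Metric.ball w r ⊆ Str α β ∧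
    ∀ᶠ s : ℝ in l, ∀ z ∈ Metric.ball w r, DifferentiableAt ℂ h (z + s) ∧ ‖deriv h (z + s)‖ ≤ B * W s

lemma dbd_sub (H : Strip h tm t tp s0) {l : Filter ℝ} (hl : l ≤ atTop) {α β : ℝ} (hα : tm ≤ α) (hβ : β ≤ tp)
    (ht : t ≤ α ∨ β ≤ t) {a : ℂ} (ha : a ∈ Str α β) : DBd h l (fun s => 1 + |(h (a + s)).re|) α β := by
  intro w hw
  have hK := one_le_KS
  obtain ⟨K, hK0, hcmp⟩ := H.cmp_sub hl hα hβ ht hw ha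
  obtain ⟨r, hr, hrs⟩ := exists_ball_Str hw
  have hne : ∀ z ∈ Str α β, z.im ≠ t := by
    intro z hz hzt
    rcases ht with h1 | h1
    · exact absurd hz.1 (by rw [hzt]; linarith)
    · exact absurd hz.2 (by rw [hzt]; linarith)
  have hdo := hl (ev_dom (s0 := s0) (hrs.trans (Str_mono hα hβ)))
  refine ⟨r/2, by linarith, 4 * KS * (KS * K) / (r/2), by positivity, (Metric.ball_subset_ball (by linarith)).trans hrs, ?_⟩
  filter_upwards [hdo, hcmp] with s hs hc z hz
  have hzs : z + s ∈ Metric.ball (w + s) (r/2) := ball_shift'.2 hz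
  have hsub : Metric.ball (z + s) (r/2) ⊆ Metric.ball (w + s) r := by
    apply Metric.ball_subset_ball'
    have : dist (z+s) (w+s) < r/2 := hzs
    linarith
  have hom : ∀ v ∈ Metric.ball (w + s) r, Omit h v := by
    intro v hv
    refine H.om v (hs hv).1 (hs hv).2 ?_
    have := hne _ (hrs (ball_shift.1 hv))
    simpa using this
  have hd : DifferentiableOn ℂ h (Metric.ball (w+s) r) := H.diff.mono hs
  refine ⟨hd.differentiableAt (Metric.isOpen_ball.mem_nhds (Metric.ball_subset_ball (by linarith) hzs)), ?_⟩
  have h1 := schottky_deriv (by linarith : 0 < r/2) (hd.mono hsub) (fun v hv => hom v (hsub hv))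
  have h2 := schottky_re hr hd hom _ hzs
  refine h1.trans ?_
  rw [div_mul_eq_mul_div]
  refine div_le_div_of_nonneg_right ?_ (by linarith)
  calc 4 * KS * (1 + |(h (z+s)).re|) ≤ 4 * KS * (KS * (1 + |(h (w+s)).re|)) := by gcongr
    _ ≤ 4 * KS * (KS * (K * (1 + |(h (a+s)).re|))) := by gcongr
    _ = _ := by ring

lemma dbd (H : Strip h tm t tp s0) {l : Filter ℝ} (hl : l ≤ atTop)
    {a b : ℂ} (ha : a ∈ Str tm t) (hb : b ∈ Str t tp) :
    DBd h l (fun s => 1 + |(h (a + s)).re| + |(h (b + s)).re|) tm tp := by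
  intro w hw
  rcases lt_trichotomy w.im t with hwt | hwt | hwt
  · obtain ⟨r, hr, B, hB, hrs, hev⟩ := H.dbd_sub hl le_rfl H.lt2.le (Or.inr le_rfl) ha w ⟨hw.1, hwt⟩
    refine ⟨r, hr, B, hB, hrs.trans (Str_mono le_rfl H.lt2.le), ?_⟩
    filter_upwards [hev] with s hs z hz
    refine ⟨(hs z hz).1, (hs z hz).2.trans ?_⟩
    refine mul_le_mul_of_nonneg_left ?_ hB
    linarith [abs_nonneg (h (b+s)).re]
  · obtain ⟨C, hC, hcr⟩ := crossing
    obtain ⟨r', hr', hrs'⟩ := exists_ball_Str hw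
    set r := r'/3 with hr
    have hr0 : 0 < r := by linarith
    have hrs : Metric.ball w (3*r) ⊆ Str tm tp := by
      have : 3 * r = r' := by rw [hr]; ring
      rw [this]; exact hrs'
    have hp1 : w + r * I ∈ Str t tp := by
      have : w + r * I ∈ Metric.ball w (3*r) := by
        rw [mem_ball_iff_norm]; simp [abs_of_pos hr0]; linarith
      refine ⟨?_, (hrs this).2⟩
      simp; linarith
    have hp2 : w - r * I ∈ Str tm t := by
      have : w - r * I ∈ Metric.ball w (3*r) := by
        rw [mem_ball_iff_norm]; simp [abs_of_pos hr0]; linarith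
      refine ⟨(hrs this).1, ?_⟩
      simp; linarith
    obtain ⟨K1, hK1, hc1⟩ := H.cmp_sub hl H.lt1.le le_rfl (Or.inl le_rfl) hp1 hb
    obtain ⟨K2, hK2, hc2⟩ := H.cmp_sub hl le_rfl H.lt2.le (Or.inr le_rfl) hp2 ha
    have hdo := hl (ev_dom (s0 := s0) hrs)
    refine ⟨r/4, by linarith, C / r * (K1 + K2), by positivity, (Metric.ball_subset_ball (by linarith)).trans hrs, ?_⟩
    filter_upwards [hdo, hc1, hc2] with s hs hc1 hc2 z hz
    have hd : DifferentiableOn ℂ h (Metric.ball (w+s) (3*r)) := H.diff.mono hs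
    have hzs : z + s ∈ Metric.ball (w + s) (r/4) := ball_shift'.2 hz
    refine ⟨hd.differentiableAt (Metric.isOpen_ball.mem_nhds (Metric.ball_subset_ball (by linarith) hzs)), ?_⟩
    have h1 := hcr h (w+s) r hr0 hd (fun v hv hvi => H.om v (hs hv).1 (hs hv).2 (by
      simpa [hwt] using hvi)) _ hzs
    refine h1.trans ?_
    rw [mul_assoc]
    gcongr
    have e1 : w + s + r * I = w + r * I + s := by ring
    have e2 : w + s - r * I = w - r * I + s := by ring
    rw [e1, e2]
    have p1 := abs_nonneg (h (a+s)).re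
    have p2 := abs_nonneg (h (b+s)).re
    nlinarith [mul_nonneg hK1.le p1, mul_nonneg hK2.le p2]
  · obtain ⟨r, hr, B, hB, hrs, hev⟩ := H.dbd_sub hl H.lt1.le le_rfl (Or.inl le_rfl) hb w ⟨hwt, hw.2⟩
    refine ⟨r, hr, B, hB, hrs.trans (Str_mono H.lt1.le le_rfl), ?_⟩
    filter_upwards [hev] with s hs z hz
    refine ⟨(hs z hz).1, (hs z hz).2.trans ?_⟩
    refine mul_le_mul_of_nonneg_left ?_ hB
    linarith [abs_nonneg (h (a+s)).re]

lemma ball_diff {l : Filter ℝ} {W : ℝ → ℝ} {w : ℂ} {r B : ℝ}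
    (hev : ∀ᶠ s : ℝ in l, ∀ z ∈ Metric.ball w r, DifferentiableAt ℂ h (z + s) ∧ ‖deriv h (z + s)‖ ≤ B * W s) :
    ∀ᶠ s : ℝ in l, ∀ z ∈ Metric.ball w r, ∀ v ∈ Metric.ball w r, ‖h (z + s) - h (v + s)‖ ≤ B * W s * (2 * r) := by
  filter_upwards [hev] with s hs z hz v hv
  have h1 : ‖h (z + s) - h (v + s)‖ ≤ B * W s * ‖(z + s) - (v+s)‖ := by
    refine (convex_ball (w + s) r).norm_image_sub_le_of_norm_deriv_le ?_ ?_ (ball_shift'.2 hv) (ball_shift'.2 hz)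
    · intro x hx
      simpa using (hs _ (ball_shift.1 hx)).1
    · intro x hx
      simpa using (hs _ (ball_shift.1 hx)).2
  refine h1.trans ?_
  have h2 : 0 ≤ B * W s := (norm_nonneg _).trans (hs z hz).2
  gcongr
  have : z + s - (v + s) = (z - w) - (v - w) := by ring
  rw [this]
  rw [mem_ball_iff_norm] at hz hv
  linarith [norm_sub_le (z - w) (v - w)]

lemma int_bound {l : Filter ℝ} {W : ℝ → ℝ} {α β : ℝ} (hD : DBd h l W α β) {a : ℂ} (ha : a ∈ Str α β) :
    ∀ w ∈ Str α β, ∃ r > 0, ∃ B : ℝ, 0 ≤ B ∧ Metric.ball w r ⊆ Str α β ∧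
      ∀ᶠ s : ℝ in l, ∀ z ∈ Metric.ball w r, DifferentiableAt ℂ h (z + s) ∧ ‖h (z + s) - h (a + s)‖ ≤ B * W s := by
  have key : ∀ w ∈ Str α β, ∃ B : ℝ, 0 ≤ B ∧ ∀ᶠ s : ℝ in l, ‖h (w + s) - h (a + s)‖ ≤ B * W s := by
    intro w hw
    refine (preconn_Str α β).induction₂ (fun x y => ∃ B : ℝ, 0 ≤ B ∧ ∀ᶠ s : ℝ in l, ‖h (x + s) - h (y + s)‖ ≤ B * W s)
      ?_ ?_ ?_ hw ha
    · intro x hx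
      obtain ⟨r, hr, B, hB, hrs, hev⟩ := hD x hx
      refine mem_nhdsWithin_of_mem_nhds ?_
      filter_upwards [Metric.ball_mem_nhds x hr] with y hy
      refine ⟨B * (2 * r), by positivity, ?_⟩
      filter_upwards [ball_diff hev] with s hs
      have := hs x (Metric.mem_ball_self hr) y hy
      linarith
    · rintro x y z - - - ⟨K1, hK1, h1⟩ ⟨K2, hK2, h2⟩
      refine ⟨K1 + K2, by positivity, ?_⟩
      filter_upwards [h1, h2] with s h1 h2
      have : h (x + s) - h (z + s) = (h (x+s) - h (y+s)) + (h (y+s) - h (z+s)) := by ring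
      rw [this, add_mul]
      exact (norm_add_le _ _).trans (add_le_add h1 h2)
    · rintro x y - - ⟨K1, hK1, h1⟩
      refine ⟨K1, hK1, ?_⟩
      filter_upwards [h1] with s h1
      rwa [norm_sub_rev]
  intro w hw
  obtain ⟨B1, hB1, h1⟩ := key w hw
  obtain ⟨r, hr, B, hB, hrs, hev⟩ := hD w hw
  refine ⟨r, hr, B1 + B * (2*r), by positivity, hrs, ?_⟩
  filter_upwards [h1, hev, ball_diff hev] with s h1 h2 h3 z hz
  refine ⟨(h2 z hz).1, ?_⟩
  have : h (z + s) - h (a + s) = (h (w+s) - h (a+s)) + (h (z+s) - h (w+s)) := by ring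
  rw [this, add_mul]
  refine (norm_add_le _ _).trans (add_le_add h1 ?_)
  have := h3 z hz w (Metric.mem_ball_self hr)
  linarith

end Strip

lemma identity_Str {f g : ℂ → ℂ} {tm tp α β : ℝ} (hf : DifferentiableOn ℂ f (Str tm tp))
    (hg : DifferentiableOn ℂ g (Str tm tp)) (hα : tm ≤ α) (hβ : β ≤ tp) (hαβ : α < β)
    (he : ∀ w ∈ Str α β, f w = g w) : ∀ w ∈ Str tm tp, f w = g w := by
  set p : ℂ := (((α + β)/2 : ℝ) : ℂ) * I with hp
  have hps : p ∈ Str α β := by constructor <;> simp [hp] <;> linarith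
  have h1 := (hf.analyticOnNhd (isOpen_Str tm tp)).eqOn_of_preconnected_of_eventuallyEq
    (hg.analyticOnNhd (isOpen_Str tm tp)) (preconn_Str tm tp) (Str_mono hα hβ hps) (by
      filter_upwards [(isOpen_Str α β).mem_nhds hps] with w hw using he w hw)
  exact fun w hw => h1 hw

lemma line_limit {g : ℂ → ℝ} {w : ℂ} (hg : ContinuousAt g w) {σ : ℝ}
    (h : ∀ᶠ ε : ℝ in 𝓝[>] 0, 0 ≤ g (w + (σ * ε : ℝ) * I)) : 0 ≤ g w := by
  have h1 : Tendsto (fun ε : ℝ => w + (σ * ε : ℝ) * I) (𝓝[>] 0) (𝓝 w) := by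
    have : Continuous (fun ε : ℝ => w + (σ * ε : ℝ) * I) := by fun_prop
    have := this.tendsto 0
    simp only [mul_zero, Complex.ofReal_zero, zero_mul, add_zero] at this
    exact this.mono_left nhdsWithin_le_nhds
  exact ge_of_tendsto (hg.tendsto.comp h1) h

namespace Strip
variable {h : ℂ → ℂ} {tm t tp s0 : ℝ}

lemma deriv_norm_shift (s : ℝ) (c T : ℂ) (z : ℂ) :
    deriv (fun w : ℂ => (h (w + s) - c) / T) z = deriv h (z + s) / T := by
  rw [deriv_div_const, deriv_sub_const, deriv_comp_add_const]

lemma cross_aux {l : Ultrafilter ℝ} {α β : ℝ} (hα : tm ≤ α) (hβ : β ≤ tp) {p q : ℂ}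
    (hp : p ∈ Str α β) (hq : q ∈ Str tm tp)
    (hD : DBd h l (fun s => 1 + |(h (p + s)).re| + |(h (q + s)).re|) tm tp)
    (hDs : DBd h l (fun s => 1 + |(h (p + s)).re|) α β) :
    ∃ K : ℝ, 0 < K ∧ ∀ᶠ s : ℝ in (l : Filter ℝ), 1 + |(h (q + s)).re| ≤ K * (1 + |(h (p + s)).re|) := by
  by_contra hcon
  push Not at hcon
  have hbig : ∀ K : ℝ, 0 < K → ∀ᶠ s : ℝ in (l : Filter ℝ), K * (1 + |(h (p + s)).re|) < 1 + |(h (q + s)).re| := by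
    exact fun K hK => hcon K hK
  set T : ℝ → ℝ := fun s => 1 + |(h (q + s)).re| with hT
  have hT0 : ∀ s, 0 < T s := fun s => by simp only [hT]; positivity
  set ψ : ℝ → ℂ → ℂ := fun s w => (h (w + s) - h (p + s)) / (T s : ℂ) with hψ
  have hps : p ∈ Str tm tp := Str_mono hα hβ hp
  have hαβ : α < β := hp.1.trans hp.2
  have hlb : LocBdd (l : Filter ℝ) ψ (Str tm tp) := by
    intro w hw
    obtain ⟨r, hr, B, hB, hrs, hev⟩ := int_bound hD hps w hw
    refine ⟨r, hr, 2 * B, hrs, ?_⟩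
    filter_upwards [hev, hbig 1 one_pos] with s hs h1
    refine ⟨?_, ?_⟩
    · intro z hz
      refine DifferentiableAt.differentiableWithinAt ?_
      simp only [hψ]
      refine DifferentiableAt.div_const (DifferentiableAt.sub_const ?_ _) _
      exact DifferentiableAt.comp (f := fun w : ℂ => w + (s:ℂ)) z (hs z hz).1 (by fun_prop)
    · intro z hz
      simp only [hψ]
      rw [norm_div, Complex.norm_real, Real.norm_eq_abs, abs_of_pos (hT0 s), div_le_iff₀ (hT0 s)]
      refine (hs z hz).2.trans ?_
      have : 1 + |(h (p + s)).re| + |(h (q + s)).re| ≤ 2 * T s := by simp only [hT]; linarith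
      nlinarith
  obtain ⟨Ψ, hΨd, -, hΨ, hΨ'⟩ := montel l hlb
  have hΨp : Ψ p = 0 := by
    have h1 := hΨ p hps
    have h2 : Tendsto (fun s => ψ s p) (l : Filter ℝ) (𝓝 0) := by
      simp only [hψ, sub_self, zero_div]; exact tendsto_const_nhds
    exact tendsto_nhds_unique h1 h2
  have hder : ∀ z ∈ Str α β, deriv Ψ z = 0 := by
    intro z hz
    obtain ⟨r, hr, B, hB, hrs, hev⟩ := hDs z hz
    have h1 := (hΨ' z (Str_mono hα hβ hz)).norm
    have h2 : ∀ K : ℝ, 0 < K → ‖deriv Ψ z‖ ≤ B / K := by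
      intro K hK
      refine le_of_tendsto h1 ?_
      filter_upwards [hev, hbig K hK] with s hs hk
      simp only [hψ]
      rw [deriv_norm_shift, norm_div, Complex.norm_real, Real.norm_eq_abs, abs_of_pos (hT0 s), div_le_div_iff₀ (hT0 s) hK]
      have := (hs z (Metric.mem_ball_self hr)).2
      calc ‖deriv h (z+s)‖ * K ≤ (B * (1 + |(h (p + s)).re|)) * K := by gcongr
        _ = B * (K * (1 + |(h (p + s)).re|)) := by ring
        _ ≤ B * T s := by gcongr
    have h3 : Tendsto (fun K : ℝ => B / K) atTop (𝓝 0) := tendsto_const_nhds.div_atTop tendsto_id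
    have h4 : ‖deriv Ψ z‖ ≤ 0 := ge_of_tendsto h3 (by
      filter_upwards [eventually_gt_atTop 0] with K hK using h2 K hK)
    simpa using h4
  have hconst : ∀ w ∈ Str α β, Ψ w = 0 := by
    intro w hw
    rw [← hΨp]
    refine (isOpen_Str α β).is_const_of_deriv_eq_zero (preconn_Str α β) (hΨd.mono (Str_mono hα hβ)) (fun z hz => hder z hz) hw hp
  have hq0 : Ψ q = 0 := identity_Str hΨd (differentiableOn_const 0) hα hβ hαβ hconst q hq
  have h1 := (hΨ q hq).norm
  rw [hq0, norm_zero] at h1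
  have h2 : ∀ᶠ s in (l : Filter ℝ), ‖ψ s q‖ < 1/2 := h1.eventually (gt_mem_nhds (by norm_num))
  obtain ⟨s, hs1, hs2⟩ := (h2.and (hbig 4 (by norm_num))).exists
  simp only [hψ] at hs1
  rw [norm_div, Complex.norm_real, Real.norm_eq_abs, abs_of_pos (hT0 s), div_lt_iff₀ (hT0 s)] at hs1
  have h3 := (Complex.abs_re_le_norm (h (q+s) - h (p+s)))
  rw [Complex.sub_re] at h3
  have h4 := abs_sub_abs_le_abs_sub (h (q+s)).re (h (p+s)).re
  simp only [hT] at hs1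
  have := abs_nonneg (h (p+s)).re
  linarith

variable {l : Ultrafilter ℝ}

lemma mem_low (H : Strip h tm t tp s0) : (((tm + t)/2 : ℝ) : ℂ) * I ∈ Str tm t := by
  have := H.lt1; have := H.lt2
  constructor <;> simp <;> linarith

lemma mem_up (H : Strip h tm t tp s0) : (((t + tp)/2 : ℝ) : ℂ) * I ∈ Str t tp := by
  have := H.lt1; have := H.lt2
  constructor <;> simp <;> linarith

lemma dbd_full (H : Strip h tm t tp s0) (hl : (l : Filter ℝ) ≤ atTop) {a : ℂ} (ha : a ∈ Str tm tp) (hat : a.im ≠ t) :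
    DBd h l (fun s => 1 + |(h (a + s)).re|) tm tp := by
  have fin : ∀ b : ℂ, DBd h l (fun s => 1 + |(h (a + s)).re| + |(h (b + s)).re|) tm tp →
      (∃ K : ℝ, 0 < K ∧ ∀ᶠ s : ℝ in (l : Filter ℝ), 1 + |(h (b + s)).re| ≤ K * (1 + |(h (a + s)).re|)) →
      DBd h l (fun s => 1 + |(h (a + s)).re|) tm tp := by
    rintro b hD ⟨K, hK, hc⟩ w hw
    obtain ⟨r, hr, B, hB, hrs, hev⟩ := hD w hw
    refine ⟨r, hr, B * (K+1), by positivity, hrs, ?_⟩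
    filter_upwards [hev, hc] with s hs hc z hz
    refine ⟨(hs z hz).1, (hs z hz).2.trans ?_⟩
    rw [mul_assoc]
    gcongr
    nlinarith [abs_nonneg (h (a+s)).re]
  rcases lt_or_gt_of_ne hat with hlt | hgt
  · have ha' : a ∈ Str tm t := ⟨ha.1, hlt⟩
    have hD := H.dbd hl ha' H.mem_up
    exact fin _ hD (cross_aux le_rfl H.lt2.le ha' (Str_mono H.lt1.le le_rfl H.mem_up) hD
      (H.dbd_sub hl le_rfl H.lt2.le (Or.inr le_rfl) ha'))
  · have ha' : a ∈ Str t tp := ⟨hgt, ha.2⟩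
    have hD := H.dbd hl H.mem_low ha'
    have hD' : DBd h l (fun s => 1 + |(h (a + s)).re| + |(h ((((tm + t)/2 : ℝ) : ℂ) * I + s)).re|) tm tp := by
      convert hD using 2 with s
      ring
    exact fin _ hD' (cross_aux H.lt1.le le_rfl ha' (Str_mono le_rfl H.lt2.le H.mem_low) hD'
      (H.dbd_sub hl H.lt1.le le_rfl (Or.inl le_rfl) ha'))

lemma cmp (H : Strip h tm t tp s0) (hl : (l : Filter ℝ) ≤ atTop) {a b : ℂ} (ha : a ∈ Str tm tp) (hat : a.im ≠ t)
    (hb : b ∈ Str tm tp) :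
    ∃ K : ℝ, 0 < K ∧ ∀ᶠ s : ℝ in (l : Filter ℝ), 1 + |(h (b + s)).re| ≤ K * (1 + |(h (a + s)).re|) := by
  obtain ⟨r, hr, B, hB, hrs, hev⟩ := int_bound (H.dbd_full hl ha hat) ha b hb
  refine ⟨B + 1, by positivity, ?_⟩
  filter_upwards [hev] with s hs
  have h1 := (hs b (Metric.mem_ball_self hr)).2
  have h3 := (Complex.abs_re_le_norm (h (b+s) - h (a+s)))
  rw [Complex.sub_re] at h3
  have h4 := abs_sub_abs_le_abs_sub (h (b+s)).re (h (a+s)).re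
  nlinarith

lemma im_bound (H : Strip h tm t tp s0) (hl : (l : Filter ℝ) ≤ atTop) {a : ℂ} (ha : a ∈ Str tm tp) (hat : a.im ≠ t) :
    ∀ w ∈ Str tm tp, ∃ r > 0, ∃ B : ℝ, 0 ≤ B ∧ Metric.ball w r ⊆ Str tm tp ∧
      ∀ᶠ s : ℝ in (l : Filter ℝ), ∀ z ∈ Metric.ball w r, DifferentiableAt ℂ h (z + s) ∧
        ‖h (z + s) - (h (a + s)).im * I‖ ≤ B * (1 + |(h (a + s)).re|) := by
  intro w hw
  obtain ⟨r, hr, B, hB, hrs, hev⟩ := int_bound (H.dbd_full hl ha hat) ha w hw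
  refine ⟨r, hr, B + 1, by positivity, hrs, ?_⟩
  filter_upwards [hev] with s hs z hz
  refine ⟨(hs z hz).1, ?_⟩
  have h1 := (hs z hz).2
  have e : h (z+s) - (h (a + s)).im * I = (h (z+s) - h (a+s)) + ((h (a+s)).re : ℂ) := by
    have := Complex.re_add_im (h (a+s))
    linear_combination -this
  rw [e]
  refine (norm_add_le _ _).trans ?_
  rw [Complex.norm_real, Real.norm_eq_abs]
  linarith

lemma locbdd (H : Strip h tm t tp s0) (hl : (l : Filter ℝ) ≤ atTop) {a : ℂ} (ha : a ∈ Str tm tp) (hat : a.im ≠ t)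
    {τ : ℝ → ℝ} {K : ℝ} (hτ : ∀ᶠ s in (l : Filter ℝ), 0 < τ s ∧ 1 + |(h (a + s)).re| ≤ K * τ s) :
    LocBdd (l : Filter ℝ) (fun s w => (h (w + s) - (h (a + s)).im * I) / (τ s : ℂ)) (Str tm tp) := by
  intro w hw
  obtain ⟨r, hr, B, hB, hrs, hev⟩ := H.im_bound hl ha hat w hw
  refine ⟨r, hr, B * K, hrs, ?_⟩
  filter_upwards [hev, hτ] with s hs hs2
  refine ⟨?_, ?_⟩
  · intro z hz
    refine DifferentiableAt.differentiableWithinAt ?_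
    refine DifferentiableAt.div_const (DifferentiableAt.sub_const ?_ _) _
    exact DifferentiableAt.comp (f := fun w : ℂ => w + (s:ℂ)) z (hs z hz).1 (by fun_prop)
  · intro z hz
    rw [norm_div, Complex.norm_real, Real.norm_eq_abs, abs_of_pos hs2.1, div_le_iff₀ hs2.1, mul_assoc]
    exact (hs z hz).2.trans (by gcongr; exact hs2.2)

/-- neutral limit -/
lemma neutral (H : Strip h tm t tp s0) (hl : (l : Filter ℝ) ≤ atTop) {a : ℂ} (ha : a ∈ Str tm tp) (hat : a.im ≠ t)
    {K : ℝ} (hK : ∀ᶠ s : ℝ in (l : Filter ℝ), |(h (a + s)).re| ≤ K) :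
    ∃ G : ℂ → ℂ, DifferentiableOn ℂ G (Str tm tp) ∧ (∀ w ∈ Str tm tp, G w ≠ 0) ∧
      TendstoLocallyUniformlyOn (fun s w => exp (h (w + (s:ℝ)))) G (l : Filter ℝ) (Str tm tp) ∧
      (∀ w ∈ Str tm tp, Tendsto (fun s : ℝ => exp (h (w + s))) l (𝓝 (G w))) ∧
      LocBdd (l : Filter ℝ) (fun (s : ℝ) w => exp (h (w + s))) (Str tm tp) := by
  have hre : ∀ w ∈ Str tm tp, ∃ r > 0, ∃ B : ℝ, Metric.ball w r ⊆ Str tm tp ∧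
      ∀ᶠ s : ℝ in (l : Filter ℝ), ∀ z ∈ Metric.ball w r, DifferentiableAt ℂ h (z + s) ∧ |(h (z+s)).re| ≤ B := by
    intro w hw
    obtain ⟨r, hr, B, hB, hrs, hev⟩ := H.im_bound hl ha hat w hw
    refine ⟨r, hr, B * (1 + K), hrs, ?_⟩
    filter_upwards [hev, hK] with s hs hs2 z hz
    refine ⟨(hs z hz).1, ?_⟩
    have h3 := (Complex.abs_re_le_norm _).trans (hs z hz).2
    simp at h3
    refine h3.trans (by gcongr)
  have hlb : LocBdd (l : Filter ℝ) (fun (s : ℝ) w => exp (h (w + s))) (Str tm tp) := by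
    intro w hw
    obtain ⟨r, hr, B, hrs, hev⟩ := hre w hw
    refine ⟨r, hr, Real.exp B, hrs, ?_⟩
    filter_upwards [hev] with s hs
    refine ⟨?_, ?_⟩
    · intro z hz
      refine DifferentiableAt.differentiableWithinAt ?_
      refine DifferentiableAt.cexp ?_
      exact DifferentiableAt.comp (f := fun w : ℂ => w + (s:ℂ)) z (hs z hz).1 (by fun_prop)
    · intro z hz
      rw [Complex.norm_exp]
      exact Real.exp_le_exp.2 ((le_abs_self _).trans (hs z hz).2)
  obtain ⟨G, hG, hGu, hGp, -⟩ := montel l hlb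
  refine ⟨G, hG, ?_, hGu, hGp, hlb⟩
  intro w hw h0
  obtain ⟨r, hr, B, hrs, hev⟩ := hre w hw
  have h1 : Real.exp (-B) ≤ ‖G w‖ := by
    refine ge_of_tendsto (hGp w hw).norm ?_
    filter_upwards [hev] with s hs
    rw [Complex.norm_exp]
    exact Real.exp_le_exp.2 ((abs_le.1 (hs w (Metric.mem_ball_self hr)).2).1)
  rw [h0, norm_zero] at h1
  linarith [Real.exp_pos (-B)]

/-- propagation of the limit 1 -/
lemma propagate_one (H : Strip h tm t tp s0) (hl : (l : Filter ℝ) ≤ atTop) {α β : ℝ} (hα : tm ≤ α) (hβ : β ≤ tp)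
    (ht : t ≤ α ∨ β ≤ t) (hαβ : α < β)
    (h1 : ∀ w ∈ Str α β, Tendsto (fun s : ℝ => exp (h (w + s))) l (𝓝 1)) :
    TendstoLocallyUniformlyOn (fun s w => exp (h (w + (s:ℝ)))) (fun _ => 1) (l : Filter ℝ) (Str tm tp) := by
  set p : ℂ := (((α + β)/2 : ℝ) : ℂ) * I with hp
  have hps : p ∈ Str α β := by constructor <;> simp [hp] <;> linarith
  have hpt : p.im ≠ t := by
    intro hpt
    rcases ht with h1 | h1
    · exact absurd hps.1 (by rw [hpt]; linarith)
    · exact absurd hps.2 (by rw [hpt]; linarith)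
  have hb : ∀ᶠ s : ℝ in (l : Filter ℝ), |(h (p + s)).re| ≤ 1 := by
    have h2 := (h1 p hps).norm
    rw [norm_one] at h2
    have h3 : Tendsto (fun s : ℝ => Real.log ‖exp (h (p + s))‖) l (𝓝 (Real.log 1)) :=
      ((Real.continuousAt_log one_ne_zero).tendsto).comp h2
    simp only [Complex.norm_exp, Real.log_exp, Real.log_one] at h3
    have h4 := h3.abs
    rw [abs_zero] at h4
    exact h4.eventually (ge_mem_nhds one_pos)
  obtain ⟨G, hG, -, hGu, hGp, -⟩ := H.neutral hl (Str_mono hα hβ hps) hpt hb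
  have hG1 : ∀ w ∈ Str tm tp, G w = 1 := identity_Str hG (differentiableOn_const 1) hα hβ hαβ
    (fun w hw => tendsto_nhds_unique (hGp w (Str_mono hα hβ hw)) (h1 w hw))
  exact hGu.congr_right hG1

/-- blow up -/
lemma blowup (H : Strip h tm t tp s0) (hl : (l : Filter ℝ) ≤ atTop)
    (hu : ∀ w ∈ Str tm tp, w.im ≠ t → Tendsto (fun s : ℝ => (h (w + s)).re) l atTop) :
    ∀ w ∈ Str tm tp, ∃ r > 0, Metric.ball w r ⊆ Str tm tp ∧ ∀ M : ℝ, ∀ᶠ s : ℝ in (l : Filter ℝ),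
      ∀ z ∈ Metric.ball w r, M ≤ (h (z + s)).re := by
  set a : ℂ := (((tm + t)/2 : ℝ) : ℂ) * I with haa
  have ha : a ∈ Str tm tp := Str_mono le_rfl H.lt2.le H.mem_low
  have hat : a.im ≠ t := (H.mem_low.2).ne
  set τ : ℝ → ℝ := fun s => 1 + |(h (a + s)).re| with hτ
  have hτ0 : ∀ s, 0 < τ s := fun s => by simp only [hτ]; positivity
  obtain ⟨Φ, hΦ, hΦu, hΦp, -⟩ := montel l (H.locbdd hl ha hat (τ := τ) (K := 1)
    (Eventually.of_forall fun s => ⟨hτ0 s, by simp [hτ]⟩))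
  have hre : ∀ (s : ℝ) (w : ℂ), ((h (w + s) - (h (a + s)).im * I) / (τ s : ℂ)).re = (h (w+s)).re / τ s := by
    intro s w
    rw [Complex.div_ofReal_re]; simp
  have hU0 : ∀ w ∈ Str tm tp, 0 ≤ (Φ w).re := by
    have hoff : ∀ w ∈ Str tm tp, w.im ≠ t → 0 ≤ (Φ w).re := by
      intro w hw hwt
      have h1 := (Complex.continuous_re.tendsto _).comp (hΦp w hw)
      refine ge_of_tendsto h1 ?_
      filter_upwards [(hu w hw hwt).eventually_ge_atTop 0] with s hs
      simp only [Function.comp]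
      rw [hre]
      exact div_nonneg hs (hτ0 s).le
    intro w hw
    by_cases hwt : w.im = t
    · refine line_limit (g := fun w => (Φ w).re) (σ := 1) ?_ ?_
      · exact Complex.continuous_re.continuousAt.comp (hΦ.continuousOn.continuousAt ((isOpen_Str _ _).mem_nhds hw))
      · have : ∀ᶠ ε : ℝ in 𝓝[>] 0, ε < tp - t := 
          mem_nhdsWithin_of_mem_nhds (gt_mem_nhds (by linarith [H.lt2]))
        filter_upwards [this, self_mem_nhdsWithin] with ε h1 h2
        have h2 : 0 < ε := h2
        have := H.lt1
        refine hoff _ ?_ ?_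
        · constructor <;> simp <;> linarith
        · simp; rw [hwt]; linarith
    · exact hoff w hw hwt
  have hUa : (Φ a).re = 1 := by
    have h1 := (Complex.continuous_re.tendsto _).comp (hΦp a ha)
    refine tendsto_nhds_unique h1 ?_
    have h2 : Tendsto (fun s : ℝ => 1 - (τ s)⁻¹) l (𝓝 (1 - 0)) := by
      refine tendsto_const_nhds.sub (Tendsto.inv_tendsto_atTop ?_)
      exact tendsto_atTop_add_const_left _ _ (tendsto_abs_atTop_atTop.comp (hu a ha hat))
    rw [sub_zero] at h2
    refine h2.congr' ?_
    filter_upwards [(hu a ha hat).eventually_ge_atTop 0] with s hs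
    simp only [Function.comp]
    rw [hre]
    have := hτ0 s
    simp only [hτ] at this ⊢
    rw [abs_of_nonneg hs] at this ⊢
    field_simp; ring
  have hpos : ∀ w ∈ Str tm tp, 0 < (Φ w).re := by
    intro w hw
    rcases (hU0 w hw).lt_or_eq with h1 | h1
    · exact h1
    · exfalso
      have hmax : IsMaxOn (norm ∘ fun z => exp (-Φ z)) (Str tm tp) w := by
        intro z hz
        simp only [Function.comp, mem_ofPred_eq, Complex.norm_exp, Complex.neg_re, ← h1]
        exact Real.exp_le_exp.2 (by linarith [hU0 z hz])
      have := Complex.norm_eqOn_of_isPreconnected_of_isMaxOn (preconn_Str tm tp) (isOpen_Str tm tp)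
        (hΦ.neg.cexp) hw hmax ha
      simp only [Function.comp, Function.const, Complex.norm_exp] at this
      have := Real.exp_injective this
      simp only [Pi.neg_apply, Complex.neg_re] at this
      rw [hUa, ← h1] at this
      norm_num at this
  intro w hw
  have hw0 := hpos w hw
  obtain ⟨r, hr, hrs, hev⟩ := hΦu.exists_ball (isOpen_Str _ _) hΦ.continuousOn hw (half_pos hw0)
  refine ⟨r, hr, hrs, fun M => ?_⟩
  have hτt : Tendsto τ l atTop := tendsto_atTop_add_const_left _ _ (tendsto_abs_atTop_atTop.comp (hu a ha hat))
  filter_upwards [hev, (hτt.eventually_ge_atTop (|M| / ((Φ w).re/2)))] with s hs h2 z hz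
  have h1 := (Complex.abs_re_le_norm _).trans (hs z hz).le
  rw [Complex.sub_re, hre] at h1
  have h3 := (abs_le.1 h1).1
  rw [div_le_iff₀ (by linarith)] at h2
  have h4 : (Φ w).re/2 ≤ (h (z+s)).re / τ s := by linarith
  rw [le_div_iff₀ (hτ0 s)] at h4
  linarith [le_abs_self M]

lemma neg (H : Strip h tm t tp s0) : Strip (fun w => - h w) tm t tp s0 where
  lt1 := H.lt1
  lt2 := H.lt2
  diff := H.diff.neg
  om := by
    intro w h1 h2 h3 n hn
    apply H.om w h1 h2 h3 (-n)
    push_cast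
    linear_combination -hn

end Strip

/-! ### extension of functions with removable singularities -/

def RExt (Ψ : ℂ → ℂ) (z : ℂ) : ℂ := limUnder (𝓝[≠] z) Ψ

lemma RExt_eq {Ψ g : ℂ → ℂ} {z : ℂ} (hg : ContinuousAt g z) (h : Ψ =ᶠ[𝓝[≠] z] g) : RExt Ψ z = g z := by
  have h1 : Tendsto Ψ (𝓝[≠] z) (𝓝 (g z)) := (hg.tendsto.mono_left nhdsWithin_le_nhds).congr' h.symm
  exact h1.limUnder_eq

lemma RExt_eventuallyEq {Ψ g : ℂ → ℂ} {z : ℂ} (hg : AnalyticAt ℂ g z) (h : Ψ =ᶠ[𝓝[≠] z] g) : RExt Ψ =ᶠ[𝓝 z] g := by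
  have h2 : ∀ᶠ w in 𝓝[≠] z, RExt Ψ w = g w := by
    have h3 : ∀ᶠ w in 𝓝[≠] z, ∀ᶠ v in 𝓝[≠] w, Ψ v = g v := by
      have := eventually_eventually_nhdsWithin.2 h
      filter_upwards [this, self_mem_nhdsWithin] with w hw hwz
      have h6 : ({z}ᶜ : Set ℂ) ∈ 𝓝 w := isOpen_compl_singleton.mem_nhds hwz
      rw [nhdsWithin_eq_nhds.2 h6] at hw
      exact hw.filter_mono nhdsWithin_le_nhds
    have h4 : ∀ᶠ w in 𝓝[≠] z, AnalyticAt ℂ g w := hg.eventually_analyticAt.filter_mono nhdsWithin_le_nhds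
    filter_upwards [h3, h4] with w h3 h4 using RExt_eq h4.continuousAt h3
  rw [eventually_nhdsWithin_iff] at h2
  filter_upwards [h2] with w hw
  by_cases hwz : w = z
  · rw [hwz]; exact RExt_eq hg.continuousAt h
  · exact hw hwz

lemma RExt_analyticAt {Ψ g : ℂ → ℂ} {z : ℂ} (hg : AnalyticAt ℂ g z) (h : Ψ =ᶠ[𝓝[≠] z] g) : AnalyticAt ℂ (RExt Ψ) z :=
  hg.congr (RExt_eventuallyEq hg h).symm

lemma RExt_self {Ψ : ℂ → ℂ} {z : ℂ} (hg : AnalyticAt ℂ Ψ z) : RExt Ψ z = Ψ z :=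
  RExt_eq hg.continuousAt (EventuallyEq.refl _ _)

/-! ### meromorphic functions -/

def RatF (f : ℂ → ℂ) : Prop :=
  ∃ p q : Polynomial ℂ, q ≠ 0 ∧ ∀ z0, ∀ᶠ z in 𝓝[≠] z0, q.eval z * f z = p.eval z

lemma poly_ev_ne {q : Polynomial ℂ} (hq : q ≠ 0) (z0 : ℂ) : ∀ᶠ z in 𝓝[≠] z0, q.eval z ≠ 0 := by
  have hf : {z | q.eval z = 0}.Finite := by
    refine (q.roots.toFinset.finite_toSet).subset ?_
    intro z hz
    simp only [Finset.mem_coe, Multiset.mem_toFinset, Polynomial.mem_roots hq]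
    exact hz
  have : ({z | q.eval z = 0} \ {z0})ᶜ ∈ 𝓝 z0 := (hf.subset sdiff_subset).isClosed.isOpen_compl.mem_nhds (by simp)
  filter_upwards [mem_nhdsWithin_of_mem_nhds this, self_mem_nhdsWithin] with z h1 h2 h3
  exact h1 ⟨h3, h2⟩

section MM
variable {f : ℂ → ℂ} {P : Set ℂ}

lemma MeromOn.ana (hm : MeromOn f P univ) {z : ℂ} (hz : z ∉ P) : AnalyticAt ℂ f z := hm.2.1 z ⟨trivial, hz⟩

lemma MeromOn.ev_notin (hm : MeromOn f P univ) (z : ℂ) : ∀ᶠ w in 𝓝[≠] z, w ∉ P := by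
  have := hm.2.2.2 z trivial
  rw [accPt_iff_frequently_nhdsNE] at this
  simpa using this

lemma MeromOn.closed (hm : MeromOn f P univ) : IsClosed P := by
  rw [isClosed_iff_clusterPt]
  intro a ha
  by_contra h
  exact hm.2.2.2 a trivial (by rw [accPt_principal_iff_clusterPt]; rwa [sdiff_singleton_eq_self h])

lemma MeromOn.ev_notin' (hm : MeromOn f P univ) {z : ℂ} (hz : z ∉ P) : ∀ᶠ w in 𝓝 z, w ∉ P :=
  hm.closed.isOpen_compl.mem_nhds hz

/-- near a pole, the reciprocal extends analytically -/
lemma MeromOn.inv_pole (hm : MeromOn f P univ) {p : ℂ} (hp : p ∈ P) (c : ℂ) :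
    AnalyticAt ℂ (Pᶜ.indicator fun z => (c - f z)⁻¹) p := by
  have hev := hm.ev_notin p
  have hinf := hm.2.2.1 p hp
  have hne : ∀ᶠ z in 𝓝[≠] p, c - f z ≠ 0 := by
    filter_upwards [hinf.eventually_gt_atTop ‖c‖] with z hz h0
    rw [sub_eq_zero] at h0
    rw [h0] at hz; exact lt_irrefl _ hz
  have hcont : ContinuousAt (Pᶜ.indicator fun z => (c - f z)⁻¹) p := by
    rw [continuousAt_iff_punctured_nhds]
    rw [indicator_of_notMem (by simpa using hp)]
    have h1 : Tendsto (fun z => (c - f z)⁻¹) (𝓝[≠] p) (𝓝 0) := by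
      refine tendsto_inv₀_cobounded.comp ?_
      rw [← tendsto_norm_atTop_iff_cobounded]
      refine tendsto_atTop_mono (fun z => ?_) (tendsto_atTop_add_const_right _ (-‖c‖) hinf)
      have := norm_sub_norm_le (f z) c
      rw [norm_sub_rev] at this
      linarith
    refine h1.congr' ?_
    filter_upwards [hev] with z hz
    simp [hz]
  refine Complex.analyticAt_of_differentiable_on_punctured_nhds_of_continuousAt ?_ hcont
  have h2 : ∀ᶠ z in 𝓝[≠] p, ∀ᶠ w in 𝓝 z, w ∉ P := by
    filter_upwards [hev] with z hz using hm.ev_notin' hz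
  filter_upwards [hev, hne, h2] with z h1 h3 h2
  have : (Pᶜ.indicator fun z => (c - f z)⁻¹) =ᶠ[𝓝 z] fun z => (c - f z)⁻¹ := by
    filter_upwards [h2] with w hw; simp [hw]
  rw [this.differentiableAt_iff]
  exact ((hm.ana h1).differentiableAt.const_sub c).inv h3

lemma MeromOn.merom (hm : MeromOn f P univ) (z : ℂ) : MeromorphicAt f z := by
  by_cases hz : z ∈ P
  · have h1 := (hm.inv_pole hz 0).meromorphicAt
    have h2 : MeromorphicAt (fun z => - ((Pᶜ.indicator fun z => (0 - f z)⁻¹) z)⁻¹) z := h1.fun_inv.fun_neg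
    refine h2.congr ?_
    filter_upwards [hm.ev_notin z] with w hw
    simp [hw]
  · exact (hm.ana hz).meromorphicAt

lemma MeromOn.ev_ne (hm : MeromOn f P univ) (hr : ¬ RatF f) (c : ℂ) (z : ℂ) : ∀ᶠ w in 𝓝[≠] z, f w ≠ c := by
  have hM : MeromorphicOn (fun z => f z - c) univ := fun z _ => (hm.merom z).fun_sub (MeromorphicAt.const c z)
  have key : meromorphicOrderAt (fun z => f z - c) z ≠ ⊤ := by
    intro htop
    apply hr
    refine ⟨Polynomial.C c, 1, one_ne_zero, ?_⟩
    intro z0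
    have h1 : meromorphicOrderAt (fun z => f z - c) z0 = ⊤ := by
      by_contra h
      exact (hM.meromorphicOrderAt_ne_top_of_isPreconnected isPreconnected_univ (mem_univ z0) (mem_univ z) h) htop
    rw [meromorphicOrderAt_eq_top_iff] at h1
    filter_upwards [h1] with w hw
    simp; linear_combination hw
  have := (meromorphicOrderAt_ne_top_iff_eventually_ne_zero (hM z trivial)).1 key
  filter_upwards [this] with w hw h
  exact hw (by simp [h])

lemma RatF.isRational (hm : MeromOn f P univ) (h : RatF f) : IsRationalFn f P := by
  obtain ⟨p, q, hq, h⟩ := h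
  refine ⟨p, q, hq, fun z hz hqz => ?_⟩
  have h1 : ContinuousAt (fun z => q.eval z * f z) z := q.continuous.continuousAt.mul (hm.ana hz).continuousAt
  have h2 : Tendsto (fun z => q.eval z * f z) (𝓝[≠] z) (𝓝 (p.eval z)) :=
    ((p.continuous.tendsto z).mono_left nhdsWithin_le_nhds).congr' (by filter_upwards [h z] with w hw using hw.symm)
  have h3 := tendsto_nhds_unique (h1.tendsto.mono_left nhdsWithin_le_nhds) h2
  rw [eq_div_iff hqz, mul_comm]; exact h3

lemma RatF.rot_back {g : ℂ → ℂ} (hfg : ∀ z0, ∀ᶠ z in 𝓝[≠] z0, g z * (1 - f z) = 1) (h : RatF g) : RatF f := by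
  obtain ⟨p, q, hq, h⟩ := h
  refine ⟨p - q, p, ?_, ?_⟩
  · rintro rfl
    obtain ⟨z, h1, h2, h3⟩ := ((poly_ev_ne hq 0).and ((h 0).and (hfg 0))).exists
    simp only [Polynomial.eval_zero, mul_eq_zero, h1, false_or] at h2
    simp [h2] at h3
  · intro z0
    filter_upwards [h z0, hfg z0] with z h1 h2
    rw [Polynomial.eval_sub, ← h1]
    linear_combination (- q.eval z) * h2

def rot (f : ℂ → ℂ) (P : Set ℂ) : ℂ → ℂ := Pᶜ.indicator fun z => (1 - f z)⁻¹

def rotP (f : ℂ → ℂ) (P : Set ℂ) : Set ℂ := {z | z ∉ P ∧ f z = 1}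

lemma rot_of {z : ℂ} (hz : z ∉ P) : rot f P z = (1 - f z)⁻¹ := by simp [rot, hz]
lemma rot_pole {z : ℂ} (hz : z ∈ P) : rot f P z = 0 := by simp [rot, hz]

lemma MeromOn.rot_rel (hm : MeromOn f P univ) (hr : ¬ RatF f) (z0 : ℂ) : ∀ᶠ z in 𝓝[≠] z0, rot f P z * (1 - f z) = 1 := by
  filter_upwards [hm.ev_notin z0, hm.ev_ne hr 1 z0] with z h1 h2
  rw [rot_of h1, inv_mul_cancel₀]
  exact sub_ne_zero.2 (Ne.symm h2)

lemma MeromOn.rot (hm : MeromOn f P univ) (hr : ¬ RatF f) : MeromOn (rot f P) (rotP f P) univ := by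
  refine ⟨subset_univ _, ?_, ?_, ?_⟩
  · rintro z ⟨-, hz⟩
    by_cases hp : z ∈ P
    · have := hm.inv_pole hp 1
      exact this.congr (by filter_upwards with w; simp [_root_.rot])
    · have h1 : f z ≠ 1 := fun h => hz ⟨hp, h⟩
      have : AnalyticAt ℂ (fun z => (1 - f z)⁻¹) z := (analyticAt_const.sub (hm.ana hp)).inv (sub_ne_zero.2 (Ne.symm h1))
      refine this.congr ?_
      filter_upwards [hm.ev_notin' hp] with w hw
      rw [rot_of hw]
  · rintro p ⟨hp, h1⟩
    have h2 : Tendsto (fun z => 1 - f z) (𝓝[≠] p) (𝓝[≠] 0) := by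
      refine tendsto_nhdsWithin_iff.2 ⟨?_, ?_⟩
      · have : Tendsto (fun z => 1 - f z) (𝓝 p) (𝓝 (1 - f p)) := (continuousAt_const.sub (hm.ana hp).continuousAt)
        rw [h1, sub_self] at this
        exact this.mono_left nhdsWithin_le_nhds
      · filter_upwards [hm.ev_ne hr 1 p] with w hw
        exact sub_ne_zero.2 (Ne.symm hw)
    have h3 := tendsto_norm_cobounded_atTop.comp (tendsto_inv₀_nhdsNE_zero.comp h2)
    refine h3.congr' ?_
    filter_upwards [hm.ev_notin p] with w hw
    simp [rot_of hw]
  · intro z _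
    rw [accPt_iff_frequently_nhdsNE]
    simp only [not_frequently]
    filter_upwards [hm.ev_ne hr 1 z] with w hw h
    exact hw h.2

end MM

lemma Ray_eq (θ : ℝ) : Ray (θ + 2 * Real.pi) = Ray θ := by
  unfold Ray
  have : exp (((θ + 2 * Real.pi : ℝ) : ℂ) * I) = exp ((θ : ℂ) * I) := by
    push_cast; rw [add_mul, Complex.exp_add, Complex.exp_two_pi_mul_I, mul_one]
  rw [this]

structure Cfg (f : ℂ → ℂ) (P : Set ℂ) (t0 t1 t2 : ℝ) : Prop where
  mer : MeromOn f P univ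
  nrat : ¬ RatF f
  h01 : t0 < t1
  h12 : t1 < t2
  h20 : t2 < t0 + 2 * Real.pi
  z0 : ({z : ℂ | z ∉ P ∧ f z = 0} \ Ray t0).Finite
  z1 : ({z : ℂ | z ∉ P ∧ f z = 1} \ Ray t1).Finite
  zp : (P \ Ray t2).Finite

namespace Cfg
variable {f : ℂ → ℂ} {P : Set ℂ} {t0 t1 t2 : ℝ}

lemma rot (C : Cfg f P t0 t1 t2) : Cfg (rot f P) (rotP f P) t2 (t0 + 2 * Real.pi) (t1 + 2 * Real.pi) where
  mer := C.mer.rot C.nrat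
  nrat := fun h => C.nrat (h.rot_back (C.mer.rot_rel C.nrat))
  h01 := C.h20
  h12 := by linarith [C.h01]
  h20 := by linarith [C.h12]
  z0 := by
    refine C.zp.subset ?_
    rintro z ⟨⟨h1, h2⟩, h3⟩
    refine ⟨?_, h3⟩
    by_contra hp
    rw [rot_of hp, inv_eq_zero, sub_eq_zero] at h2
    exact h1 ⟨hp, h2.symm⟩
  z1 := by
    refine C.z0.subset ?_
    rintro z ⟨⟨h1, h2⟩, h3⟩
    rw [Ray_eq] at h3
    refine ⟨?_, h3⟩
    by_cases hp : z ∈ P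
    · rw [rot_pole hp] at h2; exact absurd h2 zero_ne_one
    · rw [rot_of hp, inv_eq_one] at h2
      exact ⟨hp, by linear_combination -h2⟩
  zp := by rw [Ray_eq]; exact C.z1

end Cfg

lemma exp_mem_Ray {w : ℂ} {θ : ℝ} (h : exp w ∈ Ray θ) : ∃ m : ℤ, w.im = θ + 2 * Real.pi * m := by
  obtain ⟨r, hr, h⟩ := h
  have e : (r : ℂ) = exp (Real.log r : ℂ) := by rw [← Complex.ofReal_exp, Real.exp_log hr]
  rw [e, ← Complex.exp_add, Complex.exp_eq_exp_iff_exists_int] at h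
  obtain ⟨m, hm⟩ := h
  refine ⟨m, ?_⟩
  have := congrArg Complex.im hm
  simp at this
  rw [this]; ring

/-- growth: entire function with polynomial growth on large circles -/
lemma entire_poly {N : ℂ → ℂ} (hN : ∀ z, AnalyticAt ℂ N z) {C : ℝ} {d : ℕ}
    (h : ∃ᶠ R : ℝ in atTop, ∀ z : ℂ, ‖z‖ = R → ‖N z‖ ≤ C * R ^ d) : ∃ p : Polynomial ℂ, ∀ z, N z = p.eval z := by
  have hd : Differentiable ℂ N := fun z => (hN z).differentiableAt
  have h0 : ∀ n, d < n → iteratedDeriv n N 0 = 0 := by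
    intro n hn
    have h1 : ∃ᶠ R : ℝ in atTop, ‖iteratedDeriv n N 0‖ ≤ n.factorial * |C| * R⁻¹ := by
      refine (h.and_eventually (eventually_ge_atTop 1)).mono ?_
      rintro R ⟨hR, hR1⟩
      have hRp : 0 < R := by linarith
      have h2 := Complex.norm_iteratedDeriv_le_of_forall_mem_sphere_norm_le n hRp (c := (0:ℂ)) (C := C * R^d)
        hd.diffContOnCl (fun z hz => hR z (by simpa using hz))
      refine h2.trans ?_
      rw [div_le_iff₀ (by positivity)]
      have h3 : R ^ d ≤ R⁻¹ * R ^ n := by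
        rw [inv_mul_eq_div, le_div_iff₀ hRp, ← pow_succ]
        exact pow_le_pow_right₀ hR1 hn
      have h4 : C * R ^ d ≤ |C| * (R⁻¹ * R ^ n) :=
        (mul_le_mul_of_nonneg_right (le_abs_self C) (by positivity)).trans (by gcongr)
      calc (n.factorial : ℝ) * (C * R^d) ≤ n.factorial * (|C| * (R⁻¹ * R ^ n)) := by gcongr
        _ = _ := by ring
    have h5 : Tendsto (fun R : ℝ => n.factorial * |C| * R⁻¹) atTop (𝓝 0) := by
      simpa using (tendsto_inv_atTop_zero (𝕜 := ℝ)).const_mul (n.factorial * |C|)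
    by_contra hne
    have h6 := h5.eventually (gt_mem_nhds (norm_pos_iff.2 hne))
    obtain ⟨R, h7, h8⟩ := (h1.and_eventually h6).exists
    linarith
  refine ⟨∑ n ∈ Finset.range (d+1), Polynomial.monomial n ((n.factorial : ℂ)⁻¹ * iteratedDeriv n N 0), fun z => ?_⟩
  rw [← Complex.taylorSeries_eq_of_entire' 0 z hd, tsum_eq_sum (s := Finset.range (d+1))]
  · rw [Polynomial.eval_finsetSum]
    refine Finset.sum_congr rfl fun n _ => ?_
    rw [Polynomial.eval_monomial, sub_zero]
  · intro n hn
    rw [h0 n (by simpa using hn)]; simp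

lemma poly_growth (q : Polynomial ℂ) : ∃ C : ℝ, 0 ≤ C ∧ ∀ R : ℝ, 1 ≤ R → ∀ z : ℂ, ‖z‖ = R → ‖q.eval z‖ ≤ C * R ^ q.natDegree := by
  refine ⟨∑ n ∈ Finset.range (q.natDegree + 1), ‖q.coeff n‖, Finset.sum_nonneg fun _ _ => norm_nonneg _, ?_⟩
  intro R hR z hz
  rw [Polynomial.eval_eq_sum_range, Finset.sum_mul]
  refine (norm_sum_le _ _).trans (Finset.sum_le_sum fun n hn => ?_)
  rw [norm_mul, norm_pow, hz]
  refine mul_le_mul_of_nonneg_left (pow_le_pow_right₀ hR ?_) (norm_nonneg _)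
  simp at hn; omega

lemma MeromOn.rat_of_bdd {f : ℂ → ℂ} {P : Set ℂ} (hm : MeromOn f P univ) (hP : P.Finite) {M : ℝ}
    (h : ∃ᶠ R : ℝ in atTop, ∀ z : ℂ, ‖z‖ = R → z ∉ P → ‖f z‖ ≤ M) : RatF f := by
  have hmer : ∀ p, ∃ n : ℕ, AnalyticAt ℂ (fun z => (z - p) ^ n • f z) p := fun p => hm.merom p
  choose n hn using hmer
  set q : Polynomial ℂ := ∏ p ∈ hP.toFinset, (Polynomial.X - Polynomial.C p) ^ n p with hq
  have hq0 : q ≠ 0 := Finset.prod_ne_zero_iff.2 fun p _ => pow_ne_zero _ (Polynomial.X_sub_C_ne_zero p)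
  have hloc : ∀ z, ∃ g, AnalyticAt ℂ g z ∧ (fun z => q.eval z * f z) =ᶠ[𝓝[≠] z] g := by
    intro z
    by_cases hz : z ∈ P
    · have hzP : z ∈ hP.toFinset := by simpa using hz
      refine ⟨fun w => (∏ p ∈ hP.toFinset.erase z, (Polynomial.X - Polynomial.C p) ^ n p).eval w * ((w - z) ^ n z • f w), ?_, ?_⟩
      · exact ((AnalyticOnNhd.eval_polynomial (𝕜 := ℂ) _) z trivial).mul (hn z)
      · refine Eventually.of_forall fun w => ?_
        simp only [hq]
        rw [← Finset.mul_prod_erase _ _ hzP, Polynomial.eval_mul]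
        simp; ring
    · exact ⟨_, ((AnalyticOnNhd.eval_polynomial (𝕜 := ℂ) q) z trivial).mul (hm.ana hz), EventuallyEq.refl _ _⟩
  have hNa : ∀ z, AnalyticAt ℂ (RExt fun z => q.eval z * f z) z := by
    intro z; obtain ⟨g, h1, h2⟩ := hloc z; exact RExt_analyticAt h1 h2
  have hNe : ∀ z, ∀ᶠ w in 𝓝[≠] z, RExt (fun z => q.eval z * f z) w = q.eval w * f w := by
    intro z; obtain ⟨g, h1, h2⟩ := hloc z
    filter_upwards [h2, (RExt_eventuallyEq h1 h2).filter_mono nhdsWithin_le_nhds] with w h3 h4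
    rw [h3, h4]
  obtain ⟨C, hC0, hC⟩ := poly_growth q
  obtain ⟨B, hB⟩ := hP.isBounded.exists_norm_le
  obtain ⟨p, hp⟩ := entire_poly hNa (C := C * M) (d := q.natDegree) (by
    refine (h.and_eventually ((eventually_ge_atTop 1).and (eventually_gt_atTop B))).mono ?_
    rintro R ⟨hR, hR1, hRB⟩ z hz
    have hzP : z ∉ P := fun h => by have := hB z h; linarith
    rw [RExt_self (Ψ := fun z => q.eval z * f z) (((AnalyticOnNhd.eval_polynomial (𝕜 := ℂ) q) z trivial).mul (hm.ana hzP))]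
    simp only [norm_mul]
    calc ‖q.eval z‖ * ‖f z‖ ≤ (C * R ^ q.natDegree) * M := by
          gcongr
          · exact hC R hR1 z hz
          · exact hR z hz hzP
      _ = _ := by ring)
  refine ⟨p, q, hq0, fun z0 => ?_⟩
  filter_upwards [hNe z0] with w hw
  rw [← hw, hp]

namespace Cfg
variable {f : ℂ → ℂ} {P : Set ℂ} {t0 t1 t2 : ℝ}

lemma strip_exists (C : Cfg f P t0 t1 t2) (k : ℤ) : ∃ s0 : ℝ, ∃ h : ℂ → ℂ,
    Strip h (t0 + 2 * Real.pi * k) (t1 + 2 * Real.pi * k) (t2 + 2 * Real.pi * k) s0 ∧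
    ∀ w : ℂ, s0 < w.re → w ∈ Str (t0 + 2 * Real.pi * k) (t2 + 2 * Real.pi * k) → exp w ∉ P ∧ exp (h w) = f (exp w) := by
  obtain ⟨B0, hB0⟩ := C.z0.isBounded.exists_norm_le
  obtain ⟨B1, hB1⟩ := C.z1.isBounded.exists_norm_le
  obtain ⟨B2, hB2⟩ := C.zp.isBounded.exists_norm_le
  have := C.h01; have := C.h12; have := C.h20
  have pi0 := Real.pi_pos
  set s0 := Real.log (1 + |B0| + |B1| + |B2|) with hs0
  have hbig : ∀ w : ℂ, s0 < w.re → B0 < ‖exp w‖ ∧ B1 < ‖exp w‖ ∧ B2 < ‖exp w‖ := by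
    intro w hw
    have : 1 + |B0| + |B1| + |B2| < ‖exp w‖ := by
      rw [Complex.norm_exp, ← Real.log_lt_iff_lt_exp (by positivity)]
      exact hw
    refine ⟨?_, ?_, ?_⟩ <;> linarith [le_abs_self B0, le_abs_self B1, le_abs_self B2, abs_nonneg B0, abs_nonneg B1, abs_nonneg B2]
  have hlt : ∀ m n : ℤ, 2 * Real.pi * (m:ℝ) < 2 * Real.pi * n → m < n := by
    intro m n h
    have : (m:ℝ) < n := by nlinarith
    exact_mod_cast this
  have hP : ∀ w : ℂ, s0 < w.re → w ∈ Str (t0 + 2 * Real.pi * k) (t2 + 2 * Real.pi * k) → exp w ∉ P := by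
    intro w hw hs hp
    have hr : exp w ∈ Ray t2 := by
      by_contra hr
      linarith [hB2 _ ⟨hp, hr⟩, (hbig w hw).2.2]
    obtain ⟨m, hm⟩ := exp_mem_Ray hr
    have h1 := hs.1; have h2 := hs.2
    rw [hm] at h1 h2
    have a1 := hlt m k (by linarith)
    have a2 := hlt (k-1) m (by push_cast; linarith)
    omega
  have h0 : ∀ w : ℂ, s0 < w.re → w ∈ Str (t0 + 2 * Real.pi * k) (t2 + 2 * Real.pi * k) → f (exp w) ≠ 0 := by
    intro w hw hs hp
    have hr : exp w ∈ Ray t0 := by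
      by_contra hr
      linarith [hB0 _ ⟨⟨hP w hw hs, hp⟩, hr⟩, (hbig w hw).1]
    obtain ⟨m, hm⟩ := exp_mem_Ray hr
    have h1 := hs.1; have h2 := hs.2
    rw [hm] at h1 h2
    have a1 := hlt k m (by linarith)
    have a2 := hlt m (k+1) (by push_cast; linarith)
    omega
  have h1 : ∀ w : ℂ, s0 < w.re → w ∈ Str (t0 + 2 * Real.pi * k) (t2 + 2 * Real.pi * k) → f (exp w) = 1 → w.im = t1 + 2 * Real.pi * k := by
    intro w hw hs hp
    have hr : exp w ∈ Ray t1 := by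
      by_contra hr
      linarith [hB1 _ ⟨⟨hP w hw hs, hp⟩, hr⟩, (hbig w hw).2.1]
    obtain ⟨m, hm⟩ := exp_mem_Ray hr
    have h1 := hs.1; have h2 := hs.2
    rw [hm] at h1 h2
    have a1 := hlt m (k+1) (by push_cast; linarith)
    have a2 := hlt (k-1) m (by push_cast; linarith)
    have : m = k := by omega
    rw [hm, this]
  have hconv : Convex ℝ {w : ℂ | s0 < w.re ∧ w ∈ Str (t0 + 2 * Real.pi * k) (t2 + 2 * Real.pi * k)} :=
    (convex_halfSpace_re_gt s0).inter (convex_Str _ _)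
  obtain ⟨h, hd, he⟩ := exists_holo_log (g := fun w => f (exp w)) hconv Strip.isOpen_dom (by
    rintro w ⟨hw, hs⟩
    have : DifferentiableAt ℂ (fun w => f (exp w)) w :=
      DifferentiableAt.comp w (C.mer.ana (hP w hw hs)).differentiableAt Complex.differentiableAt_exp
    exact this.differentiableWithinAt) (fun w hw => h0 w hw.1 hw.2)
  refine ⟨s0, h, ⟨by linarith, by linarith, hd, ?_⟩, ?_⟩
  · intro w hw hs hne n hn
    apply hne
    apply h1 w hw hs
    rw [← he w ⟨hw, hs⟩, hn, Complex.exp_int_mul_two_pi_mul_I]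
  · intro w hw hs
    exact ⟨hP w hw hs, he w ⟨hw, hs⟩⟩

end Cfg

lemma Strip.mono {h : ℂ → ℂ} {tm t tp s0 s0' : ℝ} (H : Strip h tm t tp s0) (hs : s0 ≤ s0') : Strip h tm t tp s0' where
  lt1 := H.lt1
  lt2 := H.lt2
  diff := H.diff.mono fun _ hw => ⟨lt_of_le_of_lt hs hw.1, hw.2⟩
  om := fun w h1 => H.om w (lt_of_le_of_lt hs h1)

structure Trip (f : ℂ → ℂ) (P : Set ℂ) (t0 t1 t2 s0 : ℝ) (h1 hi h0 : ℂ → ℂ) : Prop where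
  H1 : Strip h1 t0 t1 t2 s0
  Hi : Strip hi t1 t2 (t0 + 2 * Real.pi) s0
  H0 : Strip h0 t2 (t0 + 2 * Real.pi) (t1 + 2 * Real.pi) s0
  e1 : ∀ w : ℂ, s0 < w.re → w ∈ Str t0 t2 → exp w ∉ P ∧ exp (h1 w) = f (exp w)
  ei : ∀ w : ℂ, s0 < w.re → w ∈ Str t1 (t0 + 2 * Real.pi) → (exp w ∈ P ∧ exp (hi w) = 1) ∨
    (exp w ∉ P ∧ f (exp w) ≠ 0 ∧ exp (hi w) = 1 - (f (exp w))⁻¹)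
  e0 : ∀ w : ℂ, s0 < w.re → w ∈ Str t2 (t1 + 2 * Real.pi) → exp w ∉ P ∧ f (exp w) ≠ 1 ∧ exp (h0 w) = (1 - f (exp w))⁻¹

lemma Cfg.trip {f : ℂ → ℂ} {P : Set ℂ} {t0 t1 t2 : ℝ} (C : Cfg f P t0 t1 t2) :
    ∃ s0 h1 hi h0, Trip f P t0 t1 t2 s0 h1 hi h0 := by
  obtain ⟨s1, h1, H1, e1⟩ := C.strip_exists 0
  obtain ⟨s2, h0, H0, e0⟩ := C.rot.strip_exists 0
  obtain ⟨s3, hi, Hi, ei⟩ := C.rot.rot.strip_exists (-1)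
  have a1 : t1 + 2 * Real.pi + 2 * Real.pi * ((-1 : ℤ) : ℝ) = t1 := by push_cast; ring
  have a2 : t2 + 2 * Real.pi + 2 * Real.pi * ((-1 : ℤ) : ℝ) = t2 := by push_cast; ring
  have a3 : t0 + 2 * Real.pi + 2 * Real.pi + 2 * Real.pi * ((-1 : ℤ) : ℝ) = t0 + 2 * Real.pi := by push_cast; ring
  simp only [Int.cast_zero, mul_zero, add_zero] at H1 e1 H0 e0
  rw [a1, a2, a3] at Hi
  rw [a1, a3] at ei
  set s0 := max s1 (max s2 s3)
  have l1 : s1 ≤ s0 := le_max_left _ _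
  have l2 : s2 ≤ s0 := (le_max_left _ _).trans (le_max_right _ _)
  have l3 : s3 ≤ s0 := (le_max_right _ _).trans (le_max_right _ _)
  refine ⟨s0, h1, hi, h0, H1.mono l1, Hi.mono l3, H0.mono l2, fun w hw => e1 w (l1.trans_lt hw), ?_, ?_⟩
  · intro w hw hs
    obtain ⟨g1, g2⟩ := ei w (l3.trans_lt hw) hs
    have g3 : exp w ∉ rotP f P := by
      intro g
      rw [rot_pole g] at g2
      exact Complex.exp_ne_zero _ g2
    rw [rot_of g3] at g2
    by_cases hp : exp w ∈ P
    · left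
      rw [rot_pole hp, sub_zero, inv_one] at g2
      exact ⟨hp, g2⟩
    · right
      have n1 : f (exp w) ≠ 1 := fun h => g3 ⟨hp, h⟩
      have n1' : 1 - f (exp w) ≠ 0 := sub_ne_zero.2 (Ne.symm n1)
      have n0 : f (exp w) ≠ 0 := by
        intro h
        apply g1
        refine ⟨g3, ?_⟩
        rw [rot_of hp, h]; simp
      refine ⟨hp, n0, ?_⟩
      rw [g2, rot_of hp]
      have : 1 - (1 - f (exp w))⁻¹ = - f (exp w) * (1 - f (exp w))⁻¹ := by field_simp; ring
      rw [this, mul_inv, inv_inv]; field_simp; ring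
  · intro w hw hs
    obtain ⟨g1, g2⟩ := e0 w (l2.trans_lt hw) hs
    have hp : exp w ∉ P := by
      intro hp
      rw [rot_pole hp] at g2
      exact Complex.exp_ne_zero _ g2
    refine ⟨hp, fun h => g1 ⟨hp, h⟩, ?_⟩
    rw [g2, rot_of hp]

/-! ### states -/
inductive Q4
  | z | o | i | n

section St
variable (l : Ultrafilter ℝ) (g : ℝ → ℂ)

def T0 : Prop := Tendsto g l (𝓝 0)
def T1 : Prop := Tendsto g l (𝓝 1)
def Ti : Prop := Tendsto (fun s => ‖g s‖) l atTop
def TN : Prop := ∃ v : ℂ, v ≠ 0 ∧ v ≠ 1 ∧ Tendsto g l (𝓝 v)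

open Classical in
def stt : Q4 := if T0 l g then Q4.z else if T1 l g then Q4.o else if Ti l g then Q4.i else Q4.n

variable {l g}

lemma not_Ti {v : ℂ} (h : Tendsto g l (𝓝 v)) : ¬ Ti l g := fun hi => not_tendsto_nhds_of_tendsto_atTop hi _ h.norm

lemma ultra_bdd {K : ℝ} (h : ∀ᶠ s in (l : Filter ℝ), ‖g s‖ ≤ K) : ∃ v, Tendsto g l (𝓝 v) := by
  have hc : IsCompact (Metric.closedBall (0:ℂ) K) := isCompact_closedBall _ _
  have h2 : (l.map g : Filter ℂ) ≤ 𝓟 (Metric.closedBall (0:ℂ) K) := by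
    rw [le_principal_iff]
    refine Filter.mem_map.2 ?_
    filter_upwards [h] with s hs
    simpa using hs
  obtain ⟨v, -, hv⟩ := hc.ultrafilter_le_nhds (l.map g) h2
  exact ⟨v, hv⟩

lemma ultra_dich : (∃ v, Tendsto g l (𝓝 v)) ∨ Ti l g := by
  by_cases h : ∃ K, ∀ᶠ s in (l : Filter ℝ), ‖g s‖ ≤ K
  · obtain ⟨K, h⟩ := h; exact Or.inl (ultra_bdd h)
  · right
    refine tendsto_atTop.2 fun K => ?_
    push Not at h
    have := h K
    filter_upwards [this] with s hs using hs.le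

lemma stt_z : stt l g = Q4.z ↔ T0 l g := by
  unfold stt; split_ifs <;> simp_all
lemma stt_o : stt l g = Q4.o ↔ T1 l g := by
  have h : T0 l g → ¬ T1 l g := fun h1 h2 => zero_ne_one (tendsto_nhds_unique h1 h2)
  unfold stt; split_ifs <;> simp_all
lemma stt_i : stt l g = Q4.i ↔ Ti l g := by
  have h : T0 l g → ¬ Ti l g := fun h1 => not_Ti h1
  have h : T1 l g → ¬ Ti l g := fun h1 => not_Ti h1
  unfold stt; split_ifs <;> simp_all
lemma stt_n : stt l g = Q4.n ↔ TN l g := by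
  constructor
  · intro h
    have h0 : ¬ T0 l g := fun h' => by rw [← stt_z] at h'; simp_all
    have h1 : ¬ T1 l g := fun h' => by rw [← stt_o] at h'; simp_all
    have hi : ¬ Ti l g := fun h' => by rw [← stt_i] at h'; simp_all
    rcases ultra_dich (l := l) (g := g) with ⟨v, hv⟩ | h2
    · exact ⟨v, by rintro rfl; exact h0 hv, by rintro rfl; exact h1 hv, hv⟩
    · exact absurd h2 hi
  · rintro ⟨v, v0, v1, hv⟩
    have h0 : ¬ T0 l g := fun h' => v0 (tendsto_nhds_unique hv h')
    have h1 : ¬ T1 l g := fun h' => v1 (tendsto_nhds_unique hv h')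
    have hi : ¬ Ti l g := not_Ti hv
    unfold stt; split_ifs; rfl

lemma lim_ne0_iff : (∃ v : ℂ, v ≠ 0 ∧ Tendsto g l (𝓝 v)) ↔ (stt l g = Q4.o ∨ stt l g = Q4.n) := by
  rw [stt_o, stt_n]
  constructor
  · rintro ⟨v, h0, hv⟩
    by_cases h1 : v = 1
    · left; rw [h1] at hv; exact hv
    · right; exact ⟨v, h0, h1, hv⟩
  · rintro (h | ⟨v, h0, -, hv⟩)
    · exact ⟨1, one_ne_zero, h⟩
    · exact ⟨v, h0, hv⟩

/-- the cyclic substitution on states -/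
lemma lim0_iff {g' : ℝ → ℂ} (h : ∀ᶠ s in (l : Filter ℝ), g s ≠ 1 ∧ g' s = (1 - g s)⁻¹) :
    (∃ v : ℂ, v ≠ 0 ∧ Tendsto g' l (𝓝 v)) ↔ (stt l g = Q4.z ∨ stt l g = Q4.n) := by
  rw [stt_z, stt_n]
  constructor
  · rintro ⟨v, h0, hv⟩
    have h2 : Tendsto g l (𝓝 (1 - v⁻¹)) := by
      have := (tendsto_const_nhds (x := (1:ℂ))).sub (hv.inv₀ h0)
      refine this.congr' ?_
      filter_upwards [h] with s hs
      rw [hs.2, inv_inv]; ring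
    have h3 : 1 - v⁻¹ ≠ 1 := by
      intro h; apply inv_ne_zero h0; linear_combination -h
    by_cases h1 : 1 - v⁻¹ = 0
    · left; rw [h1] at h2; exact h2
    · right; exact ⟨_, h1, h3, h2⟩
  · have key : ∀ v : ℂ, v ≠ 1 → Tendsto g l (𝓝 v) → (∃ v : ℂ, v ≠ 0 ∧ Tendsto g' l (𝓝 v)) := by
      intro v h1 hv
      have h1' : 1 - v ≠ 0 := sub_ne_zero.2 (Ne.symm h1)
      refine ⟨(1 - v)⁻¹, inv_ne_zero h1', ?_⟩
      have := ((tendsto_const_nhds (x := (1:ℂ))).sub hv).inv₀ h1'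
      refine this.congr' ?_
      filter_upwards [h] with s hs
      rw [hs.2]
    rintro (h | ⟨v, h0, h1, hv⟩)
    · exact key 0 zero_ne_one h
    · exact key v h1 hv

lemma limi_iff {g' : ℝ → ℂ} (h : ∀ᶠ s in (l : Filter ℝ), g s ≠ 0 ∧ g' s = 1 - (g s)⁻¹) :
    (∃ v : ℂ, v ≠ 0 ∧ Tendsto g' l (𝓝 v)) ↔ (stt l g = Q4.i ∨ stt l g = Q4.n) := by
  rw [stt_i, stt_n]
  constructor
  · rintro ⟨v, h0, hv⟩
    have h2 : Tendsto (fun s => (g s)⁻¹) l (𝓝 (1 - v)) := by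
      have := (tendsto_const_nhds (x := (1:ℂ))).sub hv
      refine this.congr' ?_
      filter_upwards [h] with s hs
      rw [hs.2]; ring
    by_cases h1 : v = 1
    · left
      rw [h1, sub_self] at h2
      have h3 : Tendsto (fun s => (g s)⁻¹) l (𝓝[≠] 0) := tendsto_nhdsWithin_iff.2 ⟨h2, by
        filter_upwards [h] with s hs using inv_ne_zero hs.1⟩
      have h4 := tendsto_norm_cobounded_atTop.comp (tendsto_inv₀_nhdsNE_zero.comp h3)
      refine h4.congr fun s => ?_
      simp
    · right
      have h1' : 1 - v ≠ 0 := sub_ne_zero.2 (Ne.symm h1)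
      refine ⟨(1 - v)⁻¹, inv_ne_zero h1', ?_, ?_⟩
      · intro h; rw [inv_eq_one] at h; apply h0; linear_combination -h
      · have := h2.inv₀ h1'
        simpa using this
  · rintro (hi | ⟨v, h0, h1, hv⟩)
    · refine ⟨1, one_ne_zero, ?_⟩
      have h2 : Tendsto (fun s => (g s)⁻¹) l (𝓝 0) := by
        refine tendsto_inv₀_cobounded.comp ?_
        rw [← tendsto_norm_atTop_iff_cobounded]; exact hi
      have := (tendsto_const_nhds (x := (1:ℂ))).sub h2
      rw [sub_zero] at this
      refine this.congr' ?_
      filter_upwards [h] with s hs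
      rw [hs.2]
    · refine ⟨1 - v⁻¹, ?_, ?_⟩
      · intro h
        apply h1
        rw [← inv_eq_one]; linear_combination -h
      · have := (tendsto_const_nhds (x := (1:ℂ))).sub (hv.inv₀ h0)
        refine this.congr' ?_
        filter_upwards [h] with s hs
        rw [hs.2]

end St

namespace Strip
variable {h : ℂ → ℂ} {tm t tp s0 : ℝ} {l : Ultrafilter ℝ}

def Bd (h : ℂ → ℂ) (l : Ultrafilter ℝ) (a : ℂ) : Prop := ∃ K : ℝ, ∀ᶠ s : ℝ in (l : Filter ℝ), |(h (a + s)).re| ≤ K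

lemma bd_iff {a : ℂ} : Bd h l a ↔ ∃ v : ℂ, v ≠ 0 ∧ Tendsto (fun s : ℝ => exp (h (a + s))) l (𝓝 v) := by
  constructor
  · rintro ⟨K, hK⟩
    obtain ⟨v, hv⟩ := ultra_bdd (l := l) (g := fun s : ℝ => exp (h (a + s))) (K := Real.exp K) (by
      filter_upwards [hK] with s hs
      rw [Complex.norm_exp]
      exact Real.exp_le_exp.2 ((le_abs_self _).trans hs))
    refine ⟨v, ?_, hv⟩
    rintro rfl
    have h1 : Real.exp (-K) ≤ ‖(0:ℂ)‖ := by
      refine ge_of_tendsto hv.norm ?_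
      filter_upwards [hK] with s hs
      rw [Complex.norm_exp]
      exact Real.exp_le_exp.2 ((abs_le.1 hs).1)
    rw [norm_zero] at h1
    linarith [Real.exp_pos (-K)]
  · rintro ⟨v, h0, hv⟩
    have h3 : Tendsto (fun s : ℝ => Real.log ‖exp (h (a + s))‖) l (𝓝 (Real.log ‖v‖)) :=
      ((Real.continuousAt_log (norm_ne_zero_iff.2 h0)).tendsto).comp hv.norm
    simp only [Complex.norm_exp, Real.log_exp] at h3
    refine ⟨|Real.log ‖v‖| + 1, h3.abs.eventually (ge_mem_nhds (by linarith))⟩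

lemma bd_of (H : Strip h tm t tp s0) (hl : (l : Filter ℝ) ≤ atTop) {a b : ℂ} (ha : a ∈ Str tm tp) (hat : a.im ≠ t)
    (hb : b ∈ Str tm tp) (hbd : Bd h l a) : Bd h l b := by
  obtain ⟨K, hK⟩ := hbd
  obtain ⟨K1, hK1, hc⟩ := H.cmp hl ha hat hb
  refine ⟨K1 * (1 + K), ?_⟩
  filter_upwards [hK, hc] with s h1 h2
  nlinarith

end Strip

lemma ev_re {l : Ultrafilter ℝ} (hl : (l : Filter ℝ) ≤ atTop) (s0 : ℝ) (w : ℂ) : ∀ᶠ s : ℝ in (l : Filter ℝ), s0 < (w + s).re := by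
  filter_upwards [hl (eventually_gt_atTop (s0 - w.re))] with s hs
  simp; linarith

namespace Trip
variable {f : ℂ → ℂ} {P : Set ℂ} {t0 t1 t2 s0 : ℝ} {h1 hi h0 : ℂ → ℂ} {l : Ultrafilter ℝ}

lemma lts (T : Trip f P t0 t1 t2 s0 h1 hi h0) : t0 < t1 ∧ t1 < t2 ∧ t2 < t0 + 2 * Real.pi :=
  ⟨T.H1.lt1, T.H1.lt2, T.Hi.lt2⟩

def st (f : ℂ → ℂ) (l : Ultrafilter ℝ) (w : ℂ) : Q4 := stt l (fun s : ℝ => f (exp (w + s)))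

lemma exp_per (w : ℂ) (s : ℝ) : exp (w + 2 * Real.pi * I + s) = exp (w + s) := by
  have : w + 2 * Real.pi * I + s = w + s + 2 * Real.pi * I := by ring
  rw [this, Complex.exp_add, Complex.exp_two_pi_mul_I, mul_one]

lemma st_per (w : ℂ) : st f l (w + 2 * Real.pi * I) = st f l w := by
  unfold st; simp only [exp_per]

lemma ne1 (T : Trip f P t0 t1 t2 s0 h1 hi h0) {w : ℂ} (hw : s0 < w.re) (hs : w ∈ Str t0 t2) (ht : w.im ≠ t1) :
    f (exp w) ≠ 1 := by
  intro h
  have h2 := (T.e1 w hw hs).2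
  rw [h, Complex.exp_eq_one_iff] at h2
  obtain ⟨n, hn⟩ := h2
  exact T.H1.om w hw hs ht n hn

lemma ei' (T : Trip f P t0 t1 t2 s0 h1 hi h0) {w : ℂ} (hw : s0 < w.re) (hs : w ∈ Str t1 (t0 + 2 * Real.pi)) (ht : w.im ≠ t2) :
    exp w ∉ P ∧ f (exp w) ≠ 0 ∧ exp (hi w) = 1 - (f (exp w))⁻¹ := by
  rcases T.ei w hw hs with ⟨-, h2⟩ | h2
  · exfalso
    rw [Complex.exp_eq_one_iff] at h2
    obtain ⟨n, hn⟩ := h2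
    exact T.Hi.om w hw hs ht n hn
  · exact h2

lemma bit1 (T : Trip f P t0 t1 t2 s0 h1 hi h0) (hl : (l : Filter ℝ) ≤ atTop) {w : ℂ} (hs : w ∈ Str t0 t2) :
    Strip.Bd h1 l w ↔ (st f l w = Q4.o ∨ st f l w = Q4.n) := by
  rw [Strip.bd_iff, st, ← lim_ne0_iff]
  refine exists_congr fun v => and_congr_right fun _ => tendsto_congr' ?_
  filter_upwards [ev_re hl s0 w] with s hr
  exact (T.e1 _ hr (add_real_mem_Str.2 hs)).2

lemma bit0 (T : Trip f P t0 t1 t2 s0 h1 hi h0) (hl : (l : Filter ℝ) ≤ atTop) {w : ℂ} (hs : w ∈ Str t2 (t1 + 2 * Real.pi)) :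
    Strip.Bd h0 l w ↔ (st f l w = Q4.z ∨ st f l w = Q4.n) := by
  rw [Strip.bd_iff, st, lim0_iff]
  filter_upwards [ev_re hl s0 w] with s hr
  exact (T.e0 _ hr (add_real_mem_Str.2 hs)).2

lemma biti (T : Trip f P t0 t1 t2 s0 h1 hi h0) (hl : (l : Filter ℝ) ≤ atTop) {w : ℂ} (hs : w ∈ Str t1 (t0 + 2 * Real.pi)) (ht : w.im ≠ t2) :
    Strip.Bd hi l w ↔ (st f l w = Q4.i ∨ st f l w = Q4.n) := by
  rw [Strip.bd_iff, st, limi_iff]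
  filter_upwards [ev_re hl s0 w] with s hr
  exact (T.ei' hr (add_real_mem_Str.2 hs) (by simpa using ht)).2

lemma eq1 (T : Trip f P t0 t1 t2 s0 h1 hi h0) (hl : (l : Filter ℝ) ≤ atTop) {a b : ℂ} (ha : a ∈ Str t0 t1) (hb : b ∈ Str t1 t2) :
    (st f l a = Q4.o ∨ st f l a = Q4.n) ↔ (st f l b = Q4.o ∨ st f l b = Q4.n) := by
  have ha' := Str_mono le_rfl T.H1.lt2.le ha
  have hb' := Str_mono T.H1.lt1.le le_rfl hb
  rw [← T.bit1 hl ha', ← T.bit1 hl hb']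
  exact ⟨T.H1.bd_of hl ha' ha.2.ne hb', T.H1.bd_of hl hb' hb.1.ne' ha'⟩

lemma eqi (T : Trip f P t0 t1 t2 s0 h1 hi h0) (hl : (l : Filter ℝ) ≤ atTop) {a b : ℂ} (ha : a ∈ Str t1 t2) (hb : b ∈ Str t2 (t0 + 2 * Real.pi)) :
    (st f l a = Q4.i ∨ st f l a = Q4.n) ↔ (st f l b = Q4.i ∨ st f l b = Q4.n) := by
  have ha' := Str_mono le_rfl T.Hi.lt2.le ha
  have hb' := Str_mono T.Hi.lt1.le le_rfl hb
  rw [← T.biti hl ha' ha.2.ne, ← T.biti hl hb' hb.1.ne']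
  exact ⟨T.Hi.bd_of hl ha' ha.2.ne hb', T.Hi.bd_of hl hb' hb.1.ne' ha'⟩

lemma shift_mem {a : ℂ} {α β : ℝ} (ha : a ∈ Str α β) : a + 2 * Real.pi * I ∈ Str (α + 2 * Real.pi) (β + 2 * Real.pi) := by
  constructor <;> simp <;> linarith [ha.1, ha.2]

lemma eq0 (T : Trip f P t0 t1 t2 s0 h1 hi h0) (hl : (l : Filter ℝ) ≤ atTop) {a b : ℂ} (ha : a ∈ Str t0 t1) (hb : b ∈ Str t2 (t0 + 2 * Real.pi)) :
    (st f l a = Q4.z ∨ st f l a = Q4.n) ↔ (st f l b = Q4.z ∨ st f l b = Q4.n) := by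
  rw [← st_per (w := a)]
  have ha := shift_mem ha
  set a := a + 2 * Real.pi * I
  have ha' := Str_mono T.H0.lt1.le le_rfl ha
  have hb' := Str_mono le_rfl T.H0.lt2.le hb
  rw [← T.bit0 hl ha', ← T.bit0 hl hb']
  exact ⟨T.H0.bd_of hl ha' ha.1.ne' hb', T.H0.bd_of hl hb' hb.2.ne ha'⟩

lemma st_classify (T : Trip f P t0 t1 t2 s0 h1 hi h0) (hl : (l : Filter ℝ) ≤ atTop) :
    ∃ x y u : Q4, (∀ a ∈ Str t0 t1, st f l a = x) ∧ (∀ b ∈ Str t1 t2, st f l b = y) ∧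
      (∀ c ∈ Str t2 (t0 + 2 * Real.pi), st f l c = u) ∧
      ((x = Q4.n ∧ y = Q4.n ∧ u = Q4.n) ∨ (x = Q4.i ∧ y = Q4.z ∧ u = Q4.o) ∨
       (x = y ∧ y = u ∧ x ≠ Q4.n)) := by
  obtain ⟨a, ha⟩ : ∃ a, a ∈ Str t0 t1 := ⟨_, T.H1.mem_low⟩
  obtain ⟨b, hb⟩ : ∃ a, a ∈ Str t1 t2 := ⟨_, T.H1.mem_up⟩
  obtain ⟨c, hc⟩ : ∃ a, a ∈ Str t2 (t0 + 2 * Real.pi) := ⟨_, T.Hi.mem_up⟩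
  have k1 := T.eq1 hl ha hb
  have k2 := T.eqi hl hb hc
  have k3 := T.eq0 hl ha hc
  have ka : ∀ a' ∈ Str t0 t1, st f l a' = st f l a := by
    intro a' ha'
    have m1 := T.eq1 hl ha' hb
    have m3 := T.eq0 hl ha' hc
    rw [← k1] at m1; rw [← k3] at m3
    cases h1 : st f l a <;> cases h2 : st f l a' <;> simp_all
  have kb : ∀ a' ∈ Str t1 t2, st f l a' = st f l b := by
    intro a' ha'
    have m1 := T.eq1 hl ha ha'
    have m3 := T.eqi hl ha' hc
    rw [k1] at m1; rw [← k2] at m3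
    cases h1 : st f l b <;> cases h2 : st f l a' <;> simp_all
  have kc : ∀ a' ∈ Str t2 (t0 + 2 * Real.pi), st f l a' = st f l c := by
    intro a' ha'
    have m1 := T.eqi hl hb ha'
    have m3 := T.eq0 hl ha ha'
    rw [k2] at m1; rw [k3] at m3
    cases h1 : st f l c <;> cases h2 : st f l a' <;> simp_all
  refine ⟨_, _, _, ka, kb, kc, ?_⟩
  -- exclusions
  have x1 : st f l a = Q4.o → st f l b = Q4.o := by
    intro ho
    have hp := T.H1.propagate_one hl le_rfl T.H1.lt2.le (Or.inr le_rfl) T.H1.lt1 (by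
      intro w hw
      have h2 := ka w hw
      rw [ho, st, stt_o] at h2
      refine Tendsto.congr' ?_ h2
      filter_upwards [ev_re hl s0 w] with s hr
      exact (T.e1 _ hr (add_real_mem_Str.2 (Str_mono le_rfl T.H1.lt2.le hw))).2.symm)
    have hb' := Str_mono T.H1.lt1.le le_rfl hb
    rw [st, stt_o]
    have h3 : Tendsto (fun s : ℝ => exp (h1 (b + s))) l (𝓝 1) := hp.tendsto_at hb'
    refine h3.congr' ?_
    filter_upwards [ev_re hl s0 b] with s hr
    exact (T.e1 _ hr (add_real_mem_Str.2 hb')).2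
  have x2 : st f l b = Q4.o → st f l a = Q4.o := by
    intro ho
    have hp := T.H1.propagate_one hl T.H1.lt1.le le_rfl (Or.inl le_rfl) T.H1.lt2 (by
      intro w hw
      have h2 := kb w hw
      rw [ho, st, stt_o] at h2
      refine Tendsto.congr' ?_ h2
      filter_upwards [ev_re hl s0 w] with s hr
      exact (T.e1 _ hr (add_real_mem_Str.2 (Str_mono T.H1.lt1.le le_rfl hw))).2.symm)
    have ha' := Str_mono le_rfl T.H1.lt2.le ha
    rw [st, stt_o]
    have h3 : Tendsto (fun s : ℝ => exp (h1 (a + s))) l (𝓝 1) := hp.tendsto_at ha'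
    refine h3.congr' ?_
    filter_upwards [ev_re hl s0 a] with s hr
    exact (T.e1 _ hr (add_real_mem_Str.2 ha')).2
  have x3 : st f l a = Q4.z → st f l c = Q4.z := by
    intro ho
    have hp := T.H0.propagate_one hl T.H0.lt1.le le_rfl (Or.inl le_rfl) T.H0.lt2 (by
      intro w hw
      have h2 := ka (w - 2 * Real.pi * I) (by
        have := shift_mem (a := w - 2 * Real.pi * I) (α := t0) (β := t1)
        constructor <;> simp <;> linarith [hw.1, hw.2])
      rw [← st_per, sub_add_cancel, ho, st, stt_z] at h2
      have h3 := ((tendsto_const_nhds (x := (1:ℂ))).sub h2).inv₀ (by simp)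
      rw [sub_zero, inv_one] at h3
      refine Tendsto.congr' ?_ h3
      filter_upwards [ev_re hl s0 w] with s hr
      exact (T.e0 _ hr (add_real_mem_Str.2 (Str_mono T.H0.lt1.le le_rfl hw))).2.2.symm)
    have hc' := Str_mono le_rfl T.H0.lt2.le hc
    rw [st, stt_z]
    have h3 : Tendsto (fun s : ℝ => exp (h0 (c + s))) l (𝓝 1) := hp.tendsto_at hc'
    have h4 := (tendsto_const_nhds (x := (1:ℂ))).sub (h3.inv₀ one_ne_zero)
    rw [inv_one, sub_self] at h4
    refine h4.congr' ?_
    filter_upwards [ev_re hl s0 c] with s hr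
    rw [(T.e0 _ hr (add_real_mem_Str.2 hc')).2.2, inv_inv]; ring
  clear ka kb kc
  cases e1 : st f l a <;> cases e2 : st f l b <;> cases e3 : st f l c <;> simp_all

end Trip

lemma reflect_aux {Φ : ℂ → ℂ} {α t β : ℝ} (hd : DifferentiableOn ℂ Φ (Str α β)) (h1 : α < t) (h2 : t - α < β - t)
    (hp : ∀ w ∈ Str α t, 0 ≤ (Φ w).re) (hn : ∀ w ∈ Str t β, (Φ w).re ≤ 0)
    (hb : Tendsto (fun ε : ℝ => (Φ ((α + ε : ℝ) * I)).re) (𝓝[>] 0) (𝓝 0)) :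
    ∀ w ∈ Str α β, (Φ w).re = 0 := by
  have htβ : t < β := by linarith
  have hca : ∀ w ∈ Str α β, ContinuousAt (fun w => (Φ w).re) w := fun w hw =>
    Complex.continuous_re.continuousAt.comp (hd.continuousOn.continuousAt ((isOpen_Str _ _).mem_nhds hw))
  have hline : ∀ x : ℝ, (Φ (x + t * I)).re = 0 := by
    intro x
    have hm : (x : ℂ) + t * I ∈ Str α β := by constructor <;> simp <;> assumption
    have hev : ∀ᶠ ε : ℝ in 𝓝[>] 0, ε < min (t - α) (β - t) :=
      mem_nhdsWithin_of_mem_nhds (gt_mem_nhds (by rw [lt_min_iff]; constructor <;> linarith))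
    refine le_antisymm ?_ ?_
    · have := line_limit (g := fun w => -(Φ w).re) (σ := 1) (hca _ hm).neg (by
        filter_upwards [hev, self_mem_nhdsWithin] with ε h3 h4
        have h4 : 0 < ε := h4
        rw [lt_min_iff] at h3
        have := hn (x + t * I + (1 * ε : ℝ) * I) (by constructor <;> simp <;> linarith)
        linarith)
      linarith
    · exact line_limit (g := fun w => (Φ w).re) (σ := -1) (hca _ hm) (by
        filter_upwards [hev, self_mem_nhdsWithin] with ε h3 h4
        have h4 : 0 < ε := h4
        rw [lt_min_iff] at h3
        exact hp _ (by constructor <;> simp <;> linarith))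
  set γ := 2 * t - α with hγ
  have hγβ : γ < β := by linarith
  have htγ : t < γ := by linarith
  have hsub : Str α γ ⊆ Str α β := Str_mono le_rfl hγβ.le
  set cj := starRingEnd ℂ with hcj
  set Ψ : ℂ → ℂ := fun w => Φ w + cj (Φ (cj w + 2 * t * I)) with hΨ
  have hrefl : ∀ w ∈ Str α γ, cj w + 2 * t * I ∈ Str α γ := by
    intro w hw
    have a1 := hw.1; have a2 := hw.2
    constructor <;> simp [hcj] <;> linarith
  have hΨd : DifferentiableOn ℂ Ψ (Str α γ) := by
    intro w hw
    refine DifferentiableAt.differentiableWithinAt ?_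
    refine DifferentiableAt.add (hd.differentiableAt ((isOpen_Str _ _).mem_nhds (hsub hw))) ?_
    have e : (fun w => cj (Φ (cj w + 2 * t * I))) = cj ∘ (fun v => Φ (v + 2 * t * I)) ∘ cj := by
      ext; rfl
    rw [e, differentiableAt_conj_conj_iff]
    refine DifferentiableAt.comp (g := Φ) (f := fun v => v + 2 * t * I) _ ?_ (by fun_prop)
    exact hd.differentiableAt ((isOpen_Str _ _).mem_nhds (hsub (hrefl w hw)))
  have hmem : (t : ℂ) * I ∈ Str α γ := by constructor <;> simp <;> linarith
  have hz := (hΨd.analyticOnNhd (isOpen_Str _ _)).eqOn_zero_of_preconnected_of_frequently_eq_zero (preconn_Str _ _) hmem (by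
    have ht : Tendsto (fun x : ℝ => (x : ℂ) + t * I) (𝓝[≠] 0) (𝓝[≠] (t * I)) := by
      refine tendsto_nhdsWithin_iff.2 ⟨?_, ?_⟩
      · have : Continuous (fun x : ℝ => (x : ℂ) + t * I) := by fun_prop
        have := this.tendsto 0
        simp only [Complex.ofReal_zero, zero_add] at this
        exact this.mono_left nhdsWithin_le_nhds
      · filter_upwards [self_mem_nhdsWithin] with x hx
        have hx : x ≠ 0 := hx
        simpa using hx
    refine ht.frequently (Eventually.frequently (Eventually.of_forall fun x => ?_))
    simp only [hΨ]
    have e : cj ((x:ℂ) + t * I) + 2 * t * I = x + t * I := by simp [hcj]; ring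
    rw [e, hcj, Complex.add_conj, hline x]; simp)
  have hodd : ∀ w ∈ Str α γ, (Φ w).re = - (Φ (cj w + 2 * t * I)).re := by
    intro w hw
    have := congrArg Complex.re (hz hw)
    simp [hΨ, hcj] at this
    simp only [hcj]
    linarith
  set p : ℂ := (γ : ℂ) * I with hpdef
  have hpm : p ∈ Str t β := by constructor <;> simp [hpdef] <;> linarith
  have hp0 : (Φ p).re = 0 := by
    have c1 : Tendsto (fun ε : ℝ => (Φ ((γ - ε : ℝ) * I)).re) (𝓝[>] 0) (𝓝 (Φ p).re) := by
      have hc : Tendsto (fun ε : ℝ => ((γ - ε : ℝ) : ℂ) * I) (𝓝[>] 0) (𝓝 p) := by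
        have : Continuous (fun ε : ℝ => ((γ - ε : ℝ) : ℂ) * I) := by fun_prop
        have := this.tendsto 0
        simp only [sub_zero] at this
        exact this.mono_left nhdsWithin_le_nhds
      exact (hca p (Str_mono h1.le le_rfl hpm)).tendsto.comp hc
    refine tendsto_nhds_unique c1 ?_
    have c2 := hb.neg
    rw [neg_zero] at c2
    refine c2.congr' ?_
    have hev : ∀ᶠ ε : ℝ in 𝓝[>] 0, ε < γ - α :=
      mem_nhdsWithin_of_mem_nhds (gt_mem_nhds (by linarith))
    filter_upwards [hev, self_mem_nhdsWithin] with ε h3 h4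
    have h4 : 0 < ε := h4
    have h5 := hodd (((α + ε : ℝ) : ℂ) * I) (by constructor <;> simp <;> linarith)
    rw [h5, neg_neg]
    congr 2
    simp [hcj, hγ]; ring
  have hmax : IsMaxOn (norm ∘ fun z => exp (Φ z)) (Str t β) p := by
    intro z hz
    simp only [Function.comp, mem_ofPred_eq, Complex.norm_exp, hp0]
    exact Real.exp_le_exp.2 (hn z hz)
  have hconst := Complex.eqOn_of_isPreconnected_of_isMaxOn_norm (preconn_Str t β) (isOpen_Str t β)
    ((hd.mono (Str_mono h1.le le_rfl)).cexp) hpm hmax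
  have hall := identity_Str hd.cexp (differentiableOn_const (exp (Φ p))) h1.le le_rfl htβ (fun w hw => hconst hw)
  intro w hw
  have := congrArg norm (hall w hw)
  rw [Complex.norm_exp, Complex.norm_exp, hp0] at this
  exact Real.exp_injective this

def TypeI (f : ℂ → ℂ) (l : Ultrafilter ℝ) (t0 t1 t2 : ℝ) : Prop :=
  (∀ w ∈ Str t0 t1, Ti l (fun s : ℝ => f (exp (w + s)))) ∧ (∀ w ∈ Str t1 t2, T0 l (fun s : ℝ => f (exp (w + s)))) ∧
  (∀ w ∈ Str t2 (t0 + 2 * Real.pi), T1 l (fun s : ℝ => f (exp (w + s))))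

lemma re_eq_log (w : ℂ) : w.re = Real.log ‖exp w‖ := by rw [Complex.norm_exp, Real.log_exp]

namespace Trip
variable {f : ℂ → ℂ} {P : Set ℂ} {t0 t1 t2 s0 : ℝ} {h1 hi h0 : ℂ → ℂ} {l : Ultrafilter ℝ}

lemma gap (T : Trip f P t0 t1 t2 s0 h1 hi h0) (hl : (l : Filter ℝ) ≤ atTop) (hI : TypeI f l t0 t1 t2) :
    t2 - t1 ≤ t1 - t0 := by
  by_contra hcon
  push Not at hcon
  obtain ⟨hA, hB, hC⟩ := hI
  obtain ⟨a01, a12, a20⟩ := T.lts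
  set t3 := t0 + 2 * Real.pi with ht3
  have u1A : ∀ w ∈ Str t0 t1, Tendsto (fun s : ℝ => (h1 (w + s)).re) l atTop := by
    intro w hw
    refine (Real.tendsto_log_atTop.comp (hA w hw)).congr' ?_
    filter_upwards [ev_re hl s0 w] with s hr
    rw [re_eq_log, (T.e1 _ hr (add_real_mem_Str.2 (Str_mono le_rfl a12.le hw))).2]; rfl
  have u1B : ∀ w ∈ Str t1 t2, ∀ᶠ s : ℝ in (l : Filter ℝ), (h1 (w + s)).re ≤ 0 := by
    intro w hw
    have h2 := (hB w hw).norm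
    rw [norm_zero] at h2
    filter_upwards [ev_re hl s0 w, h2.eventually (ge_mem_nhds one_pos)] with s hr h3
    rw [re_eq_log, (T.e1 _ hr (add_real_mem_Str.2 (Str_mono a01.le le_rfl hw))).2]
    exact Real.log_nonpos (norm_nonneg _) h3
  have u0C : ∀ w ∈ Str t2 t3, ∀ᶠ s : ℝ in (l : Filter ℝ), 0 ≤ (h0 (w + s)).re := by
    intro w hw
    have h2 := ((tendsto_const_nhds (x := (1:ℂ))).sub (hC w hw)).norm
    rw [sub_self, norm_zero] at h2
    filter_upwards [ev_re hl s0 w, h2.eventually (ge_mem_nhds one_pos)] with s hr h3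
    obtain ⟨-, n1, e⟩ := T.e0 _ hr (add_real_mem_Str.2 (Str_mono le_rfl T.H0.lt2.le hw))
    rw [re_eq_log, e, norm_inv]
    refine Real.log_nonneg ((one_le_inv₀ ?_).2 h3)
    exact norm_pos_iff.2 (sub_ne_zero.2 (Ne.symm n1))
  have u01 : ∀ w ∈ Str t0 t1, Tendsto (fun s : ℝ => (h0 (w + 2 * Real.pi * I + s)).re + (h1 (w + s)).re) l (𝓝 0) := by
    intro w hw
    have hw' := shift_mem hw
    have h2 : Tendsto (fun s : ℝ => (f (exp (w + s)))⁻¹) l (𝓝 0) := by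
      refine tendsto_inv₀_cobounded.comp ?_
      rw [← tendsto_norm_atTop_iff_cobounded]; exact hA w hw
    have h3 := ((h2.sub_const 1).inv₀ (by simp)).norm
    have h4 := ((Real.continuousAt_log (x := ‖((0:ℂ) - 1)⁻¹‖) (by simp)).tendsto).comp h3
    have e : Real.log ‖((0:ℂ) - 1)⁻¹‖ = 0 := by simp
    rw [e] at h4
    refine h4.congr' ?_
    filter_upwards [ev_re hl s0 w, ev_re hl s0 (w + 2 * Real.pi * I)] with s hr hr2
    have e1 := (T.e1 _ hr (add_real_mem_Str.2 (Str_mono le_rfl a12.le hw))).2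
    have e0 := (T.e0 _ hr2 (add_real_mem_Str.2 (Str_mono T.H0.lt1.le le_rfl hw'))).2
    have n0 : f (exp (w + s)) ≠ 0 := by rw [← e1]; exact Complex.exp_ne_zero _
    rw [exp_per] at e0
    simp only [Function.comp]
    rw [re_eq_log (h0 _), re_eq_log (h1 _), e0.2, e1, ← Real.log_mul (by
      simpa using sub_ne_zero.2 (Ne.symm e0.1)) (by simpa using n0), ← norm_mul]
    congr 2
    have := sub_ne_zero.2 (Ne.symm e0.1)
    rw [← mul_inv_cancel_left₀ n0 ((f (exp (w + ↑s)))⁻¹ - 1)⁻¹, mul_comm]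
    rw [inv_mul_eq_div, ← div_eq_inv_mul] 
    field_simp
  set a : ℂ := (((t0 + t1)/2 : ℝ) : ℂ) * I with haa
  have haA : a ∈ Str t0 t1 := T.H1.mem_low
  set τ : ℝ → ℝ := fun s => (h1 (a + s)).re with hτ
  have hτt : Tendsto τ l atTop := u1A a haA
  have hτ1 : ∀ᶠ s in (l : Filter ℝ), 1 ≤ τ s := hτt.eventually_ge_atTop 1
  obtain ⟨Φ1, hΦ1, -, hΦ1p, -⟩ := montel l (T.H1.locbdd hl (Str_mono le_rfl a12.le haA) haA.2.ne (τ := τ) (K := 2) (by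
    filter_upwards [hτ1] with s hs
    refine ⟨by linarith, ?_⟩
    rw [abs_of_nonneg (show 0 ≤ (h1 (a + s)).re from by simp only [hτ] at hs; linarith)]
    simp only [hτ] at hs ⊢; linarith))
  have haA' := shift_mem haA
  set a' : ℂ := a + 2 * Real.pi * I with ha'
  obtain ⟨Φ0, hΦ0, -, hΦ0p, -⟩ := montel l (T.H0.locbdd hl (Str_mono T.H0.lt1.le le_rfl haA') haA'.1.ne' (τ := τ) (K := 3) (by
    have h5 := (u01 a haA).abs
    rw [abs_zero] at h5
    filter_upwards [hτ1, h5.eventually (ge_mem_nhds one_pos)] with s hs h6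
    refine ⟨by linarith, ?_⟩
    have h7 := abs_le.1 h6
    have : |(h0 (a' + s)).re| ≤ τ s + 1 := by
      simp only [hτ] at hs ⊢
      rw [abs_le]; constructor <;> linarith [h7.1, h7.2]
    linarith))
  have hre1 : ∀ w ∈ Str t0 t2, Tendsto (fun s : ℝ => (h1 (w+s)).re / τ s) l (𝓝 (Φ1 w).re) := by
    intro w hw
    refine ((Complex.continuous_re.tendsto _).comp (hΦ1p w hw)).congr fun s => ?_
    simp only [Function.comp]
    rw [Complex.div_ofReal_re]; simp
  have hre0 : ∀ w ∈ Str t2 (t1 + 2 * Real.pi), Tendsto (fun s : ℝ => (h0 (w+s)).re / τ s) l (𝓝 (Φ0 w).re) := by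
    intro w hw
    refine ((Complex.continuous_re.tendsto _).comp (hΦ0p w hw)).congr fun s => ?_
    simp only [Function.comp]
    rw [Complex.div_ofReal_re]; simp
  have p1 : ∀ w ∈ Str t0 t1, 0 ≤ (Φ1 w).re := by
    intro w hw
    refine ge_of_tendsto (hre1 w (Str_mono le_rfl a12.le hw)) ?_
    filter_upwards [hτ1, (u1A w hw).eventually_ge_atTop 0] with s h2 h3
    exact div_nonneg h3 (by linarith)
  have n1 : ∀ w ∈ Str t1 t2, (Φ1 w).re ≤ 0 := by
    intro w hw
    refine le_of_tendsto (hre1 w (Str_mono a01.le le_rfl hw)) ?_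
    filter_upwards [hτ1, (u1B w hw)] with s h2 h3
    exact div_nonpos_of_nonpos_of_nonneg h3 (by linarith)
  have p0 : ∀ w ∈ Str t2 t3, 0 ≤ (Φ0 w).re := by
    intro w hw
    refine ge_of_tendsto (hre0 w (Str_mono le_rfl T.H0.lt2.le hw)) ?_
    filter_upwards [hτ1, (u0C w hw)] with s h2 h3
    exact div_nonneg h3 (by linarith)
  have r01 : ∀ w ∈ Str t0 t1, (Φ1 w).re = - (Φ0 (w + 2 * Real.pi * I)).re := by
    intro w hw
    have hw' := Str_mono T.H0.lt1.le le_rfl (shift_mem hw)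
    have h2 := (hre0 _ hw').add (hre1 w (Str_mono le_rfl a12.le hw))
    have h3 := (u01 w hw).mul (tendsto_inv_atTop_zero.comp hτt)
    rw [zero_mul] at h3
    have h4 := tendsto_nhds_unique h2 (h3.congr fun s => by simp only [Function.comp]; ring)
    linarith
  have ha1 : (Φ1 a).re = 1 := by
    refine tendsto_nhds_unique (hre1 a (Str_mono le_rfl a12.le haA)) ?_
    refine tendsto_const_nhds.congr' ?_
    filter_upwards [hτ1] with s hs
    simp only [hτ] at hs ⊢
    rw [div_self (by linarith)]
  have hq : (t3 : ℂ) * I ∈ Str t2 (t1 + 2 * Real.pi) := by constructor <;> simp [ht3] <;> linarith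
  have hcq : ContinuousAt (fun w => (Φ0 w).re) ((t3:ℂ) * I) :=
    Complex.continuous_re.continuousAt.comp (hΦ0.continuousOn.continuousAt ((isOpen_Str _ _).mem_nhds hq))
  have hsh : ∀ ε : ℝ, ((t3:ℂ)) * I + (1 * ε : ℝ) * I = ((t0 + ε : ℝ) : ℂ) * I + 2 * Real.pi * I := by
    intro ε; rw [ht3]; push_cast; ring
  have hevA : ∀ᶠ ε : ℝ in 𝓝[>] 0, ((t0 + ε : ℝ) : ℂ) * I ∈ Str t0 t1 := by
    have hev : ∀ᶠ ε : ℝ in 𝓝[>] 0, ε < t1 - t0 := mem_nhdsWithin_of_mem_nhds (gt_mem_nhds (by linarith))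
    filter_upwards [hev, self_mem_nhdsWithin] with ε h3 h4
    have h4 : 0 < ε := h4
    constructor <;> simp <;> linarith
  have hq0 : (Φ0 ((t3:ℂ) * I)).re = 0 := by
    refine le_antisymm ?_ ?_
    · have := line_limit (g := fun w => -(Φ0 w).re) (σ := 1) hcq.neg (by
        filter_upwards [hevA] with ε h3
        rw [hsh ε]
        have := r01 _ h3
        have := p1 _ h3
        linarith)
      linarith
    · exact line_limit (g := fun w => (Φ0 w).re) (σ := -1) hcq (by
        have hev : ∀ᶠ ε : ℝ in 𝓝[>] 0, ε < t3 - t2 := mem_nhdsWithin_of_mem_nhds (gt_mem_nhds (by linarith))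
        filter_upwards [hev, self_mem_nhdsWithin] with ε h3 h4
        have h4 : 0 < ε := h4
        exact p0 _ (by constructor <;> simp <;> linarith))
  have hb : Tendsto (fun ε : ℝ => (Φ1 ((t0 + ε : ℝ) * I)).re) (𝓝[>] 0) (𝓝 0) := by
    have c0 : Tendsto (fun ε : ℝ => (t3:ℂ) * I + (1 * ε : ℝ) * I) (𝓝[>] 0) (𝓝 (t3 * I)) := by
      have : Continuous (fun ε : ℝ => (t3:ℂ) * I + (1 * ε : ℝ) * I) := by fun_prop
      have := this.tendsto 0
      simp only [mul_zero, Complex.ofReal_zero, zero_mul, add_zero] at this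
      exact this.mono_left nhdsWithin_le_nhds
    have c1 := (hcq.tendsto.comp c0).neg
    rw [hq0, neg_zero] at c1
    refine c1.congr' ?_
    filter_upwards [hevA] with ε h3
    simp only [Function.comp]
    rw [hsh ε, r01 _ h3]
  have := reflect_aux hΦ1 a01 hcon p1 n1 hb a (Str_mono le_rfl a12.le haA)
  rw [ha1] at this
  norm_num at this

end Trip

lemma Cfg.gap {f : ℂ → ℂ} {P : Set ℂ} {t0 t1 t2 : ℝ} (C : Cfg f P t0 t1 t2) {l : Ultrafilter ℝ} (hl : (l : Filter ℝ) ≤ atTop)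
    (hI : TypeI f l t0 t1 t2) : t2 - t1 ≤ t1 - t0 := by
  obtain ⟨s0, h1, hi, h0, T⟩ := C.trip
  exact T.gap hl hI

lemma Cfg.typeI_rot {f : ℂ → ℂ} {P : Set ℂ} {t0 t1 t2 : ℝ} (C : Cfg f P t0 t1 t2) {l : Ultrafilter ℝ} (hl : (l : Filter ℝ) ≤ atTop)
    (hI : TypeI f l t0 t1 t2) : TypeI (_root_.rot f P) l t2 (t0 + 2 * Real.pi) (t1 + 2 * Real.pi) := by
  obtain ⟨s0, h1, hi, h0, T⟩ := C.trip
  obtain ⟨hA, hB, hC⟩ := hI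
  obtain ⟨a01, a12, a20⟩ := T.lts
  refine ⟨?_, ?_, ?_⟩
  · intro w hw
    have hw' := Str_mono le_rfl T.H0.lt2.le hw
    have h2 : Tendsto (fun s : ℝ => 1 - f (exp (w + s))) l (𝓝[≠] 0) := by
      refine tendsto_nhdsWithin_iff.2 ⟨?_, ?_⟩
      · have := (tendsto_const_nhds (x := (1:ℂ))).sub (hC w hw)
        rwa [sub_self] at this
      · filter_upwards [ev_re hl s0 w] with s hr
        exact sub_ne_zero.2 (Ne.symm (T.e0 _ hr (add_real_mem_Str.2 hw')).2.1)
    have h3 := tendsto_norm_cobounded_atTop.comp (tendsto_inv₀_nhdsNE_zero.comp h2)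
    refine h3.congr' ?_
    filter_upwards [ev_re hl s0 w] with s hr
    rw [rot_of (T.e0 _ hr (add_real_mem_Str.2 hw')).1]; rfl
  · intro w hw
    have hw' := Str_mono T.H0.lt1.le le_rfl hw
    have hm : w - 2 * Real.pi * I ∈ Str t0 t1 := by constructor <;> simp <;> linarith [hw.1, hw.2]
    have h1 := hA _ hm
    have h2 : Tendsto (fun s : ℝ => (1 - f (exp (w + s)))⁻¹) l (𝓝 0) := by
      refine tendsto_inv₀_cobounded.comp ?_
      rw [← tendsto_norm_atTop_iff_cobounded]
      refine tendsto_atTop_mono (fun s => ?_) (tendsto_atTop_add_const_right _ (-1) h1)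
      have e : exp (w - 2 * Real.pi * I + s) = exp (w + s) := by rw [← Trip.exp_per, sub_add_cancel]
      show ‖f (exp (w - 2 * Real.pi * I + s))‖ + -1 ≤ _
      rw [e]
      have := norm_sub_norm_le (f (exp (w + s))) 1
      rw [norm_sub_rev, norm_one] at this
      linarith
    refine h2.congr' ?_
    filter_upwards [ev_re hl s0 w] with s hr
    rw [rot_of (T.e0 _ hr (add_real_mem_Str.2 hw')).1]
  · intro w hw
    have hm : w - 2 * Real.pi * I ∈ Str t1 t2 := by constructor <;> simp <;> linarith [hw.1, hw.2]
    have h1 := hB _ hm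
    have h2 := ((tendsto_const_nhds (x := (1:ℂ))).sub h1).inv₀ (by simp)
    rw [sub_zero, inv_one] at h2
    refine h2.congr' ?_
    filter_upwards [ev_re hl s0 (w - 2 * Real.pi * I)] with s hr
    have h3 := (T.e1 _ hr (add_real_mem_Str.2 (Str_mono a01.le le_rfl hm))).1
    rw [← Trip.exp_per, sub_add_cancel] at h3 ⊢
    rw [rot_of h3]

/-- Type I forces equal gaps -/
lemma Cfg.gaps_eq {f : ℂ → ℂ} {P : Set ℂ} {t0 t1 t2 : ℝ} (C : Cfg f P t0 t1 t2) {l : Ultrafilter ℝ} (hl : (l : Filter ℝ) ≤ atTop)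
    (hI : TypeI f l t0 t1 t2) : t1 = t0 + 2 * Real.pi / 3 ∧ t2 = t0 + 4 * Real.pi / 3 := by
  have g1 := C.gap hl hI
  have g2 := C.rot.gap hl (C.typeI_rot hl hI)
  have g3 := C.rot.rot.gap hl (C.rot.typeI_rot hl (C.typeI_rot hl hI))
  constructor <;> linarith

/-! ### excluding constant limits -/

lemma circle_of_local {l : Ultrafilter ℝ} {Q : ℝ → ℂ → Prop} (hQ : ∀ M M' z, M ≤ M' → Q M z → Q M' z) {m ρ : ℝ}
    (hloc : ∀ y ∈ Icc m (m + 2 * Real.pi), ∃ r > 0, ∃ M : ℝ, ∀ᶠ s : ℝ in (l : Filter ℝ),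
      ∀ z ∈ Metric.ball ((ρ : ℂ) + y * I) r, Q M (exp (z + s))) :
    ∃ M : ℝ, ∀ᶠ s : ℝ in (l : Filter ℝ), ∀ z : ℂ, ‖z‖ = Real.exp (ρ + s) → Q M z := by
  have key : ∃ M : ℝ, ∀ᶠ s : ℝ in (l : Filter ℝ), ∀ y ∈ Icc m (m + 2 * Real.pi), Q M (exp ((ρ : ℂ) + y * I + s)) := by
    refine (isCompact_Icc (a := m) (b := m + 2 * Real.pi)).induction_on (p := fun S : Set ℝ => ∃ M : ℝ, ∀ᶠ s : ℝ in (l : Filter ℝ), ∀ y ∈ S, Q M (exp ((ρ : ℂ) + y * I + s)))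
      ⟨0, by simp⟩ ?_ ?_ ?_
    · rintro S S' hS ⟨M, hM⟩
      exact ⟨M, hM.mono fun s hs y hy => hs y (hS hy)⟩
    · rintro S S' ⟨M, hM⟩ ⟨M', hM'⟩
      refine ⟨max M M', ?_⟩
      filter_upwards [hM, hM'] with s h1 h2 y hy
      rcases hy with hy | hy
      · exact hQ _ _ _ (le_max_left _ _) (h1 y hy)
      · exact hQ _ _ _ (le_max_right _ _) (h2 y hy)
    · intro y hy
      obtain ⟨r, hr, M, hM⟩ := hloc y hy
      have hc : Continuous fun y : ℝ => (ρ : ℂ) + y * I := by fun_prop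
      refine ⟨_, mem_nhdsWithin_of_mem_nhds (hc.continuousAt.preimage_mem_nhds (Metric.ball_mem_nhds _ hr)), M, ?_⟩
      filter_upwards [hM] with s hs y' hy' using hs _ hy'
  obtain ⟨M, hM⟩ := key
  refine ⟨M, ?_⟩
  filter_upwards [hM] with s hs z hz
  have hz0 : z ≠ 0 := by
    rintro rfl
    rw [norm_zero] at hz
    exact (Real.exp_pos _).ne hz
  obtain ⟨y, hy, he⟩ : ∃ y ∈ Icc m (m + 2 * Real.pi), exp ((ρ : ℂ) + y * I + s) = z := by
    refine ⟨toIcoMod (by positivity : 0 < 2 * Real.pi) m z.arg, Ico_subset_Icc_self (toIcoMod_mem_Ico _ _ _), ?_⟩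
    have h1 := self_sub_toIcoDiv_zsmul (by positivity : 0 < 2 * Real.pi) m z.arg
    rw [← h1]
    have h2 : Complex.log z = ((ρ + s : ℝ) : ℂ) + z.arg * I := by
      apply Complex.ext
      · rw [Complex.log_re, hz, Real.log_exp]; simp
      · rw [Complex.log_im]; simp
    have h3 : (ρ : ℂ) + ((z.arg - toIcoDiv (by positivity : 0 < 2 * Real.pi) m z.arg • (2 * Real.pi) : ℝ) : ℂ) * I + s
       = Complex.log z - toIcoDiv (by positivity : 0 < 2 * Real.pi) m z.arg • (2 * Real.pi * I) := by
      rw [h2]; push_cast [zsmul_eq_mul]; ring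
    rw [h3, zsmul_eq_mul, Complex.exp_sub, Complex.exp_log hz0, Complex.exp_int_mul_two_pi_mul_I, div_one]
  rw [← he]
  exact hs y hy

def Off (t0 t1 t2 : ℝ) : Set ℂ := Str t0 t1 ∪ Str t1 t2 ∪ Str t2 (t0 + 2 * Real.pi)

def EqG (t0 t1 t2 : ℝ) : Prop := t1 = t0 + 2 * Real.pi / 3 ∧ t2 = t0 + 4 * Real.pi / 3

lemma EqG.rot {t0 t1 t2 : ℝ} (h : EqG t2 (t0 + 2 * Real.pi) (t1 + 2 * Real.pi)) : EqG t0 t1 t2 := by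
  obtain ⟨h1, h2⟩ := h
  constructor <;> linarith

lemma Cfg.kap {f : ℂ → ℂ} {P : Set ℂ} {t0 t1 t2 : ℝ} (C : Cfg f P t0 t1 t2) (hne : ¬ EqG t0 t1 t2)
    {l : Ultrafilter ℝ} (hl : (l : Filter ℝ) ≤ atTop) : ∃ κ, ∀ a ∈ Off t0 t1 t2, Trip.st f l a = κ := by
  obtain ⟨s0, h1, hi, h0, T⟩ := C.trip
  obtain ⟨x, y, u, hx, hy, hu, h⟩ := T.st_classify hl
  rcases h with ⟨rfl, rfl, rfl⟩ | ⟨rfl, rfl, rfl⟩ | ⟨rfl, rfl, -⟩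
  · exact ⟨Q4.n, by rintro a ((ha | ha) | ha); exacts [hx a ha, hy a ha, hu a ha]⟩
  · exact absurd (C.gaps_eq hl ⟨fun w hw => (stt_i).1 (hx w hw), fun w hw => (stt_z).1 (hy w hw), fun w hw => (stt_o).1 (hu w hw)⟩) hne
  · exact ⟨x, by rintro a ((ha | ha) | ha); exacts [hx a ha, hy a ha, hu a ha]⟩

def rotQ : Q4 → Q4
  | Q4.z => Q4.o
  | Q4.o => Q4.i
  | Q4.i => Q4.z
  | Q4.n => Q4.n

lemma Cfg.st_rot {f : ℂ → ℂ} {P : Set ℂ} {t0 t1 t2 : ℝ} (C : Cfg f P t0 t1 t2)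
    {l : Ultrafilter ℝ} (hl : (l : Filter ℝ) ≤ atTop) {c : ℂ} (hc : c ∈ Str t2 (t0 + 2 * Real.pi)) :
    Trip.st (_root_.rot f P) l c = rotQ (Trip.st f l c) := by
  obtain ⟨s0, h1, hi, h0, T⟩ := C.trip
  have hc' := Str_mono le_rfl T.H0.lt2.le hc
  have hev : ∀ᶠ s : ℝ in (l : Filter ℝ), f (exp (c + s)) ≠ 1 ∧ (1 - f (exp (c + s)))⁻¹ = _root_.rot f P (exp (c + s)) := by
    filter_upwards [ev_re hl s0 c] with s hr
    have := T.e0 _ hr (add_real_mem_Str.2 hc')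
    exact ⟨this.2.1, (rot_of this.1).symm⟩
  have hev2 := hev.mono fun s hs => hs.2
  have lim : ∀ v : ℂ, v ≠ 1 → Tendsto (fun s : ℝ => f (exp (c + s))) l (𝓝 v) →
      Tendsto (fun s : ℝ => _root_.rot f P (exp (c + s))) l (𝓝 (1 - v)⁻¹) := fun v hv h =>
    (((tendsto_const_nhds (x := (1:ℂ))).sub h).inv₀ (sub_ne_zero.2 (Ne.symm hv))).congr' hev2
  cases hst : Trip.st f l c with
  | z =>
    have := lim 0 (by norm_num) (stt_z.1 hst)
    rw [sub_zero, inv_one] at this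
    exact stt_o.2 this
  | o =>
    have h2 : Tendsto (fun s : ℝ => 1 - f (exp (c + s))) l (𝓝[≠] 0) := by
      refine tendsto_nhdsWithin_iff.2 ⟨?_, ?_⟩
      · have := (tendsto_const_nhds (x := (1:ℂ))).sub (stt_o.1 hst)
        rwa [sub_self] at this
      · filter_upwards [hev] with s hr
        exact sub_ne_zero.2 (Ne.symm hr.1)
    have h3 := tendsto_norm_cobounded_atTop.comp (tendsto_inv₀_nhdsNE_zero.comp h2)
    refine stt_i.2 (h3.congr' ?_)
    filter_upwards [hev2] with s hr
    rw [← hr]; rfl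
  | i =>
    have h2 : Tendsto (fun s : ℝ => (1 - f (exp (c + s)))⁻¹) l (𝓝 0) := by
      refine tendsto_inv₀_cobounded.comp ?_
      rw [← tendsto_norm_atTop_iff_cobounded]
      refine tendsto_atTop_mono (fun s => ?_) (tendsto_atTop_add_const_right _ (-1) (stt_i.1 hst))
      have := norm_sub_norm_le (f (exp (c + s))) 1
      rw [norm_sub_rev, norm_one] at this
      linarith
    exact stt_z.2 (h2.congr' hev2)
  | n =>
    obtain ⟨v, hv0, hv1, hv⟩ := stt_n.1 hst
    refine stt_n.2 ⟨_, inv_ne_zero (sub_ne_zero.2 (Ne.symm hv1)), ?_, lim v hv1 hv⟩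
    intro h
    rw [inv_eq_one] at h
    exact hv0 (by linear_combination -h)

lemma Cfg.kap_rot {f : ℂ → ℂ} {P : Set ℂ} {t0 t1 t2 : ℝ} (C : Cfg f P t0 t1 t2) (hne : ¬ EqG t0 t1 t2)
    {l : Ultrafilter ℝ} (hl : (l : Filter ℝ) ≤ atTop) {κ : Q4} (h : ∀ a ∈ Off t0 t1 t2, Trip.st f l a = κ) :
    ∀ a ∈ Off t2 (t0 + 2 * Real.pi) (t1 + 2 * Real.pi), Trip.st (_root_.rot f P) l a = rotQ κ := by
  obtain ⟨κ', h'⟩ := C.rot.kap (fun h => hne h.rot) hl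
  have hc : ((((t2 + (t0 + 2 * Real.pi))/2 : ℝ) : ℂ) * I) ∈ Str t2 (t0 + 2 * Real.pi) := by
    have := C.h20
    constructor <;> simp <;> linarith
  have h1 := C.st_rot hl hc
  rw [h _ (Or.inr hc), h' _ (Or.inl (Or.inl hc))] at h1
  rw [← h1]; exact h'

lemma Cfg.finite_poles {f : ℂ → ℂ} {P : Set ℂ} (hm : MeromOn f P univ) {R : ℝ} (h : ∀ z, R < ‖z‖ → z ∉ P) : P.Finite := by
  by_contra hinf
  have hsub : P ⊆ Metric.closedBall 0 R := by
    intro z hz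
    rw [mem_closedBall_zero_iff]
    by_contra hc
    exact h z (not_le.1 hc) hz
  obtain ⟨z, -, hz⟩ := (show P.Infinite from hinf).exists_accPt_of_subset_isCompact (isCompact_closedBall 0 R) hsub
  rw [accPt_iff_frequently_nhdsNE] at hz
  exact hz (by simpa using hm.ev_notin z)

/-- constant limit 0 along all ultrafilters is impossible -/
lemma Cfg.not_all_z {f : ℂ → ℂ} {P : Set ℂ} {t0 t1 t2 : ℝ} (C : Cfg f P t0 t1 t2)
    (h : ∀ l : Ultrafilter ℝ, (l : Filter ℝ) ≤ atTop → ∀ a ∈ Off t0 t1 t2, Trip.st f l a = Q4.z) : False := by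
  obtain ⟨s0, h1, hi, h0, T⟩ := C.trip
  obtain ⟨a01, a12, a20⟩ := T.lts
  have main : ∀ᶠ s : ℝ in atTop, ∀ z : ℂ, ‖z‖ = Real.exp s → z ∉ P ∧ ‖f z‖ ≤ 1 := by
    change _ ∈ (atTop : Filter ℝ)
    rw [mem_iff_ultrafilter]
    intro l hl
    have hst := h l hl
    have hz : ∀ a ∈ Off t0 t1 t2, Tendsto (fun s : ℝ => f (exp (a + s))) l (𝓝 0) := fun a ha => stt_z.1 (hst a ha)
    have hlim1 : ∀ w ∈ Str t0 t2, w.im ≠ t1 → Tendsto (fun s : ℝ => ((fun w => - h1 w) (w + s)).re) l atTop := by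
      intro w hw hwt
      have ho : w ∈ Off t0 t1 t2 := by
        rcases lt_or_gt_of_ne hwt with h' | h'
        exacts [Or.inl (Or.inl ⟨hw.1, h'⟩), Or.inl (Or.inr ⟨h', hw.2⟩)]
      have h3 := (hz w ho).norm
      rw [norm_zero] at h3
      have h4 : Tendsto (fun s : ℝ => ‖f (exp (w + s))‖) l (𝓝[>] 0) := by
        refine tendsto_nhdsWithin_iff.2 ⟨h3, ?_⟩
        filter_upwards [ev_re hl s0 w] with s hr
        rw [← (T.e1 _ hr (add_real_mem_Str.2 hw)).2]
        simp
      have h5 := tendsto_neg_atBot_atTop.comp (Real.tendsto_log_nhdsGT_zero.comp h4)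
      refine h5.congr' ?_
      filter_upwards [ev_re hl s0 w] with s hr
      simp only [Function.comp]
      rw [← (T.e1 _ hr (add_real_mem_Str.2 hw)).2, ← re_eq_log]; simp
    have hlimi : ∀ w ∈ Str t1 (t0 + 2 * Real.pi), w.im ≠ t2 → Tendsto (fun s : ℝ => (hi (w + s)).re) l atTop := by
      intro w hw hwt
      have ho : w ∈ Off t0 t1 t2 := by
        rcases lt_or_gt_of_ne hwt with h' | h'
        exacts [Or.inl (Or.inr ⟨hw.1, h'⟩), Or.inr ⟨h', hw.2⟩]
      have hev : ∀ᶠ s : ℝ in (l : Filter ℝ), f (exp (w + s)) ≠ 0 ∧ exp (hi (w + s)) = 1 - (f (exp (w + s)))⁻¹ := by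
        filter_upwards [ev_re hl s0 w] with s hr
        exact (T.ei' hr (add_real_mem_Str.2 hw) (by simpa using hwt)).2
      have h2 : Tendsto (fun s : ℝ => f (exp (w + s))) l (𝓝[≠] 0) :=
        tendsto_nhdsWithin_iff.2 ⟨hz w ho, hev.mono fun s hs => hs.1⟩
      have h3 := tendsto_norm_cobounded_atTop.comp (tendsto_inv₀_nhdsNE_zero.comp h2)
      have h4 := Real.tendsto_log_atTop.comp (tendsto_atTop_add_const_right _ (-1) h3)
      refine tendsto_atTop_mono' _ ?_ h4
      have h6 := h3.eventually_gt_atTop 1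
      filter_upwards [hev, h6] with s hs hs6
      rw [re_eq_log, hs.2]
      simp only [Function.comp] at hs6 ⊢
      apply Real.log_le_log (by linarith)
      have := norm_sub_norm_le ((f (exp (w + s)))⁻¹) 1
      rw [norm_sub_rev, norm_one] at this
      linarith
    have hprop0 := T.H0.propagate_one hl (α := t2) (β := t0 + 2 * Real.pi) le_rfl T.H0.lt2.le (Or.inr le_rfl) a20 (by
      intro w hw
      have h3 := ((tendsto_const_nhds (x := (1:ℂ))).sub (hz w (Or.inr hw))).inv₀ (by simp)
      rw [sub_zero, inv_one] at h3
      refine h3.congr' ?_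
      filter_upwards [ev_re hl s0 w] with s hr
      rw [(T.e0 _ hr (add_real_mem_Str.2 (Str_mono le_rfl T.H0.lt2.le hw))).2.2])
    have hre : ∀ w : ℂ, ∀ᶠ s : ℝ in (l : Filter ℝ), ∀ z ∈ Metric.ball w 1, s0 < (z + s).re := by
      intro w
      filter_upwards [ev_re hl (s0 + 1) w] with s hr z hz
      rw [mem_ball_iff_norm] at hz
      have h7 := (Complex.abs_re_le_norm _).trans_lt hz
      have h8 := (abs_lt.1 h7).1
      simp at h8 hr ⊢
      linarith
    have hloc : ∀ w ∈ Str t0 (t1 + 2 * Real.pi), ∃ r > 0, ∀ᶠ s : ℝ in (l : Filter ℝ), ∀ z ∈ Metric.ball w r,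
        exp (z + s) ∉ P ∧ ‖f (exp (z + s))‖ ≤ 1 := by
      intro w hw
      by_cases c1 : w.im < t2
      · obtain ⟨r, hr, hrs, hM⟩ := T.H1.neg.blowup hl hlim1 w ⟨hw.1, c1⟩
        refine ⟨min r 1, by positivity, ?_⟩
        filter_upwards [hM 0, hre w] with s h3 h4 z hz
        have e := T.e1 _ (h4 z (Metric.ball_subset_ball (min_le_right _ _) hz))
          (add_real_mem_Str.2 (hrs (Metric.ball_subset_ball (min_le_left _ _) hz)))
        have h5 := h3 z (Metric.ball_subset_ball (min_le_left _ _) hz)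
        refine ⟨e.1, ?_⟩
        rw [← e.2, Complex.norm_exp, Real.exp_le_one_iff]
        simpa using h5
      by_cases c2 : w.im < t0 + 2 * Real.pi
      · obtain ⟨r, hr, hrs, hM⟩ := T.Hi.blowup hl hlimi w ⟨by linarith, c2⟩
        refine ⟨min r 1, by positivity, ?_⟩
        filter_upwards [hM 2, hre w] with s h3 h4 z hz
        have h5 := h3 z (Metric.ball_subset_ball (min_le_left _ _) hz)
        have h6 : 2 < ‖exp (hi (z + s))‖ := by
          rw [Complex.norm_exp]
          linarith [Real.add_one_le_exp (hi (z + s)).re]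
        rcases T.ei _ (h4 z (Metric.ball_subset_ball (min_le_right _ _) hz))
          (add_real_mem_Str.2 (hrs (Metric.ball_subset_ball (min_le_left _ _) hz))) with e | e
        · rw [e.2, norm_one] at h6; norm_num at h6
        · refine ⟨e.1, ?_⟩
          rw [e.2.2] at h6
          have h7 := norm_sub_le (1:ℂ) (f (exp (z + s)))⁻¹
          rw [norm_one, norm_inv] at h7
          have h8 : 0 < ‖f (exp (z + s))‖ := norm_pos_iff.2 e.2.1
          have h9 : 1 < ‖f (exp (z + s))‖⁻¹ := by linarith
          exact ((one_lt_inv₀ h8).1 h9).le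
      · have hw0 : w ∈ Str t2 (t1 + 2 * Real.pi) := ⟨by linarith, hw.2⟩
        obtain ⟨r, hr, hrs, hM⟩ := hprop0.exists_ball (isOpen_Str _ _) continuousOn_const hw0 (show (0:ℝ) < 1/2 by norm_num)
        refine ⟨min r 1, by positivity, ?_⟩
        filter_upwards [hM, hre w] with s h3 h4 z hz
        have e := T.e0 _ (h4 z (Metric.ball_subset_ball (min_le_right _ _) hz))
          (add_real_mem_Str.2 (hrs (Metric.ball_subset_ball (min_le_left _ _) hz)))
        have h5 := h3 z (Metric.ball_subset_ball (min_le_left _ _) hz)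
        refine ⟨e.1, ?_⟩
        rw [e.2.2] at h5
        set v := f (exp (z + s))
        have h6 : 1 - v ≠ 0 := sub_ne_zero.2 (Ne.symm e.2.1)
        have h7 : (1 - v)⁻¹ - 1 = v * (1 - v)⁻¹ := by field_simp; ring
        have h10 := norm_sub_norm_le (1:ℂ) (1 - (1 - v)⁻¹)
        rw [norm_one, sub_sub_cancel, norm_sub_rev] at h10
        rw [h7, norm_mul] at h5
        rw [h7, norm_mul] at h10
        nlinarith [norm_nonneg v, norm_nonneg (1 - v)⁻¹]
    obtain ⟨M, hM⟩ := circle_of_local (l := l) (Q := fun _ z => z ∉ P ∧ ‖f z‖ ≤ 1) (m := (t0 + t1)/2) (ρ := 0)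
      (fun _ _ _ _ h => h) (by
        intro y hy
        obtain ⟨r, hr, h9⟩ := hloc (((0:ℝ):ℂ) + y * I) (by
          constructor <;> simp <;> linarith [hy.1, hy.2])
        exact ⟨r, hr, 0, h9⟩)
    simp only [zero_add] at hM
    exact hM
  obtain ⟨S, hS⟩ := eventually_atTop.1 main
  have hS' : ∀ z : ℂ, Real.exp S < ‖z‖ → z ∉ P ∧ ‖f z‖ ≤ 1 := by
    intro z hz
    have hz0 : 0 < ‖z‖ := (Real.exp_pos _).trans hz
    refine hS (Real.log ‖z‖) ?_ z (Real.exp_log hz0).symm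
    rw [Real.le_log_iff_exp_le hz0]; exact hz.le
  refine C.nrat (C.mer.rat_of_bdd (Cfg.finite_poles C.mer (R := Real.exp S) fun z hz => (hS' z hz).1) (M := 1) ?_)
  refine Eventually.frequently ?_
  filter_upwards [eventually_gt_atTop (Real.exp S)] with R hR z hz _
  exact (hS' z (by rw [hz]; exact hR)).2

/-- the key dichotomy: some ultrafilter is of type `n` -/
lemma Cfg.exists_n {f : ℂ → ℂ} {P : Set ℂ} {t0 t1 t2 : ℝ} (C : Cfg f P t0 t1 t2) (hne : ¬ EqG t0 t1 t2) :
    ∃ l : Ultrafilter ℝ, (l : Filter ℝ) ≤ atTop ∧ ∀ a ∈ Off t0 t1 t2, Trip.st f l a = Q4.n := by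
  by_contra hcon
  push Not at hcon
  obtain ⟨s0, h1, hi, h0, T⟩ := C.trip
  have a01 := C.h01
  have a12 := C.h12
  set a : ℂ := (((t0 + t1)/2 : ℝ) : ℂ) * I with ha
  have haA : a ∈ Str t0 t1 := by constructor <;> simp [ha] <;> linarith
  have haO : a ∈ Off t0 t1 t2 := Or.inl (Or.inl haA)
  have hn : ∀ l : Ultrafilter ℝ, (l : Filter ℝ) ≤ atTop → Trip.st f l a ≠ Q4.n := by
    intro l hl hn
    obtain ⟨κ, hκ⟩ := C.kap hne hl
    obtain ⟨b, hb, hb'⟩ := hcon l hl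
    rw [hκ b hb, ← hκ a haO] at hb'
    exact hb' hn
  set g : ℝ → ℂ := fun s => f (exp (a + s)) with hg
  have U1 : IsOpen {v : ℂ | ‖v‖ < 1/3} := isOpen_lt continuous_norm continuous_const
  have U2 : IsOpen {v : ℂ | ‖v - 1‖ < 1/3} := isOpen_lt (by fun_prop) continuous_const
  have U3 : IsOpen {v : ℂ | 2 < ‖v‖} := isOpen_lt continuous_const continuous_norm
  have hcov : ∀ᶠ s in atTop, g s ∈ {v : ℂ | ‖v‖ < 1/3} ∪ {v : ℂ | ‖v - 1‖ < 1/3} ∪ {v : ℂ | 2 < ‖v‖} := by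
    change _ ∈ (atTop : Filter ℝ)
    rw [mem_iff_ultrafilter]
    intro l hl
    cases hst : Trip.st f l a with
    | z =>
      have := (stt_z.1 hst).eventually (U1.mem_nhds (by simp))
      exact this.mono fun s hs => Or.inl (Or.inl hs)
    | o =>
      have := (stt_o.1 hst).eventually (U2.mem_nhds (by simp))
      exact this.mono fun s hs => Or.inl (Or.inr hs)
    | i =>
      exact ((stt_i.1 hst).eventually_gt_atTop 2).mono fun s hs => Or.inr hs
    | n => exact absurd hst (hn l hl)
  obtain ⟨S, hS⟩ := eventually_atTop.1 hcov
  set S' := max S (s0 + 1)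
  have hcont : ContinuousOn g (Ici S') := by
    intro s hs
    have hs1 : s0 + 1 ≤ s := (le_max_right _ _).trans hs
    have h3 := (T.e1 (a + s) (by simp [ha]; linarith) (add_real_mem_Str.2 (Str_mono le_rfl a12.le haA))).1
    have h4 := (C.mer.ana h3).continuousAt
    refine ContinuousAt.continuousWithinAt ?_
    exact ContinuousAt.comp (f := fun s : ℝ => exp (a + s)) (g := f) h4 (by fun_prop)
  have hpre : IsPreconnected (g '' Ici S') := isPreconnected_Ici.image _ hcont
  have hsub : g '' Ici S' ⊆ {v : ℂ | ‖v‖ < 1/3} ∪ {v : ℂ | ‖v - 1‖ < 1/3} ∪ {v : ℂ | 2 < ‖v‖} := by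
    rintro _ ⟨s, hs, rfl⟩
    exact hS s ((le_max_left _ _).trans hs)
  have d12 : Disjoint {v : ℂ | ‖v‖ < 1/3} {v : ℂ | ‖v - 1‖ < 1/3} := by
    rw [Set.disjoint_left]
    intro v h1 h2
    simp only [mem_ofPred_eq] at h1 h2
    have := norm_sub_norm_le (1:ℂ) (1 - v)
    rw [sub_sub_cancel, norm_one, norm_sub_rev] at this
    linarith
  have d13 : Disjoint {v : ℂ | ‖v‖ < 1/3} {v : ℂ | 2 < ‖v‖} := by
    rw [Set.disjoint_left]
    intro v h1 h2
    simp only [mem_ofPred_eq] at h1 h2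
    linarith
  have d23 : Disjoint {v : ℂ | ‖v - 1‖ < 1/3} {v : ℂ | 2 < ‖v‖} := by
    rw [Set.disjoint_left]
    intro v h1 h2
    simp only [mem_ofPred_eq] at h1 h2
    have := norm_sub_norm_le v 1
    rw [norm_one] at this
    linarith
  have hone : ∃ κ : Q4, ∀ l : Ultrafilter ℝ, (l : Filter ℝ) ≤ atTop → Trip.st f l a = κ ∧ κ ≠ Q4.n := by
    have hmem : ∀ {V : Set ℂ}, g '' Ici S' ⊆ V → ∀ l : Ultrafilter ℝ, (l : Filter ℝ) ≤ atTop → ∀ᶠ s in (l : Filter ℝ), g s ∈ V :=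
      fun hV l hl => hl ((eventually_ge_atTop S').mono fun s hs => hV ⟨s, hs, rfl⟩)
    have hzz : ∀ l : Ultrafilter ℝ, (l : Filter ℝ) ≤ atTop → Trip.st f l a = Q4.z → ∀ᶠ s in (l : Filter ℝ), g s ∈ {v : ℂ | ‖v‖ < 1/3} :=
      fun l _ h => (stt_z.1 h).eventually (U1.mem_nhds (by simp))
    have hoo : ∀ l : Ultrafilter ℝ, (l : Filter ℝ) ≤ atTop → Trip.st f l a = Q4.o → ∀ᶠ s in (l : Filter ℝ), g s ∈ {v : ℂ | ‖v - 1‖ < 1/3} :=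
      fun l _ h => (stt_o.1 h).eventually (U2.mem_nhds (by simp))
    have hii : ∀ l : Ultrafilter ℝ, (l : Filter ℝ) ≤ atTop → Trip.st f l a = Q4.i → ∀ᶠ s in (l : Filter ℝ), g s ∈ {v : ℂ | 2 < ‖v‖} :=
      fun l _ h => (stt_i.1 h).eventually_gt_atTop 2
    have clash : ∀ {V W : Set ℂ}, Disjoint V W → ∀ l : Ultrafilter ℝ, (∀ᶠ s in (l : Filter ℝ), g s ∈ V) → (∀ᶠ s in (l : Filter ℝ), g s ∈ W) → False := by
      intro V W hd l hv hw
      obtain ⟨s, h1, h2⟩ := (hv.and hw).exists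
      exact Set.disjoint_left.1 hd h1 h2
    rcases hS S' (le_max_left _ _) with (hc | hc) | hc
    · have := hpre.subset_left_of_subset_union U1 (U2.union U3) (Set.disjoint_union_right.2 ⟨d12, d13⟩) (by rwa [← union_assoc])
        ⟨g S', mem_image_of_mem g self_mem_Ici, hc⟩
      refine ⟨Q4.z, fun l hl => ⟨?_, by simp⟩⟩
      cases hst : Trip.st f l a with
      | z => rfl
      | o => exact (clash d12 l (hmem this l hl) (hoo l hl hst)).elim
      | i => exact (clash d13 l (hmem this l hl) (hii l hl hst)).elim
      | n => exact absurd hst (hn l hl)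
    · have := hpre.subset_left_of_subset_union U2 (U1.union U3) (Set.disjoint_union_right.2 ⟨d12.symm, d23⟩)
        (by rw [← union_assoc, union_comm {v : ℂ | ‖v - 1‖ < 1/3}]; exact hsub)
        ⟨g S', mem_image_of_mem g self_mem_Ici, hc⟩
      refine ⟨Q4.o, fun l hl => ⟨?_, by simp⟩⟩
      cases hst : Trip.st f l a with
      | z => exact (clash d12 l (hzz l hl hst) (hmem this l hl)).elim
      | o => rfl
      | i => exact (clash d23 l (hmem this l hl) (hii l hl hst)).elim
      | n => exact absurd hst (hn l hl)
    · have := hpre.subset_left_of_subset_union U3 (U1.union U2) (Set.disjoint_union_right.2 ⟨d13.symm, d23.symm⟩)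
        (by rw [union_comm]; exact hsub)
        ⟨g S', mem_image_of_mem g self_mem_Ici, hc⟩
      refine ⟨Q4.i, fun l hl => ⟨?_, by simp⟩⟩
      cases hst : Trip.st f l a with
      | z => exact (clash d13 l (hzz l hl hst) (hmem this l hl)).elim
      | o => exact (clash d23 l (hoo l hl hst) (hmem this l hl)).elim
      | i => rfl
      | n => exact absurd hst (hn l hl)
  obtain ⟨κ, hκ⟩ := hone
  have hall : ∀ l : Ultrafilter ℝ, (l : Filter ℝ) ≤ atTop → ∀ b ∈ Off t0 t1 t2, Trip.st f l b = κ := by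
    intro l hl b hb
    obtain ⟨κ', h'⟩ := C.kap hne hl
    rw [h' b hb, ← h' a haO]; exact (hκ l hl).1
  have hneq' : ¬ EqG t2 (t0 + 2 * Real.pi) (t1 + 2 * Real.pi) := fun h => hne h.rot
  have hall1 := fun l hl => C.kap_rot hne hl (hall l hl)
  have hall2 := fun l hl => C.rot.kap_rot hneq' hl (hall1 l hl)
  cases κ with
  | z => exact C.not_all_z hall
  | o => exact C.rot.rot.not_all_z hall2
  | i => exact C.rot.not_all_z hall1
  | n =>
    exact (hκ (Ultrafilter.of atTop) (Ultrafilter.of_le _)).2 rfl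

/-! ### good circles -/

lemma countable_ones {G : ℂ → ℂ} {U : Set ℂ} (hU : IsOpen U) (hp : IsPreconnected U) (hG : DifferentiableOn ℂ G U)
    {a : ℂ} (ha : a ∈ U) (h1 : G a ≠ 1) : {w | w ∈ U ∧ G w = 1}.Countable := by
  have han : AnalyticOnNhd ℂ (fun w => G w - 1) U := (hG.sub (differentiableOn_const 1)).analyticOnNhd hU
  have hd : DiscreteTopology {w | w ∈ U ∧ G w = 1} := by
    rw [discreteTopology_subtype_iff]
    rintro x ⟨hx, hx1⟩
    rw [← disjoint_iff, disjoint_principal_right]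
    rcases (han x hx).eventually_eq_zero_or_eventually_ne_zero with h | h
    · have := han.eqOn_zero_of_preconnected_of_eventuallyEq_zero hp hx h ha
      simp [sub_eq_zero] at this
      exact absurd this h1
    · filter_upwards [h] with w hw hw2
      exact hw (by rw [hw2.2, sub_self])
  have : Countable {w | w ∈ U ∧ G w = 1} := countable_of_Lindelof_of_discrete
  exact this

lemma Strip.good {h : ℂ → ℂ} {tm t tp s0 : ℝ} {l : Ultrafilter ℝ} (H : Strip h tm t tp s0) (hl : (l : Filter ℝ) ≤ atTop)
    {a v : ℂ} (ha : a ∈ Str tm tp) (hat : a.im ≠ t) (hv0 : v ≠ 0) (hv1 : v ≠ 1)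
    (hv : Tendsto (fun s : ℝ => exp (h (a + s))) l (𝓝 v)) :
    ∃ B : Set ℝ, B.Countable ∧ ∀ w ∈ Str tm tp, w.re ∉ B → ∃ φ : ℂ, φ ≠ 0 ∧ φ ≠ 1 ∧ ∀ ε > 0, ∃ r > 0, Metric.ball w r ⊆ Str tm tp ∧
      ∀ᶠ s : ℝ in (l : Filter ℝ), ∀ z ∈ Metric.ball w r, ‖exp (h (z + s)) - φ‖ < ε := by
  obtain ⟨K, hK⟩ := Strip.bd_iff.2 ⟨v, hv0, hv⟩
  obtain ⟨G, hG, hG0, hun, hpt, -⟩ := H.neutral hl ha hat hK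
  have hGa : G a = v := tendsto_nhds_unique (hpt a ha) hv
  refine ⟨Complex.re '' {w | w ∈ Str tm tp ∧ G w = 1},
    (countable_ones (isOpen_Str _ _) (preconn_Str _ _) hG ha (by rwa [hGa])).image _, ?_⟩
  intro w hw hwB
  refine ⟨G w, hG0 w hw, fun h => hwB ⟨w, ⟨hw, h⟩, rfl⟩, ?_⟩
  intro ε hε
  exact hun.exists_ball (isOpen_Str _ _) hG.continuousOn hw hε

def GC (f : ℂ → ℂ) (P : Set ℂ) (M R : ℝ) : Prop :=
  ∀ z : ℂ, ‖z‖ = R → z ∉ P ∧ ‖f z‖ ≤ M ∧ 1 ≤ M * ‖f z‖ ∧ 1 ≤ M * ‖f z - 1‖ ∧ ‖z‖ * ‖deriv f z‖ ≤ M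

lemma Cfg.good {f : ℂ → ℂ} {P : Set ℂ} {t0 t1 t2 : ℝ} (C : Cfg f P t0 t1 t2)
    {l : Ultrafilter ℝ} (hl : (l : Filter ℝ) ≤ atTop) (hn : ∀ a ∈ Off t0 t1 t2, Trip.st f l a = Q4.n) :
    ∃ M, ∃ᶠ R in atTop, GC f P M R := by
  obtain ⟨s0, h1, hi, h0, T⟩ := C.trip
  obtain ⟨a01, a12, a20⟩ := T.lts
  -- test points
  have A := T.H1.mem_low
  have B := T.Hi.mem_low
  have D := T.H0.mem_low
  set a : ℂ := (((t0 + t1)/2 : ℝ) : ℂ) * I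
  set b : ℂ := (((t1 + t2)/2 : ℝ) : ℂ) * I
  set d : ℂ := (((t2 + (t0 + 2 * Real.pi))/2 : ℝ) : ℂ) * I
  obtain ⟨va, va0, va1, hva⟩ := stt_n.1 (hn a (Or.inl (Or.inl A)))
  obtain ⟨vb, vb0, vb1, hvb⟩ := stt_n.1 (hn b (Or.inl (Or.inr B)))
  obtain ⟨vd, vd0, vd1, hvd⟩ := stt_n.1 (hn d (Or.inr D))
  have A' := Str_mono le_rfl a12.le A
  have B' := Str_mono le_rfl a20.le B
  have D' := Str_mono le_rfl T.H0.lt2.le D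
  obtain ⟨B1, cB1, g1⟩ := T.H1.good hl A' A.2.ne va0 va1 (hva.congr' (by
    filter_upwards [ev_re hl s0 a] with s hr
    exact (T.e1 _ hr (add_real_mem_Str.2 A')).2.symm))
  obtain ⟨Bi, cBi, gi⟩ := T.Hi.good hl B' B.2.ne (v := 1 - vb⁻¹)
    (by rw [sub_ne_zero]; intro h; exact vb1 (by rw [← inv_inv vb, ← h, inv_one]))
    (by intro h; exact vb0 (inv_eq_zero.1 (by linear_combination -h)))
    ((tendsto_const_nhds.sub (hvb.inv₀ vb0)).congr' (by
    filter_upwards [ev_re hl s0 b] with s hr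
    exact (T.ei' hr (add_real_mem_Str.2 B') (by simpa using B.2.ne)).2.2.symm))
  obtain ⟨B0, cB0, g0⟩ := T.H0.good hl D' D.2.ne (v := (1 - vd)⁻¹)
    (inv_ne_zero (sub_ne_zero.2 (Ne.symm vd1)))
    (by intro h; rw [inv_eq_one] at h; exact vd0 (by linear_combination -h))
    (((tendsto_const_nhds.sub hvd).inv₀ (sub_ne_zero.2 (Ne.symm vd1))).congr' (by
    filter_upwards [ev_re hl s0 d] with s hr
    exact (T.e0 _ hr (add_real_mem_Str.2 D')).2.2.symm))
  obtain ⟨ρ, hρ⟩ := ((cB1.union (cBi.union cB0)).dense_compl ℝ).nonempty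
  simp only [mem_compl_iff, mem_union, not_or] at hρ
  have hre : ∀ w : ℂ, ∀ᶠ s : ℝ in (l : Filter ℝ), ∀ z ∈ Metric.ball w 1, s0 < (z + s).re := by
    intro w
    filter_upwards [ev_re hl (s0 + 1) w] with s hr z hz
    rw [mem_ball_iff_norm] at hz
    have h7 := (Complex.abs_re_le_norm _).trans_lt hz
    have h8 := (abs_lt.1 h7).1
    simp at h8 hr ⊢
    linarith
  have uni : ∀ w ∈ Str t0 (t1 + 2 * Real.pi), w.re = ρ → ∃ v : ℂ, v ≠ 0 ∧ v ≠ 1 ∧ ∀ ε > 0, ∃ r > 0,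
      ∀ᶠ s : ℝ in (l : Filter ℝ), ∀ z ∈ Metric.ball w r, exp (z + s) ∉ P ∧ ‖f (exp (z + s)) - v‖ < ε := by
    intro w hw hwρ
    by_cases c1 : w.im < t2
    · obtain ⟨φ, hφ0, hφ1, hφ⟩ := g1 w ⟨hw.1, c1⟩ (by rw [hwρ]; exact hρ.1)
      refine ⟨φ, hφ0, hφ1, fun ε hε => ?_⟩
      obtain ⟨r, hr, hrs, hev⟩ := hφ ε hε
      refine ⟨min r 1, by positivity, ?_⟩
      filter_upwards [hev, hre w] with s h3 h4 z hz
      have e := T.e1 _ (h4 z (Metric.ball_subset_ball (min_le_right _ _) hz))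
        (add_real_mem_Str.2 (hrs (Metric.ball_subset_ball (min_le_left _ _) hz)))
      refine ⟨e.1, ?_⟩
      rw [← e.2]; exact h3 z (Metric.ball_subset_ball (min_le_left _ _) hz)
    by_cases c2 : w.im < t0 + 2 * Real.pi
    · obtain ⟨φ, hφ0, hφ1, hφ⟩ := gi w ⟨by linarith, c2⟩ (by rw [hwρ]; exact hρ.2.1)
      have hφ1' : 1 - φ ≠ 0 := sub_ne_zero.2 (Ne.symm hφ1)
      refine ⟨(1 - φ)⁻¹, inv_ne_zero hφ1', by intro h; rw [inv_eq_one] at h; exact hφ0 (by linear_combination -h), fun ε hε => ?_⟩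
      have hc : ContinuousAt (fun x : ℂ => (1 - x)⁻¹) φ := ContinuousAt.inv₀ (by fun_prop) hφ1'
      obtain ⟨δ, hδ, hδε⟩ := Metric.continuousAt_iff.1 hc ε hε
      have hd : 0 < ‖φ - 1‖ := norm_pos_iff.2 (sub_ne_zero.2 hφ1)
      obtain ⟨r, hr, hrs, hev⟩ := hφ (min δ ‖φ - 1‖) (by positivity)
      refine ⟨min r 1, by positivity, ?_⟩
      filter_upwards [hev, hre w] with s h3 h4 z hz
      have h5 := h3 z (Metric.ball_subset_ball (min_le_left _ _) hz)
      rcases T.ei _ (h4 z (Metric.ball_subset_ball (min_le_right _ _) hz))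
        (add_real_mem_Str.2 (hrs (Metric.ball_subset_ball (min_le_left _ _) hz))) with e | e
      · rw [e.2, norm_sub_rev] at h5
        exact absurd (h5.trans_le (min_le_right _ _)) (lt_irrefl _)
      · refine ⟨e.1, ?_⟩
        have h6 := hδε (x := exp (hi (z + s))) (by rw [dist_eq_norm]; exact h5.trans_le (min_le_left _ _))
        rw [dist_eq_norm, e.2.2] at h6
        simpa using h6
    · obtain ⟨φ, hφ0, hφ1, hφ⟩ := g0 w ⟨by linarith, hw.2⟩ (by rw [hwρ]; exact hρ.2.2)
      refine ⟨1 - φ⁻¹, ?_, ?_, fun ε hε => ?_⟩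
      · rw [sub_ne_zero]; intro h; exact hφ1 (by rw [← inv_inv φ, ← h, inv_one])
      · intro h; exact hφ0 (inv_eq_zero.1 (by linear_combination -h))
      have hc : ContinuousAt (fun x : ℂ => 1 - x⁻¹) φ := continuousAt_const.sub (continuousAt_inv₀ hφ0)
      obtain ⟨δ, hδ, hδε⟩ := Metric.continuousAt_iff.1 hc ε hε
      obtain ⟨r, hr, hrs, hev⟩ := hφ δ hδ
      refine ⟨min r 1, by positivity, ?_⟩
      filter_upwards [hev, hre w] with s h3 h4 z hz
      have h5 := h3 z (Metric.ball_subset_ball (min_le_left _ _) hz)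
      have e := T.e0 _ (h4 z (Metric.ball_subset_ball (min_le_right _ _) hz))
        (add_real_mem_Str.2 (hrs (Metric.ball_subset_ball (min_le_left _ _) hz)))
      refine ⟨e.1, ?_⟩
      have h6 := hδε (x := exp (h0 (z + s))) (by rw [dist_eq_norm]; exact h5)
      rw [dist_eq_norm, e.2.2] at h6
      simpa using h6
  obtain ⟨M, hM⟩ := circle_of_local (l := l)
    (Q := fun M z => z ∉ P ∧ ‖f z‖ ≤ M ∧ 1 ≤ M * ‖f z‖ ∧ 1 ≤ M * ‖f z - 1‖ ∧ ‖z‖ * ‖deriv f z‖ ≤ M)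
    (m := (t0 + t1)/2) (ρ := ρ) (by
      rintro M M' z hMM ⟨q1, q2, q3, q4, q5⟩
      exact ⟨q1, q2.trans hMM, q3.trans (by gcongr), q4.trans (by gcongr), q5.trans hMM⟩) (by
      intro y hy
      obtain ⟨v, hv0, hv1, hv⟩ := uni ((ρ:ℂ) + y * I) (by
          constructor <;> simp <;> linarith [hy.1, hy.2]) (by simp)
      have p0 : 0 < ‖v‖ := norm_pos_iff.2 hv0
      have p1 : 0 < ‖v - 1‖ := norm_pos_iff.2 (sub_ne_zero.2 hv1)
      obtain ⟨r, hr, hev⟩ := hv (min (‖v‖/2) (‖v - 1‖/2)) (by positivity)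
      set M0 := max (max (2 * ‖v‖) (2 * ‖v‖ / (r/2))) (max (2/‖v‖) (2/‖v - 1‖)) with hM0
      refine ⟨r/2, by positivity, M0, ?_⟩
      filter_upwards [hev] with s hs z hz
      have hzr : z ∈ Metric.ball ((ρ:ℂ) + y * I) r := Metric.ball_subset_ball (by linarith) hz
      have bd : ∀ z ∈ Metric.ball ((ρ:ℂ) + y * I) r, ‖f (exp (z + s))‖ ≤ 2 * ‖v‖ := by
        intro z hz
        have h5 := (hs z hz).2.trans_le (min_le_left _ _)
        have := norm_sub_norm_le (f (exp (z + s))) v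
        linarith
      have k1 : 2 * ‖v‖ ≤ M0 := (le_max_left _ _).trans (le_max_left _ _)
      have k2 : 2 * ‖v‖ / (r/2) ≤ M0 := (le_max_right _ _).trans (le_max_left _ _)
      have k3 : 2 / ‖v‖ ≤ M0 := (le_max_left _ _).trans (le_max_right _ _)
      have k4 : 2 / ‖v - 1‖ ≤ M0 := (le_max_right _ _).trans (le_max_right _ _)
      obtain ⟨hzP, hzv⟩ := hs z hzr
      refine ⟨hzP, (bd z hzr).trans k1, ?_, ?_, ?_⟩
      · have h5 := hzv.trans_le (min_le_left _ _)
        have h6 := norm_sub_norm_le v (f (exp (z + s)))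
        rw [norm_sub_rev] at h6
        calc (1:ℝ) = 2 / ‖v‖ * (‖v‖/2) := by field_simp
          _ ≤ M0 * ‖f (exp (z + s))‖ := by gcongr; linarith
      · have h5 := hzv.trans_le (min_le_right _ _)
        have h6 := norm_sub_norm_le (v - 1) (f (exp (z + s)) - 1)
        rw [sub_sub_sub_cancel_right, norm_sub_rev v (f _)] at h6
        calc (1:ℝ) = 2 / ‖v - 1‖ * (‖v - 1‖/2) := by field_simp
          _ ≤ M0 * ‖f (exp (z + s)) - 1‖ := by gcongr; linarith
      · have hd : ∀ x ∈ Metric.ball ((ρ:ℂ) + y * I) r, HasDerivAt (fun x : ℂ => f (exp (x + s)))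
            (deriv f (exp (x + s)) * exp (x + s)) x := by
          intro x hx
          have h3 := (C.mer.ana (hs x hx).1).differentiableAt.hasDerivAt
          have h4 : HasDerivAt (fun x : ℂ => exp (x + s)) (exp (x + s)) x := by
            simpa using ((hasDerivAt_id x).add_const (s:ℂ)).cexp
          exact h3.comp x h4
        have hsub : Metric.closedBall z (r/2) ⊆ Metric.ball ((ρ:ℂ) + y * I) r := by
          intro x hx
          rw [Metric.mem_closedBall] at hx
          rw [Metric.mem_ball] at hz ⊢
          linarith [dist_triangle x z ((ρ:ℂ) + y * I)]
        have := Complex.norm_deriv_le_of_forall_mem_sphere_norm_le (f := fun x : ℂ => f (exp (x + s))) (c := z) (R := r/2) (C := 2 * ‖v‖)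
          (by positivity) (DifferentiableOn.diffContOnCl (by
            rw [closure_ball _ (by positivity)]
            exact fun x hx => (hd x (hsub hx)).differentiableAt.differentiableWithinAt))
          (fun x hx => bd x (hsub (Metric.sphere_subset_closedBall hx)))
        rw [(hd z hzr).deriv, norm_mul, mul_comm] at this
        exact this.trans k2)
  refine ⟨M, ?_⟩
  have hfr : ∃ᶠ s in atTop, GC f P M (Real.exp (ρ + s)) := by
    have : ∃ᶠ s in (l : Filter ℝ), GC f P M (Real.exp (ρ + s)) := Eventually.frequently hM
    exact this.filter_mono hl
  exact (Real.tendsto_exp_atTop.comp (tendsto_atTop_add_const_left _ ρ tendsto_id)).frequently hfr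

lemma Cfg.inf_poles {f : ℂ → ℂ} {P : Set ℂ} {t0 t1 t2 : ℝ} (C : Cfg f P t0 t1 t2) {M : ℝ}
    (h : ∃ᶠ R in atTop, GC f P M R) : P.Infinite := by
  intro hP
  exact C.nrat (C.mer.rat_of_bdd hP (h.mono fun R hR z hz _ => (hR z hz).2.1))

structure Good (f : ℂ → ℂ) (P : Set ℂ) : Prop where
  gc : ∃ M, ∃ᶠ R in atTop, GC f P M R
  pinf : P.Infinite
  oinf : {z | z ∉ P ∧ f z = 1}.Infinite
  zinf : {z | z ∉ P ∧ f z = 0}.Infinite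

lemma Cfg.toGood {f : ℂ → ℂ} {P : Set ℂ} {t0 t1 t2 : ℝ} (C : Cfg f P t0 t1 t2) (hne : ¬ EqG t0 t1 t2)
    {l : Ultrafilter ℝ} (hl : (l : Filter ℝ) ≤ atTop) (hn : ∀ a ∈ Off t0 t1 t2, Trip.st f l a = Q4.n) :
    Good f P := by
  have hneq' : ¬ EqG t2 (t0 + 2 * Real.pi) (t1 + 2 * Real.pi) := fun h => hne h.rot
  have n1 := C.kap_rot hne hl hn
  have n2 := C.rot.kap_rot hneq' hl n1
  obtain ⟨M, g⟩ := C.good hl hn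
  obtain ⟨M1, g1⟩ := C.rot.good hl n1
  obtain ⟨M2, g2⟩ := C.rot.rot.good hl n2
  refine ⟨⟨M, g⟩, C.inf_poles g, C.rot.inf_poles g1, ?_⟩
  refine (C.rot.rot.inf_poles g2).mono ?_
  rintro z ⟨hz1, hz2⟩
  by_cases hP : z ∈ P
  · rw [rot_pole hP] at hz2; norm_num at hz2
  · rw [rot_of hP, inv_eq_one] at hz2
    exact ⟨hP, by linear_combination -hz2⟩

/-- main reduction: the three cyclic versions are good -/
lemma Cfg.good_all {f : ℂ → ℂ} {P : Set ℂ} {t0 t1 t2 : ℝ} (C : Cfg f P t0 t1 t2) (hne : ¬ EqG t0 t1 t2) :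
    Good f P ∧ Good (_root_.rot f P) (rotP f P) ∧ Good (_root_.rot (_root_.rot f P) (rotP f P)) (rotP (_root_.rot f P) (rotP f P)) := by
  have hneq' : ¬ EqG t2 (t0 + 2 * Real.pi) (t1 + 2 * Real.pi) := fun h => hne h.rot
  obtain ⟨l, hl, hn⟩ := C.exists_n hne
  have n1 := C.kap_rot hne hl hn
  have n2 := C.rot.kap_rot hneq' hl n1
  exact ⟨C.toGood hne hl hn, C.rot.toGood hneq' hl n1, C.rot.rot.toGood (fun h => hneq' h.rot) hl n2⟩

/-! ### reflection lemma -/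

def CB (f : ℂ → ℂ) (P : Set ℂ) (C R : ℝ) : Prop :=
  ∀ z : ℂ, ‖z‖ = R → z ∉ P ∧ f z ≠ 0 ∧ ‖z‖ * ‖deriv f z‖ ≤ C * ‖f z‖

structure RLH (f : ℂ → ℂ) (P : Set ℂ) (R0 C : ℝ) : Prop where
  mer : MeromOn f P univ
  pos : 0 < R0
  hC : 0 ≤ C
  hp : ∀ z ∈ P, R0 ≤ ‖z‖ → z.im = 0 ∧ z.re < 0
  hz : ∀ z, z ∉ P → R0 ≤ ‖z‖ → f z = 0 → z.im < 0
  c0 : CB f P C R0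
  ck : ∃ᶠ R in atTop, CB f P C R

lemma ana_conj {g : ℂ → ℂ} {z : ℂ} (h : AnalyticAt ℂ g (conj z)) : AnalyticAt ℂ (fun z => conj (g (conj z))) z := by
  have h1 := h.eventually_analyticAt
  have hc : Tendsto (fun z : ℂ => conj z) (𝓝 z) (𝓝 (conj z)) := (Complex.continuous_conj).tendsto z
  rw [Complex.analyticAt_iff_eventually_differentiableAt]
  filter_upwards [hc.eventually h1] with w hw
  have := hw.differentiableAt.conj_conj
  rw [Complex.conj_conj] at this
  exact this

lemma CB.circ {f : ℂ → ℂ} {P : Set ℂ} {C R : ℝ} (hm : MeromOn f P univ) (hC : 0 ≤ C) (h : CB f P C R) (hR : 0 < R) {z : ℂ}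
    (hz : ‖z‖ = R) (hy : 0 < z.im) : ‖f (conj z)‖ ≤ ‖f z‖ * Real.exp (Real.pi * C * z.im / R) := by
  set γ : ℝ → ℂ := fun θ => (R : ℂ) * exp (θ * I) with hγ
  have hγn : ∀ θ, ‖γ θ‖ = R := by
    intro θ
    simp [hγ, Complex.norm_exp_ofReal_mul_I, abs_of_pos hR]
  have hγd : ∀ θ, HasDerivAt γ (γ θ * I) θ := by
    intro θ
    have h1 : HasDerivAt (fun θ : ℝ => (θ : ℂ) * I) I θ := by
      simpa using (Complex.ofRealCLM.hasDerivAt (x := θ)).mul_const I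
    have h2 := (h1.cexp).const_mul (R : ℂ)
    simpa [hγ, mul_assoc] using h2
  set ψ : ℝ → ℝ := fun θ => Real.log (‖f (γ θ)‖ ^ 2) with hψ
  have hψd : ∀ θ, ∃ d : ℝ, HasDerivAt ψ d θ ∧ |d| ≤ 2 * C := by
    intro θ
    obtain ⟨q1, q2, q3⟩ := h (γ θ) (hγn θ)
    have h1 : HasDerivAt (fun θ : ℝ => f (γ θ)) (deriv f (γ θ) * (γ θ * I)) θ :=
      HasDerivAt.comp θ (hm.ana q1).differentiableAt.hasDerivAt (hγd θ)
    have h2 := h1.norm_sq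
    have hpos : 0 < ‖f (γ θ)‖ := norm_pos_iff.2 q2
    have h3 := h2.log (by simpa using q2)
    refine ⟨_, h3, ?_⟩
    have h4 := abs_real_inner_le_norm (f (γ θ)) (deriv f (γ θ) * (γ θ * I))
    rw [abs_div, abs_of_pos (by positivity : 0 < ‖f (γ θ)‖ ^ 2), div_le_iff₀ (by positivity), abs_mul, abs_two]
    rw [norm_mul, norm_mul, Complex.norm_I, mul_one] at h4
    nlinarith
  have lip : ∀ a b : ℝ, ψ a - ψ b ≤ 2 * C * |a - b| := by
    intro a b
    have := convex_univ.norm_image_sub_le_of_norm_deriv_le (f := ψ) (C := 2 * C) (x := b) (y := a)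
      (fun x _ => (hψd x).choose_spec.1.differentiableAt)
      (fun x _ => by rw [(hψd x).choose_spec.1.deriv]; exact (hψd x).choose_spec.2) (mem_univ _) (mem_univ _)
    exact (le_abs_self _).trans this
  set φ := z.arg with hφ
  have hzφ : γ φ = z := by
    simp only [hγ, ← hz]; exact Complex.norm_mul_exp_arg_mul_I z
  have hφ0 : 0 < φ := by
    rcases (Complex.arg_nonneg_iff.2 hy.le).lt_or_eq with h1 | h1
    · exact h1
    · have : z.im = 0 := (Complex.arg_eq_zero_iff.1 h1.symm).2
      linarith
  have hφp : φ ≤ Real.pi := Complex.arg_le_pi z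
  have him : z.im = R * Real.sin φ := by
    rw [← hz, hφ]; exact (Complex.norm_mul_sin_arg z).symm
  have hc1 : γ (-φ) = conj z := by
    rw [← hzφ]; simp only [hγ]
    rw [map_mul, ← Complex.exp_conj]; simp
  have hc2 : γ (2 * Real.pi - φ) = conj z := by
    rw [← hc1]; simp only [hγ]
    congr 1
    have : ((2 * Real.pi - φ : ℝ) : ℂ) * I = ((-φ : ℝ) : ℂ) * I + 2 * Real.pi * I := by push_cast; ring
    rw [this, Complex.exp_add, Complex.exp_two_pi_mul_I, mul_one]
  have hcc : ‖conj z‖ = R := by rw [Complex.norm_conj, hz]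
  have p1 : 0 < ‖f z‖ := norm_pos_iff.2 (h z hz).2.1
  have p2 : 0 < ‖f (conj z)‖ := norm_pos_iff.2 (h _ hcc).2.1
  have key : Real.log (‖f (conj z)‖ ^ 2) - Real.log (‖f z‖ ^ 2) ≤ 2 * C * (Real.pi * Real.sin φ) := by
    rcases le_total φ (Real.pi / 2) with hh | hh
    · have h1 := lip (-φ) φ
      simp only [hψ, hc1, hzφ] at h1
      have h2 := Real.mul_le_sin hφ0.le hh
      rw [show -φ - φ = -(2 * φ) by ring, abs_neg, abs_of_pos (by positivity)] at h1
      have h3 : 2 * φ ≤ Real.pi * Real.sin φ := by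
        have := mul_le_mul_of_nonneg_left h2 Real.pi_pos.le
        calc 2 * φ = Real.pi * (2 / Real.pi * φ) := by field_simp
          _ ≤ _ := this
      exact h1.trans (by gcongr)
    · have h1 := lip (2 * Real.pi - φ) φ
      simp only [hψ, hc2, hzφ] at h1
      have h2 := Real.mul_le_sin (x := Real.pi - φ) (by linarith) (by linarith)
      rw [Real.sin_pi_sub] at h2
      rw [abs_of_nonneg (by linarith)] at h1
      have h3 : 2 * (Real.pi - φ) ≤ Real.pi * Real.sin φ := by
        have := mul_le_mul_of_nonneg_left h2 Real.pi_pos.le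
        calc 2 * (Real.pi - φ) = Real.pi * (2 / Real.pi * (Real.pi - φ)) := by field_simp
          _ ≤ _ := this
      exact h1.trans (by gcongr; linarith)
  rw [Real.log_pow, Real.log_pow] at key
  push_cast at key
  have e1 : Real.pi * C * z.im / R = C * (Real.pi * Real.sin φ) := by rw [him]; field_simp
  rw [e1, ← Real.log_le_log_iff p2 (by positivity), Real.log_mul p1.ne' (Real.exp_pos _).ne', Real.log_exp]
  linarith

lemma mob_bound {z w : ℂ} (hz : 0 ≤ z.im) (hw : 0 < w.im) {R : ℝ} (hR : 0 < R) (hzw : R * w.im ≤ 2 * ‖z - w‖ ^ 2) (h0 : z ≠ w) :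
    ‖z - conj w‖ ≤ ‖z - w‖ * Real.exp (4 * z.im / R) := by
  have e : ‖z - conj w‖ ^ 2 = ‖z - w‖ ^ 2 + 4 * z.im * w.im := by
    rw [← Complex.normSq_eq_norm_sq, ← Complex.normSq_eq_norm_sq, Complex.normSq_apply, Complex.normSq_apply]
    simp; ring
  have hp : 0 < ‖z - w‖ := norm_pos_iff.2 (sub_ne_zero.2 h0)
  refine (pow_le_pow_iff_left₀ (norm_nonneg _) (by positivity) two_ne_zero).1 ?_
  rw [e, mul_pow, ← Real.exp_nat_mul]
  have h1 := Real.add_one_le_exp (((2:ℕ):ℝ) * (4 * z.im / R))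
  have h2 : 4 * z.im * w.im ≤ ‖z - w‖ ^ 2 * (((2:ℕ):ℝ) * (4 * z.im / R)) := by
    push_cast
    rw [show ‖z - w‖ ^ 2 * (2 * (4 * z.im / R)) = (8 * z.im * ‖z - w‖ ^ 2) / R by ring, le_div_iff₀ hR]
    nlinarith
  calc _ ≤ ‖z - w‖ ^ 2 * (((2:ℕ):ℝ) * (4 * z.im / R) + 1) := by linarith
    _ ≤ _ := by gcongr

def reflF (f : ℂ → ℂ) (w : ℂ) (a b : ℝ) : ℂ → ℂ := fun z =>
  conj (f (conj z)) * (z - conj w) / (f z * (z - w)) * (exp (-(I * a / z)) * exp (I * b * z))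

lemma refl_exp_norm (a b : ℝ) (z : ℂ) :
    ‖exp (-(I * a / z)) * exp (I * b * z)‖ = Real.exp (-(a * z.im / ‖z‖ ^ 2) - b * z.im) := by
  rw [norm_mul, Complex.norm_exp, Complex.norm_exp, ← Real.exp_add]
  congr 1
  rw [← Complex.normSq_eq_norm_sq]
  simp [Complex.div_re, Complex.normSq_apply]
  ring

section
variable {f : ℂ → ℂ} {P : Set ℂ} {R0 C : ℝ}

lemma RLH.ana_pos (H : RLH f P R0 C) {z : ℂ} (hz : R0 ≤ ‖z‖) (hy : z.im ≠ 0) : AnalyticAt ℂ f z :=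
  H.mer.ana (fun h => hy (H.hp z h hz).1)

lemma RLH.ana_star (H : RLH f P R0 C) {z : ℂ} (hz : R0 ≤ ‖z‖) (hy : z.im ≠ 0) :
    AnalyticAt ℂ (fun z => conj (f (conj z))) z :=
  ana_conj (H.ana_pos (z := conj z) (by rwa [Complex.norm_conj]) (by simpa using hy))

lemma RLH.ne_pos (H : RLH f P R0 C) {z : ℂ} (hz : R0 ≤ ‖z‖) (hy : 0 < z.im) : f z ≠ 0 := fun h =>
  absurd (H.hz z (fun h => hy.ne' (H.hp z h hz).1) hz h) (by linarith)

lemma refl_exp_ana (a b : ℝ) {z : ℂ} (hz : z ≠ 0) :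
    AnalyticAt ℂ (fun z => exp (-(I * a / z)) * exp (I * b * z)) z := by
  have h1 : AnalyticAt ℂ (fun z => exp (-(I * a / z))) z := by
    refine AnalyticAt.cexp ?_
    exact (analyticAt_const.div analyticAt_id hz).neg
  have h2 : AnalyticAt ℂ (fun z => exp (I * b * z)) z :=
    AnalyticAt.cexp (analyticAt_const.mul analyticAt_id)
  exact h1.mul h2

lemma RLH.refl_ana (H : RLH f P R0 C) {w : ℂ} (a b : ℝ) {z : ℂ} (hz : R0 ≤ ‖z‖) (hy : 0 < z.im) (hzw : z ≠ w) :
    AnalyticAt ℂ (reflF f w a b) z := by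
  have hz0 : z ≠ 0 := by rintro rfl; simp at hy
  refine AnalyticAt.mul ?_ (refl_exp_ana a b hz0)
  refine AnalyticAt.div ?_ ?_ ?_
  · exact (H.ana_star hz hy.ne').mul (analyticAt_id.sub analyticAt_const)
  · exact (H.ana_pos hz hy.ne').mul (analyticAt_id.sub analyticAt_const)
  · exact mul_ne_zero (H.ne_pos hz hy) (sub_ne_zero.2 hzw)

lemma RLH.refl_w (H : RLH f P R0 C) {w : ℂ} (a b : ℝ) (hz : R0 ≤ ‖w‖) (hy : 0 < w.im) (hw : f (conj w) = 0) :
    AnalyticAt ℂ (RExt (reflF f w a b)) w := by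
  have hz0 : w ≠ 0 := by rintro rfl; simp at hy
  have hst := H.ana_star hz hy.ne'
  have hds : AnalyticAt ℂ (dslope (fun z => conj (f (conj z))) w) w := by
    obtain ⟨s, hs, hd⟩ := hst.exists_mem_nhds_analyticOnNhd
    have : DifferentiableOn ℂ (dslope (fun z => conj (f (conj z))) w) s :=
      (Complex.differentiableOn_dslope hs).2 hd.differentiableOn
    exact this.analyticAt hs
  have hg : AnalyticAt ℂ (fun z => dslope (fun z => conj (f (conj z))) w z * (z - conj w) / f z *
      (exp (-(I * a / z)) * exp (I * b * z))) w := by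
    refine AnalyticAt.mul ?_ (refl_exp_ana a b hz0)
    exact AnalyticAt.div (hds.mul (analyticAt_id.sub analyticAt_const)) (H.ana_pos hz hy.ne') (H.ne_pos hz hy)
  refine RExt_analyticAt hg ?_
  filter_upwards [self_mem_nhdsWithin] with z hzw
  have hzw' : z - w ≠ 0 := sub_ne_zero.2 hzw
  simp only [reflF]
  rw [dslope_of_ne _ hzw, slope_def_field]
  simp only [hw, map_zero, sub_zero]
  congr 1
  by_cases hf : f z = 0
  · simp [hf]
  · field_simp

lemma RLH.refl_real (H : RLH f P R0 C) {w : ℂ} (a b : ℝ) {z : ℂ} (hz : R0 ≤ ‖z‖) (hy : z.im = 0) (hw : 0 < w.im) :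
    AnalyticAt ℂ (RExt (reflF f w a b)) z ∧ ‖RExt (reflF f w a b) z‖ = 1 := by
  have hz0 : z ≠ 0 := by rintro rfl; simp at hz; linarith [H.pos]
  have hcz : conj z = z := Complex.conj_eq_iff_im.2 hy
  have hzw : z ≠ w := by rintro rfl; linarith
  have hev : ∀ᶠ x in 𝓝[≠] z, f x ≠ 0 := by
    by_cases hP : z ∈ P
    · filter_upwards [(H.mer.2.2.1 z hP).eventually_gt_atTop 0] with x hx
      exact norm_pos_iff.1 hx
    · have h1 : f z ≠ 0 := fun h => absurd (H.hz z hP hz h) (by linarith)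
      exact ((H.mer.ana hP).continuousAt.eventually_ne h1).filter_mono nhdsWithin_le_nhds
  have hme := H.mer.merom z
  have hord : meromorphicOrderAt f z ≠ ⊤ := (meromorphicOrderAt_ne_top_iff_eventually_ne_zero hme).2 hev
  obtain ⟨g, hg, hg0, he⟩ := (meromorphicOrderAt_ne_top_iff hme).1 hord
  set n := (meromorphicOrderAt f z).untop₀ with hn
  have htc : Tendsto (fun x : ℂ => conj x) (𝓝[≠] z) (𝓝[≠] z) := by
    refine tendsto_nhdsWithin_iff.2 ⟨?_, ?_⟩
    · have := (Complex.continuous_conj).tendsto z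
      rw [hcz] at this
      exact this.mono_left nhdsWithin_le_nhds
    · filter_upwards [self_mem_nhdsWithin] with x hx
      intro h
      apply hx
      have : conj (conj x) = conj z := by rw [show conj x = z from h]
      rw [Complex.conj_conj, hcz] at this
      exact this
  have hgs : AnalyticAt ℂ (fun z => conj (g (conj z))) z := ana_conj (by rwa [hcz])
  have hG : AnalyticAt ℂ (fun x => conj (g (conj x)) * (x - conj w) / (g x * (x - w)) *
      (exp (-(I * a / x)) * exp (I * b * x))) z := by
    refine AnalyticAt.mul ?_ (refl_exp_ana a b hz0)
    refine AnalyticAt.div ?_ ?_ ?_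
    · exact hgs.mul (analyticAt_id.sub analyticAt_const)
    · exact hg.mul (analyticAt_id.sub analyticAt_const)
    · exact mul_ne_zero hg0 (sub_ne_zero.2 hzw)
  have hEq : reflF f w a b =ᶠ[𝓝[≠] z] (fun x => conj (g (conj x)) * (x - conj w) / (g x * (x - w)) *
      (exp (-(I * a / x)) * exp (I * b * x))) := by
    filter_upwards [he, htc.eventually he, self_mem_nhdsWithin] with x h1 h2 h3
    have h4 : (x - z) ^ n ≠ 0 := zpow_ne_zero _ (sub_ne_zero.2 h3)
    simp only [reflF]
    rw [h1, h2]
    simp only [smul_eq_mul, map_mul, map_zpow₀, map_sub, Complex.conj_conj, hcz]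
    congr 1
    rw [mul_assoc, mul_assoc, mul_div_mul_left _ _ h4]
  refine ⟨RExt_analyticAt hG hEq, ?_⟩
  rw [RExt_eq hG.continuousAt hEq, norm_mul, refl_exp_norm, hy]
  simp only [hcz, mul_zero, zero_div, neg_zero, sub_zero, Real.exp_zero, mul_one]
  have e1 : ‖z - conj w‖ = ‖z - w‖ := by
    rw [← Complex.norm_conj (z - w), map_sub, hcz]
  rw [norm_div, norm_mul, norm_mul, Complex.norm_conj, e1]
  exact div_self (mul_ne_zero (norm_ne_zero_iff.2 hg0) (norm_ne_zero_iff.2 (sub_ne_zero.2 hzw)))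

lemma RLH.circ_bound (H : RLH f P R0 C) {w z : ℂ} (hw : 0 < w.im) {a b r : ℝ} (hr : 0 < r) (hR : R0 ≤ r)
    (hcb : CB f P C r) (hz : ‖z‖ = r)
    (hy : 0 < z.im) (hzw : z ≠ w) (hd : r * w.im ≤ 2 * ‖z - w‖ ^ 2)
    (hab : (Real.pi * C + 4) / r ≤ a / r ^ 2 + b) :
    ‖reflF f w a b z‖ ≤ 1 := by
  have h1 := hcb.circ H.mer H.hC hr hz hy
  have h2 := mob_bound hy.le hw hr hd hzw
  have p1 : 0 < ‖f z‖ := norm_pos_iff.2 (H.ne_pos (by rw [hz]; exact hR) hy)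
  have p2 : 0 < ‖z - w‖ := norm_pos_iff.2 (sub_ne_zero.2 hzw)
  simp only [reflF]
  rw [norm_mul, refl_exp_norm, norm_div, norm_mul, norm_mul, Complex.norm_conj, hz]
  rw [div_mul_eq_mul_div, div_le_one (by positivity)]
  calc ‖f (conj z)‖ * ‖z - conj w‖ * Real.exp (-(a * z.im / r ^ 2) - b * z.im)
      ≤ (‖f z‖ * Real.exp (Real.pi * C * z.im / r)) * (‖z - w‖ * Real.exp (4 * z.im / r)) *
          Real.exp (-(a * z.im / r ^ 2) - b * z.im) := by gcongr
    _ = ‖f z‖ * ‖z - w‖ * Real.exp (Real.pi * C * z.im / r + 4 * z.im / r + (-(a * z.im / r ^ 2) - b * z.im)) := by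
        rw [Real.exp_add, Real.exp_add]; ring
    _ ≤ ‖f z‖ * ‖z - w‖ * 1 := by
        gcongr
        rw [Real.exp_le_one_iff]
        have := mul_le_mul_of_nonneg_right hab hy.le
        have e : (Real.pi * C + 4) / r * z.im = Real.pi * C * z.im / r + 4 * z.im / r := by ring
        have e2 : (a / r ^ 2 + b) * z.im = a * z.im / r ^ 2 + b * z.im := by ring
        linarith
    _ = _ := mul_one _

lemma RLH.fin (H : RLH f P R0 C) {w : ℂ} (hw : 0 < w.im) (hwR : 2 * R0 ≤ ‖w‖) (hw0 : f (conj w) = 0)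
    {R : ℝ} (hR : 2 * ‖w‖ ≤ R) (hcb : CB f P C R) {z : ℂ} (h1 : R0 < ‖z‖) (h2 : ‖z‖ < R) (hy : 0 < z.im) :
    ‖f (conj z)‖ * ‖z - conj w‖ ≤ ‖f z‖ * ‖z - w‖ *
      Real.exp ((Real.pi * C + 4) * R0 * z.im / ‖z‖ ^ 2 + (Real.pi * C + 4) / R * z.im) := by
  have hR0 := H.pos
  have hRp : 0 < R := by linarith
  set K := Real.pi * C + 4 with hK
  have hKp : 0 < K := by have := H.hC; have := Real.pi_pos; positivity
  by_cases hzw : z = w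
  · subst hzw; rw [hw0]; simp
  set D : Set ℂ := {z | R0 < ‖z‖ ∧ ‖z‖ < R ∧ 0 < z.im} with hD
  set Φ := RExt (reflF f w (K * R0) (K / R)) with hΦ
  have hDo : IsOpen D := by
    refine (isOpen_lt continuous_const continuous_norm).inter ?_
    exact (isOpen_lt continuous_norm continuous_const).inter (isOpen_lt continuous_const Complex.continuous_im)
  have hDc : closure D ⊆ {z | R0 ≤ ‖z‖ ∧ ‖z‖ ≤ R ∧ 0 ≤ z.im} := by
    refine closure_minimal (fun x hx => ⟨hx.1.le, hx.2.1.le, hx.2.2.le⟩) ?_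
    refine (isClosed_le continuous_const continuous_norm).inter ?_
    exact (isClosed_le continuous_norm continuous_const).inter (isClosed_le continuous_const Complex.continuous_im)
  have hana : ∀ x ∈ closure D, AnalyticAt ℂ Φ x := by
    intro x hx
    obtain ⟨q1, q2, q3⟩ := hDc hx
    rcases q3.eq_or_lt with q3 | q3
    · exact (H.refl_real _ _ q1 q3.symm hw).1
    · by_cases hxw : x = w
      · subst hxw; exact H.refl_w _ _ q1 q3 hw0
      · have := H.refl_ana (K * R0) (K / R) q1 q3 hxw
        exact RExt_analyticAt this (Eventually.of_forall fun _ => rfl)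
  have hval : ∀ x : ℂ, R0 ≤ ‖x‖ → 0 < x.im → x ≠ w → Φ x = reflF f w (K * R0) (K / R) x := by
    intro x q1 q3 hxw
    have := H.refl_ana (K * R0) (K / R) q1 q3 hxw
    exact RExt_eq this.continuousAt (Eventually.of_forall fun _ => rfl)
  have hwim : w.im ≤ ‖w‖ := (le_abs_self _).trans (Complex.abs_im_le_norm w)
  have hbd : ∀ x ∈ frontier D, ‖Φ x‖ ≤ 1 := by
    intro x hx
    obtain ⟨q1, q2, q3⟩ := hDc hx.1
    have hnD : x ∉ D := by have := hx.2; rwa [hDo.interior_eq] at this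
    rcases q3.eq_or_lt with q3 | q3
    · exact (H.refl_real _ _ q1 q3.symm hw).2.le
    rcases q1.eq_or_lt with q1 | q1
    · have n1 : ‖w‖ / 2 ≤ ‖x - w‖ := by
        have := norm_sub_norm_le w x
        rw [norm_sub_rev] at this
        linarith
      have hxw : x ≠ w := by rintro rfl; linarith
      rw [hval x q1.le q3 hxw]
      refine H.circ_bound hw hR0 le_rfl H.c0 q1.symm q3 hxw ?_ ?_
      · nlinarith [norm_nonneg w]
      · have : K * R0 / R0 ^ 2 = K / R0 := by field_simp
        rw [this]
        have : 0 < K / R := by positivity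
        linarith
    rcases q2.eq_or_lt with q2 | q2
    · have n1 : R / 2 ≤ ‖x - w‖ := by
        have := norm_sub_norm_le x w
        linarith
      have hxw : x ≠ w := by rintro rfl; linarith
      rw [hval x q1.le q3 hxw]
      refine H.circ_bound hw hRp (by linarith) hcb q2 q3 hxw ?_ ?_
      · nlinarith [norm_nonneg w]
      · have : 0 ≤ K * R0 / R ^ 2 := by positivity
        linarith
    · exact absurd ⟨q1, q2, q3⟩ hnD
  have hB : Bornology.IsBounded D := by
    refine (Metric.isBounded_closedBall (x := (0:ℂ)) (r := R)).subset fun x hx => ?_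
    simpa using hx.2.1.le
  have hdc : DiffContOnCl ℂ Φ D :=
    ⟨fun x hx => (hana x (subset_closure hx)).differentiableAt.differentiableWithinAt,
      fun x hx => (hana x hx).continuousAt.continuousWithinAt⟩
  have hfin := Complex.norm_le_of_forall_mem_frontier_norm_le hB hdc hbd (subset_closure (⟨h1, h2, hy⟩ : z ∈ D))
  rw [hval z h1.le hy hzw] at hfin
  have p1 : 0 < ‖f z‖ := norm_pos_iff.2 (H.ne_pos h1.le hy)
  have p2 : 0 < ‖z - w‖ := norm_pos_iff.2 (sub_ne_zero.2 hzw)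
  simp only [reflF] at hfin
  rw [norm_mul, refl_exp_norm, norm_div, norm_mul, norm_mul, Complex.norm_conj, div_mul_eq_mul_div,
    div_le_one (by positivity)] at hfin
  have e : -(K * R0 * z.im / ‖z‖ ^ 2) - K / R * z.im = -(K * R0 * z.im / ‖z‖ ^ 2 + K / R * z.im) := by ring
  rw [e, Real.exp_neg, ← div_eq_mul_inv, div_le_iff₀ (Real.exp_pos _)] at hfin
  exact hfin

lemma RLH.lim (H : RLH f P R0 C) {w : ℂ} (hw : 0 < w.im) (hwR : 2 * R0 ≤ ‖w‖) (hw0 : f (conj w) = 0)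
    {z : ℂ} (h1 : R0 < ‖z‖) (hy : 0 < z.im) :
    ‖f (conj z)‖ * ‖z - conj w‖ ≤ ‖f z‖ * ‖z - w‖ *
      Real.exp ((Real.pi * C + 4) * R0 * z.im / ‖z‖ ^ 2) := by
  have ht : Tendsto (fun R : ℝ => ‖f z‖ * ‖z - w‖ *
      Real.exp ((Real.pi * C + 4) * R0 * z.im / ‖z‖ ^ 2 + (Real.pi * C + 4) / R * z.im)) atTop
      (𝓝 (‖f z‖ * ‖z - w‖ * Real.exp ((Real.pi * C + 4) * R0 * z.im / ‖z‖ ^ 2 + 0 * z.im))) := by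
    refine Tendsto.const_mul _ ?_
    refine (Real.continuous_exp.tendsto _).comp ?_
    refine Tendsto.const_add _ (Tendsto.mul_const _ ?_)
    exact tendsto_const_nhds.div_atTop tendsto_id
  rw [zero_mul, add_zero] at ht
  have hfr := (H.ck.and_eventually (eventually_ge_atTop (2 * ‖w‖))).and_eventually (eventually_gt_atTop ‖z‖)
  refine ge_of_tendsto_of_frequently ht (hfr.mono ?_)
  rintro R ⟨⟨q1, q2⟩, q3⟩
  exact H.fin hw hwR hw0 q2 q1 h1 q3 hy

end

lemma hasDeriv_log_norm {F : ℂ → ℂ} {x c : ℂ} (hF : DifferentiableAt ℂ F x) (h0 : F x ≠ 0) :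
    HasDerivAt (fun y : ℝ => Real.log (‖F (x + c * y)‖ ^ 2)) (2 * (c * (deriv F x / F x)).re) 0 := by
  have h1 : HasDerivAt (fun y : ℝ => x + c * (y : ℂ)) c 0 := by
    simpa using ((Complex.ofRealCLM.hasDerivAt (x := (0:ℝ))).const_mul c).const_add x
  have e0 : x + c * ((0:ℝ) : ℂ) = x := by simp
  have h2 : HasDerivAt (fun y : ℝ => F (x + c * y)) (deriv F x * c) 0 :=
    HasDerivAt.comp (0:ℝ) (h₂ := F) (by rw [e0]; exact hF.hasDerivAt) h1
  have h3 := h2.norm_sq.log (by rw [e0]; simpa using h0)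
  convert h3 using 1
  rw [e0, Complex.inner, mul_div_assoc]
  congr 1
  have hn : (‖F x‖ ^ 2 : ℝ) ≠ 0 := by simpa using h0
  rw [eq_div_iff hn, ← Complex.re_mul_ofReal]
  congr 1
  rw [← Complex.normSq_eq_norm_sq, Complex.normSq_eq_conj_mul_self]
  field_simp

lemma right_deriv_nonneg {ψ : ℝ → ℝ} {d : ℝ} (h : HasDerivAt ψ d 0) (h0 : ψ 0 = 0) (hp : ∀ᶠ y in 𝓝[>] (0:ℝ), 0 ≤ ψ y) : 0 ≤ d := by
  have h1 := (hasDerivAt_iff_tendsto_slope.1 h).mono_left (nhdsGT_le_nhdsNE (0:ℝ))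
  refine ge_of_tendsto h1 ?_
  filter_upwards [self_mem_nhdsWithin, hp] with y hy hpy
  rw [slope_def_field, h0, sub_zero, sub_zero]
  exact div_nonneg hpy (le_of_lt hy)

section
variable {f : ℂ → ℂ} {P : Set ℂ} {R0 C : ℝ}

lemma RLH.pos_real (H : RLH f P R0 C) {x : ℝ} (hx : R0 < x) : (x : ℂ) ∉ P ∧ f x ≠ 0 := by
  have hp := H.pos
  have hn : ‖(x : ℂ)‖ = x := by simp; linarith
  have h1 : (x : ℂ) ∉ P := fun h => by
    have := (H.hp _ h (by rw [hn]; exact hx.le)).2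
    simp at this; linarith
  refine ⟨h1, fun h => ?_⟩
  have := H.hz _ h1 (by rw [hn]; exact hx.le) h
  simp at this

lemma RLH.deriv_le (H : RLH f P R0 C) {w : ℂ} (hw : 0 < w.im) (hwR : 2 * R0 ≤ ‖w‖) (hw0 : f (conj w) = 0)
    {x : ℝ} (hx : R0 < x) :
    (deriv f x / f x).im ≤ (Real.pi * C + 4) * R0 / x ^ 2 - w.im / ‖(x : ℂ) - w‖ ^ 2 := by
  have hp := H.pos
  have hx0 : 0 < x := by linarith
  obtain ⟨n1, n2⟩ := H.pos_real hx
  set K := Real.pi * C + 4 with hK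
  have hKp : 0 < K := by have := H.hC; have := Real.pi_pos; positivity
  set F : ℂ → ℂ := fun z => f z * (z - w) with hF
  have hxw : (x : ℂ) - w ≠ 0 := by
    intro h; have := congrArg Complex.im h; simp at this; linarith
  have hf := (H.mer.ana n1).differentiableAt
  have hFd : HasDerivAt F (deriv f x * (x - w) + f x * 1) x :=
    hf.hasDerivAt.mul ((hasDerivAt_id _).sub_const w)
  have hF0 : F x ≠ 0 := mul_ne_zero n2 hxw
  have a1 := hasDeriv_log_norm (c := I) hFd.differentiableAt hF0
  have a2 := hasDeriv_log_norm (c := -I) hFd.differentiableAt hF0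
  have a3 : HasDerivAt (fun y : ℝ => 2 * (K * R0 / x ^ 2) * y) (2 * (K * R0 / x ^ 2)) 0 := by
    simpa using (hasDerivAt_id (0:ℝ)).const_mul (2 * (K * R0 / x ^ 2))
  have a4 := (a1.sub a2).add a3
  have hFq : deriv F x / F x = deriv f x / f x + ((x:ℂ) - w)⁻¹ := by
    rw [hFd.deriv]; simp only [hF]; field_simp
  have hev : ∀ c : ℂ, ∀ᶠ y : ℝ in 𝓝[>] 0, F (x + c * y) ≠ 0 := by
    intro c
    have hc : ContinuousAt (fun y : ℝ => F (x + c * y)) 0 := by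
      refine ContinuousAt.comp (g := F) ?_ (by fun_prop)
      simpa using hFd.continuousAt
    exact (hc.eventually_ne (by simpa using hF0)).filter_mono nhdsWithin_le_nhds
  have key := right_deriv_nonneg a4 (by simp) (by
    filter_upwards [self_mem_nhdsWithin, hev I, hev (-I)] with y hy m1 m2
    have hy : 0 < y := hy
    set z : ℂ := x + I * y with hz
    have hzi : z.im = y := by simp [hz]
    have hzr : z.re = x := by simp [hz]
    have hcz : conj z = x + -I * y := by simp [hz]
    have hzn : x ^ 2 ≤ ‖z‖ ^ 2 := by
      rw [← Complex.normSq_eq_norm_sq, Complex.normSq_apply, hzi, hzr]; nlinarith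
    have hzn2 : x ≤ ‖z‖ := (pow_le_pow_iff_left₀ hx0.le (norm_nonneg _) two_ne_zero).1 hzn
    have h1 := H.lim hw hwR hw0 (z := z) (by linarith) (by linarith)
    have h2 : ‖F (conj z)‖ = ‖f (conj z)‖ * ‖z - conj w‖ := by
      simp only [hF]; rw [norm_mul, ← Complex.norm_conj (z - conj w), map_sub, Complex.conj_conj]
    have h3 : ‖F z‖ = ‖f z‖ * ‖z - w‖ := by simp only [hF]; rw [norm_mul]
    have h4 : Real.exp (K * R0 * z.im / ‖z‖ ^ 2) ≤ Real.exp (K * R0 / x ^ 2 * y) := by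
      apply Real.exp_le_exp.2
      rw [hzi, div_mul_eq_mul_div]
      gcongr
    rw [← h2, ← h3] at h1
    have h5 : ‖F (conj z)‖ ≤ ‖F z‖ * Real.exp (K * R0 / x ^ 2 * y) := h1.trans (by gcongr)
    simp only [Pi.add_apply, Pi.sub_apply]
    rw [← hcz] at m2 ⊢
    rw [← hz]
    have p1 := norm_pos_iff.2 m1
    have p2 := norm_pos_iff.2 m2
    rw [Real.log_pow, Real.log_pow]
    have h6 := Real.log_le_log p2 h5
    rw [Real.log_mul p1.ne' (Real.exp_pos _).ne', Real.log_exp] at h6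
    push_cast
    linarith)
  rw [hFq] at key
  have e1 : (((x:ℂ) - w)⁻¹).im = w.im / ‖(x:ℂ) - w‖ ^ 2 := by
    rw [Complex.inv_im, Complex.normSq_eq_norm_sq]; simp
  have e2 : ∀ q : ℂ, (I * q).re = -q.im := by intro q; simp
  have e3 : ∀ q : ℂ, (-I * q).re = q.im := by intro q; simp
  rw [e2, e3, Complex.add_im, e1] at key
  have : 0 < K * R0 / x ^ 2 := by positivity
  linarith

end

structure Pl (f : ℂ → ℂ) (P : Set ℂ) (R0 M σ : ℝ) : Prop where
  mer : MeromOn f P univ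
  pos : 0 < R0
  sp : 0 < σ
  hp : ∀ z ∈ P, R0 ≤ ‖z‖ → z.im = 0 ∧ z.re < 0
  hz : ∀ z, z ∉ P → R0 ≤ ‖z‖ → f z = 0 → σ * ‖z‖ ≤ -z.im
  ho : ∀ z, z ∉ P → R0 ≤ ‖z‖ → f z = 1 → σ * ‖z‖ ≤ z.im
  c0 : GC f P M R0
  ck : ∃ᶠ R in atTop, GC f P M R
  zinf : ∀ B : ℝ, ∃ z, z ∉ P ∧ f z = 0 ∧ B < ‖z‖
  oinf : ∀ B : ℝ, ∃ z, z ∉ P ∧ f z = 1 ∧ B < ‖z‖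

def conjP (P : Set ℂ) : Set ℂ := {z | conj z ∈ P}
def conjF (f : ℂ → ℂ) : ℂ → ℂ := fun z => conj (f (conj z)) - 1

lemma conj_tendsto_ne (z : ℂ) : Tendsto (fun x : ℂ => conj x) (𝓝[≠] z) (𝓝[≠] (conj z)) := by
  refine tendsto_nhdsWithin_iff.2 ⟨?_, ?_⟩
  · exact ((Complex.continuous_conj).tendsto z).mono_left nhdsWithin_le_nhds
  · filter_upwards [self_mem_nhdsWithin] with x hx
    intro h
    apply hx
    have : conj (conj x) = conj (conj z) := by rw [show conj x = conj z from h]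
    rwa [Complex.conj_conj, Complex.conj_conj] at this

lemma conj_merom {f : ℂ → ℂ} {P : Set ℂ} (hm : MeromOn f P univ) : MeromOn (conjF f) (conjP P) univ := by
  refine ⟨subset_univ _, ?_, ?_, ?_⟩
  · intro z hz
    have : AnalyticAt ℂ f (conj z) := hm.ana hz.2
    exact (ana_conj this).sub analyticAt_const
  · intro p hp
    have h1 := (hm.2.2.1 _ hp).comp (conj_tendsto_ne p)
    refine tendsto_atTop_mono (fun z => ?_) (tendsto_atTop_add_const_right _ (-1) h1)
    have := norm_sub_norm_le (conj (f (conj z))) 1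
    rw [Complex.norm_conj, norm_one] at this
    simp only [Function.comp, conjF]
    linarith
  · intro z _ h
    have h1 := hm.2.2.2 (conj z) (mem_univ _)
    apply h1
    rw [accPt_iff_frequently_nhdsNE] at h ⊢
    exact (conj_tendsto_ne z).frequently h

section
variable {f : ℂ → ℂ} {P : Set ℂ} {R0 M σ : ℝ}

lemma Pl.Mpos (H : Pl f P R0 M σ) : 0 ≤ M := by
  obtain ⟨_, h, _⟩ := H.c0 (R0 : ℂ) (by simp [H.pos.le])
  exact (norm_nonneg _).trans h

lemma GC.cb {R : ℝ} (hM : 0 ≤ M) (h : GC f P M R) : CB f P (M ^ 2) R := by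
  intro z hz
  obtain ⟨h1, h2, h3, h4, h5⟩ := h z hz
  refine ⟨h1, ?_, ?_⟩
  · intro h0; rw [h0] at h3; simp at h3; linarith
  · calc _ ≤ M := h5
      _ = M * 1 := (mul_one _).symm
      _ ≤ M * (M * ‖f z‖) := by gcongr
      _ = _ := by ring

lemma conjF_deriv (z : ℂ) : deriv (conjF f) z = conj (deriv f (conj z)) := by
  have : deriv (conjF f) z = deriv (fun z => conj (f (conj z))) z := by
    unfold conjF; rw [deriv_sub_const]
  rw [this]
  exact congrFun (deriv_conj_conj (f := f)) z

lemma GC.cb' {R : ℝ} (hM : 0 ≤ M) (h : GC f P M R) : CB (conjF f) (conjP P) (M ^ 2) R := by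
  intro z hz
  obtain ⟨h1, h2, h3, h4, h5⟩ := h (conj z) (by rwa [Complex.norm_conj])
  have e : ‖conjF f z‖ = ‖f (conj z) - 1‖ := by
    rw [← Complex.norm_conj (f (conj z) - 1)]; simp [conjF]
  rw [Complex.norm_conj] at h5
  refine ⟨h1, ?_, ?_⟩
  · intro h0; rw [← e, h0] at h4; simp at h4; linarith
  · rw [conjF_deriv, Complex.norm_conj, e]
    calc _ ≤ M := h5
      _ = M * 1 := (mul_one _).symm
      _ ≤ M * (M * ‖f (conj z) - 1‖) := by gcongr
      _ = _ := by ring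

lemma Pl.rlh (H : Pl f P R0 M σ) : RLH f P R0 (M ^ 2) where
  mer := H.mer
  pos := H.pos
  hC := sq_nonneg _
  hp := H.hp
  hz := by
    intro z h1 h2 h3
    have := H.hz z h1 h2 h3
    have : 0 < σ * ‖z‖ := mul_pos H.sp (H.pos.trans_le h2)
    linarith
  c0 := H.c0.cb H.Mpos
  ck := H.ck.mono fun R h => h.cb H.Mpos

lemma Pl.rlh' (H : Pl f P R0 M σ) : RLH (conjF f) (conjP P) R0 (M ^ 2) where
  mer := conj_merom H.mer
  pos := H.pos
  hC := sq_nonneg _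
  hp := by
    intro z h1 h2
    have := H.hp (conj z) h1 (by rwa [Complex.norm_conj])
    simpa using this
  hz := by
    intro z h1 h2 h3
    have h4 : f (conj z) = 1 := by
      have : conj (f (conj z)) = 1 := sub_eq_zero.1 h3
      have := congrArg conj this
      simpa using this
    have := H.ho (conj z) h1 (by rwa [Complex.norm_conj]) h4
    rw [Complex.norm_conj, Complex.conj_im] at this
    have : 0 < σ * ‖z‖ := mul_pos H.sp (H.pos.trans_le h2)
    linarith
  c0 := H.c0.cb' H.Mpos
  ck := H.ck.mono fun R h => h.cb' H.Mpos

lemma Pl.lam0 (H : Pl f P R0 M σ) {w : ℂ} (hw : w ∉ P) (hw0 : f w = 0) (hwR : 2 * R0 ≤ ‖w‖) {x : ℝ} (hx : R0 < x) {D : ℝ}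
    (hD : ‖w‖ + x ≤ D) :
    (deriv f x / f x).im ≤ (Real.pi * M ^ 2 + 4) * R0 / x ^ 2 - σ * ‖w‖ / D ^ 2 := by
  have hp := H.pos
  have h1 := H.hz w hw (by linarith) hw0
  have h3 : 0 < σ * ‖w‖ := mul_pos H.sp (by linarith)
  have h2 := H.rlh.deriv_le (w := conj w) (by simp; linarith) (by rwa [Complex.norm_conj]) (by simpa using hw0) hx
  have h4 : ‖(x:ℂ) - conj w‖ ≤ D := by
    have := norm_sub_le (x:ℂ) (conj w)
    rw [Complex.norm_conj, Complex.norm_real, Real.norm_of_nonneg (by linarith)] at this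
    linarith
  have h5 : 0 < ‖(x:ℂ) - conj w‖ := by
    refine norm_pos_iff.2 fun h => ?_
    have := congrArg Complex.im h; simp at this; linarith
  have h6 : σ * ‖w‖ / D ^ 2 ≤ (conj w).im / ‖(x:ℂ) - conj w‖ ^ 2 := by
    rw [Complex.conj_im]
    have : 0 ≤ -w.im := by linarith
    gcongr
  linarith

lemma Pl.lam1 (H : Pl f P R0 M σ) {w : ℂ} (hw : w ∉ P) (hw0 : f w = 1) (hwR : 2 * R0 ≤ ‖w‖) {x : ℝ} (hx : R0 < x) {D : ℝ}
    (hD : ‖w‖ + x ≤ D) :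
    σ * ‖w‖ / D ^ 2 - (Real.pi * M ^ 2 + 4) * R0 / x ^ 2 ≤ (deriv f x / (f x - 1)).im := by
  have hp := H.pos
  have h1 := H.ho w hw (by linarith) hw0
  have h3 : 0 < σ * ‖w‖ := mul_pos H.sp (by linarith)
  have h2 := H.rlh'.deriv_le (w := w) (by linarith) hwR (by simp [conjF, hw0]) hx
  have h4 : ‖(x:ℂ) - w‖ ≤ D := by
    have := norm_sub_le (x:ℂ) w
    rw [Complex.norm_real, Real.norm_of_nonneg (by linarith)] at this
    linarith
  have h5 : 0 < ‖(x:ℂ) - w‖ := by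
    refine norm_pos_iff.2 fun h => ?_
    have := congrArg Complex.im h; simp at this; linarith
  have h6 : σ * ‖w‖ / D ^ 2 ≤ w.im / ‖(x:ℂ) - w‖ ^ 2 := by
    have : 0 ≤ w.im := by linarith
    gcongr
  have e : deriv (conjF f) x / conjF f x = conj (deriv f x / (f x - 1)) := by
    rw [conjF_deriv]; simp [conjF]
  rw [e, Complex.conj_im] at h2
  linarith

lemma Pl.false (H : Pl f P R0 M σ) : False := by
  have hp := H.pos
  have hs := H.sp
  set K := (Real.pi * M ^ 2 + 4) * R0 with hK
  have hKp : 0 < K := by have := Real.pi_pos; positivity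
  obtain ⟨h, hd, he⟩ := exists_holo_log (U := {z : ℂ | R0 < z.re ∧ -σ * z.re < z.im}) (g := f) (by
      have a1 : Convex ℝ {z : ℂ | R0 < z.re} := convex_halfSpace_re_gt R0
      have a2 : Convex ℝ {z : ℂ | 0 < (σ * z.re + z.im)} := by
        refine convex_halfSpace_gt ?_ 0
        constructor
        · intro a b; simp; ring
        · intro a b; simp; ring
      have := a1.inter a2
      convert this using 1
      ext z; simp only [mem_inter_iff, mem_ofPred_eq]
      constructor <;> rintro ⟨q1, q2⟩ <;> exact ⟨q1, by linarith⟩)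
    ((isOpen_lt continuous_const Complex.continuous_re).inter
      (isOpen_lt (continuous_const.mul Complex.continuous_re) Complex.continuous_im))
    (by
      intro z hz
      have hn : R0 ≤ ‖z‖ := hz.1.le.trans (Complex.re_le_norm z)
      have : z ∉ P := fun hP => by have := (H.hp z hP hn).2; linarith [hz.1]
      exact (H.mer.ana this).differentiableAt.differentiableWithinAt)
    (by
      intro z hz h0
      have hn : R0 ≤ ‖z‖ := hz.1.le.trans (Complex.re_le_norm z)
      have : z ∉ P := fun hP => by have := (H.hp z hP hn).2; linarith [hz.1]
      have h1 := H.hz z this hn h0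
      have h2 : σ * z.re ≤ σ * ‖z‖ := mul_le_mul_of_nonneg_left (Complex.re_le_norm z) hs.le
      linarith [hz.2])
  set U : Set ℂ := {z : ℂ | R0 < z.re ∧ -σ * z.re < z.im} with hU
  have hUo : IsOpen U := (isOpen_lt continuous_const Complex.continuous_re).inter
      (isOpen_lt (continuous_const.mul Complex.continuous_re) Complex.continuous_im)
  have hxU : ∀ x : ℝ, R0 < x → (x : ℂ) ∈ U := by
    intro x hx
    refine ⟨by simpa using hx, ?_⟩
    simp only [Complex.ofReal_re, Complex.ofReal_im]
    nlinarith
  set l : ℝ → ℝ := fun x => (h x).im with hl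
  have hld : ∀ x, R0 < x → HasDerivAt l (deriv f x / f x).im x := by
    intro x hx
    have hU1 : U ∈ 𝓝 (x : ℂ) := hUo.mem_nhds (hxU x hx)
    have h1 : HasDerivAt h (deriv h x) x := (hd.differentiableAt hU1).hasDerivAt
    have h2 : HasDerivAt f (exp (h x) * deriv h x) x := by
      refine h1.cexp.congr_of_eventuallyEq ?_
      filter_upwards [hU1] with z hz using (he z hz).symm
    have h3 : deriv f x / f x = deriv h x := by
      rw [h2.deriv, ← he x (hxU x hx)]
      field_simp [Complex.exp_ne_zero]
    rw [h3]
    have h4 := h1.comp_ofReal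
    exact (Complex.imCLM.hasFDerivAt.comp_hasDerivAt x h4)
  set u : ℝ → ℝ := fun x => l x + K / x with hu
  have hud : ∀ x, R0 < x → HasDerivAt u ((deriv f x / f x).im - K / x ^ 2) x := by
    intro x hx
    have h1 : HasDerivAt (fun x : ℝ => K / x) (-K / x ^ 2) x := by
      have hx' : x ≠ 0 := by linarith
      have := (hasDerivAt_inv hx').const_mul K
      simp only [← div_eq_mul_inv] at this
      rw [show -K / x ^ 2 = K * -(x ^ 2)⁻¹ by ring]
      exact this
    have := (hld x hx).add h1
    rw [sub_eq_add_neg, ← neg_div]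
    exact this
  have hdrop : ∀ w, w ∉ P → f w = 0 → 2 * R0 ≤ ‖w‖ → ∀ x, R0 < x →
      (deriv f x / f x).im - K / x ^ 2 ≤ -(σ * ‖w‖ / (‖w‖ + x) ^ 2) := by
    intro w h1 h2 h3 x hx
    have := H.lam0 h1 h2 h3 hx le_rfl
    linarith
  have hanti : AntitoneOn u (Ioi R0) := by
    obtain ⟨w, q1, q2, q3⟩ := H.zinf (2 * R0)
    refine antitoneOn_of_deriv_nonpos (convex_Ioi _) (fun x hx => (hud x hx).continuousAt.continuousWithinAt)
      (fun x hx => ?_) (fun x hx => ?_)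
    · rw [interior_Ioi] at hx
      exact (hud x hx).differentiableAt.differentiableWithinAt
    · rw [interior_Ioi] at hx
      rw [(hud x hx).deriv]
      refine (hdrop w q1 q2 q3.le x hx).trans ?_
      have : 0 ≤ σ * ‖w‖ / (‖w‖ + x) ^ 2 := by positivity
      linarith
  have hstep : ∀ X, R0 < X → ∃ x, X < x ∧ u x ≤ u X - σ / 9 := by
    intro X hX
    obtain ⟨w, q1, q2, q3⟩ := H.zinf (2 * X)
    set r := ‖w‖ with hr
    have hr0 : 0 < r := by linarith
    refine ⟨2 * r, by linarith, ?_⟩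
    have h1 : u r ≤ u X := hanti (mem_Ioi.2 hX) (mem_Ioi.2 (by linarith)) (by linarith)
    have h2 : u (2 * r) - u r ≤ -(σ / (9 * r)) * (2 * r - r) := by
      refine Convex.image_sub_le_mul_sub_of_deriv_le (convex_Icc r (2 * r)) (f := u)
        (fun x hx => (hud x (by linarith [hx.1])).continuousAt.continuousWithinAt) (fun x hx => ?_) (fun x hx => ?_)
        r ⟨le_rfl, by linarith⟩ (2 * r) ⟨by linarith, le_rfl⟩ (by linarith)
      · rw [interior_Icc] at hx
        exact (hud x (by linarith [hx.1])).differentiableAt.differentiableWithinAt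
      · rw [interior_Icc] at hx
        have hx1 := hx.1
        have hx2 := hx.2
        rw [(hud x (by linarith)).deriv]
        refine (hdrop w q1 q2 (by linarith) x (by linarith)).trans ?_
        rw [neg_le_neg_iff]
        calc σ / (9 * r) = σ * r / (3 * r) ^ 2 := by field_simp; norm_num
          _ ≤ σ * r / (r + x) ^ 2 := by
              have : 0 < r + x := by linarith
              gcongr; linarith
    have h3 : -(σ / (9 * r)) * (2 * r - r) = -(σ / 9) := by field_simp; ring
    linarith
  have hiter : ∀ X, R0 < X → ∀ n : ℕ, ∃ x, X ≤ x ∧ u x ≤ u X - n * (σ / 9) := by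
    intro X hX n
    induction n with
    | zero => exact ⟨X, le_rfl, by simp⟩
    | succ n ih =>
      obtain ⟨x, h1, h2⟩ := ih
      obtain ⟨y, h3, h4⟩ := hstep x (by linarith)
      refine ⟨y, by linarith, ?_⟩
      push_cast; linarith
  -- choose a large starting point
  obtain ⟨w0, a1, a2, a3⟩ := H.zinf (2 * R0 + 4 * K / σ)
  obtain ⟨w1, b1, b2, b3⟩ := H.oinf (2 * R0 + 4 * K / σ)
  have hKs : 0 < 4 * K / σ := by positivity
  have c1 : 4 * K < σ * ‖w0‖ := by
    have : 4 * K / σ < ‖w0‖ := by linarith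
    rw [div_lt_iff₀ hs] at this; linarith
  have c2 : 4 * K < σ * ‖w1‖ := by
    have : 4 * K / σ < ‖w1‖ := by linarith
    rw [div_lt_iff₀ hs] at this; linarith
  set X := ‖w0‖ + ‖w1‖ with hX
  have hX0 : R0 < X := by linarith [norm_nonneg w1]
  obtain ⟨m, hm⟩ := exists_nat_gt (-(l X) / (2 * Real.pi))
  have hm' : -Real.pi - 2 * Real.pi * m < l X := by
    rw [div_lt_iff₀ (by positivity)] at hm
    linarith [Real.pi_pos]
  obtain ⟨n, hn⟩ := exists_nat_gt ((u X + Real.pi + 2 * Real.pi * m) / (σ / 9))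
  rw [div_lt_iff₀ (by positivity)] at hn
  obtain ⟨Y, hY1, hY2⟩ := hiter X hX0 n
  have hlY : l Y ≤ -Real.pi - 2 * Real.pi * m := by
    have : l Y ≤ u Y := by
      have : 0 ≤ K / Y := div_nonneg hKp.le (by linarith)
      simp only [hu]; linarith
    linarith
  obtain ⟨x, hx, hlx⟩ := intermediate_value_Icc' hY1
    (fun y hy => (hld y (by linarith [hy.1])).continuousAt.continuousWithinAt) ⟨hlY, hm'.le⟩
  have hxX : X ≤ x := hx.1
  have hxR : R0 < x := by linarith
  have hx0 : 0 < x := by linarith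
  have hfx : f x = -(Real.exp (h x).re : ℂ) := by
    rw [← he x (hxU x hxR)]
    have : h x = ((h x).re : ℂ) + ((-Real.pi : ℝ) * I + ((-m : ℤ) : ℂ) * (2 * Real.pi * I)) := by
      apply Complex.ext
      · simp
      · simp [show (h x).im = _ from hlx]; ring
    rw [this, Complex.exp_add, Complex.exp_periodic.int_mul]
    push_cast
    rw [neg_mul, Complex.exp_neg, Complex.exp_pi_mul_I]
    simp
  set ρ := Real.exp (h x).re with hρ
  have hρ0 : 0 < ρ := Real.exp_pos _
  have d0 := H.lam0 a1 a2 (by linarith) hxR (D := 2 * x) (by linarith [norm_nonneg w1])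
  have d1 := H.lam1 b1 b2 (by linarith) hxR (D := 2 * x) (by linarith [norm_nonneg w0])
  have g0 : K / x ^ 2 < σ * ‖w0‖ / (2 * x) ^ 2 := by
    rw [div_lt_div_iff₀ (by positivity) (by positivity)]
    have : 0 < x ^ 2 := by positivity
    nlinarith
  have g1 : K / x ^ 2 < σ * ‖w1‖ / (2 * x) ^ 2 := by
    rw [div_lt_div_iff₀ (by positivity) (by positivity)]
    have : 0 < x ^ 2 := by positivity
    nlinarith
  have i0 : (deriv f x / f x).im < 0 := by linarith
  have i1 : 0 < (deriv f x / (f x - 1)).im := by linarith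
  have e : deriv f x / (f x - 1) = (deriv f x / f x) * ((ρ / (ρ + 1) : ℝ) : ℂ) := by
    rw [hfx]
    have q1 : (ρ : ℂ) ≠ 0 := by exact_mod_cast hρ0.ne'
    have q2 : (ρ : ℂ) + 1 ≠ 0 := by exact_mod_cast (by positivity : ρ + 1 ≠ 0)
    have q3 : -(ρ : ℂ) - 1 ≠ 0 := by
      rw [show -(ρ : ℂ) - 1 = -(ρ + 1) by ring]; exact neg_ne_zero.2 q2
    push_cast
    field_simp
    ring
  rw [e, Complex.im_mul_ofReal] at i1
  have : 0 < ρ / (ρ + 1) := by positivity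
  nlinarith

end

def spP (c : ℂ) (P : Set ℂ) : Set ℂ := {z | c * z ∈ P}
def spF (c : ℂ) (f : ℂ → ℂ) : ℂ → ℂ := fun z => f (c * z)

lemma sp_tendsto_ne {c : ℂ} (hc : c ≠ 0) (z : ℂ) : Tendsto (fun x : ℂ => c * x) (𝓝[≠] z) (𝓝[≠] (c * z)) := by
  refine tendsto_nhdsWithin_iff.2 ⟨?_, ?_⟩
  · have : Continuous fun x : ℂ => c * x := by fun_prop
    exact (this.tendsto z).mono_left nhdsWithin_le_nhds
  · filter_upwards [self_mem_nhdsWithin] with x hx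
    intro h
    exact hx (mul_left_cancel₀ hc h)

lemma sp_merom {f : ℂ → ℂ} {P : Set ℂ} {c : ℂ} (hc : c ≠ 0) (hm : MeromOn f P univ) : MeromOn (spF c f) (spP c P) univ := by
  refine ⟨subset_univ _, ?_, ?_, ?_⟩
  · intro z hz
    have : AnalyticAt ℂ f (c * z) := hm.ana hz.2
    exact AnalyticAt.fun_comp (g := f) this (analyticAt_const.mul analyticAt_id)
  · intro p hp
    exact (hm.2.2.1 _ hp).comp (sp_tendsto_ne hc p)
  · intro z _ h
    have h1 := hm.2.2.2 (c * z) (mem_univ _)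
    apply h1
    rw [accPt_iff_frequently_nhdsNE] at h ⊢
    exact (sp_tendsto_ne hc z).frequently h

lemma sp_gc {f : ℂ → ℂ} {P : Set ℂ} {c : ℂ} (hc : ‖c‖ = 1) {M R : ℝ} (h : GC f P M R) :
    GC (spF c f) (spP c P) M R := by
  intro z hz
  obtain ⟨h1, h2, h3, h4, h5⟩ := h (c * z) (by rw [norm_mul, hc, one_mul, hz])
  refine ⟨h1, h2, h3, h4, ?_⟩
  have : deriv (spF c f) z = c * deriv f (c * z) := deriv_comp_mul_left c f z
  rw [this, norm_mul, hc, one_mul]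
  rwa [norm_mul, hc, one_mul] at h5

lemma Set.Finite.norm_bd {S : Set ℂ} (h : S.Finite) : ∃ B : ℝ, ∀ z ∈ S, ‖z‖ ≤ B := h.isBounded.exists_norm_le

section
variable {f : ℂ → ℂ} {P : Set ℂ} {t0 t1 t2 : ℝ}

lemma Cfg.far_ones (C : Cfg f P t0 t1 t2) (G : {z | z ∉ P ∧ f z = 1}.Infinite) (B : ℝ) :
    ∃ z, z ∉ P ∧ f z = 1 ∧ B < ‖z‖ := by
  by_contra hcon
  push Not at hcon
  refine G (Cfg.finite_poles (R := B) C.rot.mer fun z hz hzP => ?_)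
  have := hcon z hzP.1 hzP.2
  linarith

lemma Cfg.far_zeros (C : Cfg f P t0 t1 t2) (G : {z | z ∉ P ∧ f z = 0}.Infinite) (B : ℝ) :
    ∃ z, z ∉ P ∧ f z = 0 ∧ B < ‖z‖ := by
  by_contra hcon
  push Not at hcon
  have e : rotP (_root_.rot f P) (rotP f P) = {z | z ∉ P ∧ f z = 0} := by
    ext z
    constructor
    · rintro ⟨h1, h2⟩
      by_cases hp : z ∈ P
      · rw [rot_pole hp] at h2; exact absurd h2 zero_ne_one
      · rw [rot_of hp, inv_eq_one] at h2
        exact ⟨hp, by linear_combination -h2⟩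
    · rintro ⟨h1, h2⟩
      refine ⟨fun h => ?_, ?_⟩
      · have := h.2; rw [h2] at this; exact zero_ne_one this
      · rw [rot_of h1, h2]; simp
  have h1 := Cfg.finite_poles (R := B) C.rot.rot.mer fun z hz hzP => by
    rw [e] at hzP
    have := hcon z hzP.1 hzP.2
    linarith
  rw [e] at h1
  exact G h1

lemma ray_sp {θ α : ℝ} {z : ℂ} (h : exp (α * I) * z ∈ Ray θ) :
    z.re = ‖z‖ * Real.cos (θ - α) ∧ z.im = ‖z‖ * Real.sin (θ - α) := by
  obtain ⟨t, ht, h⟩ := h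
  have hz : z = (t : ℂ) * exp ((θ - α : ℝ) * I) := by
    have h0 : exp (α * I) ≠ 0 := Complex.exp_ne_zero _
    apply mul_left_cancel₀ h0
    rw [h]
    have : (θ : ℂ) * I = α * I + (θ - α : ℝ) * I := by push_cast; ring
    rw [this, Complex.exp_add]; ring
  have hn : ‖z‖ = t := by
    rw [hz, norm_mul, Complex.norm_exp_ofReal_mul_I, mul_one, Complex.norm_real, Real.norm_of_nonneg ht.le]
  rw [hn, hz]
  rw [Complex.re_ofReal_mul, Complex.im_ofReal_mul, Complex.exp_ofReal_mul_I_re, Complex.exp_ofReal_mul_I_im]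
  exact ⟨rfl, rfl⟩

lemma Cfg.main (C : Cfg f P t0 t1 t2) (G : Good f P) (h1 : t2 - t1 < Real.pi) (h2 : t0 + 2 * Real.pi - t2 < Real.pi) : False := by
  set α : ℝ := t2 - Real.pi with hα
  set c : ℂ := exp (α * I) with hc
  have hc1 : ‖c‖ = 1 := Complex.norm_exp_ofReal_mul_I α
  have hc0 : c ≠ 0 := Complex.exp_ne_zero _
  obtain ⟨M, hM⟩ := G.gc
  obtain ⟨B0, hB0⟩ := C.z0.norm_bd
  obtain ⟨B1, hB1⟩ := C.z1.norm_bd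
  obtain ⟨B2, hB2⟩ := C.zp.norm_bd
  have hfr := (((hM.and_eventually (eventually_gt_atTop 0)).and_eventually (eventually_gt_atTop B0)).and_eventually
    (eventually_gt_atTop B1)).and_eventually (eventually_gt_atTop B2)
  obtain ⟨R0, ⟨⟨⟨hg, hR⟩, r0⟩, r1⟩, r2⟩ := hfr.exists
  have s1 : 0 < Real.sin (t2 - t1) := Real.sin_pos_of_pos_of_lt_pi (by linarith [C.h12]) h1
  have s2 : 0 < Real.sin (t0 + 2 * Real.pi - t2) := Real.sin_pos_of_pos_of_lt_pi (by linarith [C.h20]) h2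
  have hcn : ∀ z, ‖c * z‖ = ‖z‖ := fun z => by rw [norm_mul, hc1, one_mul]
  have far : ∀ v : ℂ, (∀ B : ℝ, ∃ z, z ∉ P ∧ f z = v ∧ B < ‖z‖) →
      ∀ B : ℝ, ∃ z, z ∉ spP c P ∧ spF c f z = v ∧ B < ‖z‖ := by
    intro v hv B
    obtain ⟨z, q1, q2, q3⟩ := hv B
    have e : c * (c⁻¹ * z) = z := by field_simp
    refine ⟨c⁻¹ * z, ?_, ?_, ?_⟩
    · intro h; apply q1; rw [← e]; exact h
    · simp only [spF]; rw [e]; exact q2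
    · rw [norm_mul, norm_inv, hc1]; simpa using q3
  refine Pl.false (f := spF c f) (P := spP c P) (R0 := R0) (M := M)
    (σ := min (Real.sin (t2 - t1)) (Real.sin (t0 + 2 * Real.pi - t2))) ?_
  refine ⟨sp_merom hc0 C.mer, hR, lt_min s1 s2, ?_, ?_, ?_, sp_gc hc1 hg, hM.mono fun R h => sp_gc hc1 h,
    far 0 (C.far_zeros G.zinf), far 1 (C.far_ones G.oinf)⟩
  · intro z hz hzR
    have hray : c * z ∈ Ray t2 := by
      by_contra hcon
      have := hB2 (c * z) ⟨hz, hcon⟩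
      rw [hcn] at this; linarith
    obtain ⟨q1, q2⟩ := ray_sp hray
    rw [show t2 - α = Real.pi by simp [hα]] at q1 q2
    rw [Real.cos_pi] at q1
    rw [Real.sin_pi] at q2
    exact ⟨by linarith, by linarith⟩
  · intro z hz hzR h0
    have hray : c * z ∈ Ray t0 := by
      by_contra hcon
      have := hB0 (c * z) ⟨⟨hz, h0⟩, hcon⟩
      rw [hcn] at this; linarith
    obtain ⟨q1, q2⟩ := ray_sp hray
    have e : Real.sin (t0 - α) = -Real.sin (t0 + 2 * Real.pi - t2) := by
      rw [← Real.sin_add_pi, ← Real.sin_sub_two_pi (t0 + 2 * Real.pi - t2 + Real.pi)]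
      congr 1; rw [hα]; ring
    rw [q2, e]
    have := mul_le_mul_of_nonneg_left (min_le_right (Real.sin (t2 - t1)) (Real.sin (t0 + 2 * Real.pi - t2))) (norm_nonneg z)
    linarith
  · intro z hz hzR h0
    have hray : c * z ∈ Ray t1 := by
      by_contra hcon
      have := hB1 (c * z) ⟨⟨hz, h0⟩, hcon⟩
      rw [hcn] at this; linarith
    obtain ⟨q1, q2⟩ := ray_sp hray
    have e : Real.sin (t1 - α) = Real.sin (t2 - t1) := by
      rw [← Real.sin_pi_sub (t2 - t1)]
      congr 1; rw [hα]; ring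
    rw [q2, e]
    have := mul_le_mul_of_nonneg_left (min_le_left (Real.sin (t2 - t1)) (Real.sin (t0 + 2 * Real.pi - t2))) (norm_nonneg z)
    linarith

lemma Cfg.false (C : Cfg f P t0 t1 t2) (hne : ¬ EqG t0 t1 t2) : False := by
  obtain ⟨G0, G1, G2⟩ := C.good_all hne
  have a := C.h01
  have b := C.h12
  have c := C.h20
  by_cases h1 : t2 - t1 < Real.pi
  · by_cases h2 : t0 + 2 * Real.pi - t2 < Real.pi
    · exact C.main G0 h1 h2
    · exact C.rot.main G1 (by linarith) (by linarith)
  · exact C.rot.rot.main G2 (by linarith) (by linarith)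

lemma Ray_add_int (θ : ℝ) (n : ℤ) : Ray (θ + n * (2 * Real.pi)) = Ray θ := by
  have h : ((θ + n * (2 * Real.pi) : ℝ) : ℂ) * I = θ * I + n * (2 * Real.pi * I) := by push_cast; ring
  unfold Ray
  rw [h, Complex.exp_periodic.int_mul n]

lemma exists_rep (a θ : ℝ) : ∃ s, a ≤ s ∧ s < a + 2 * Real.pi ∧ Ray s = Ray θ := by
  refine ⟨toIcoMod Real.two_pi_pos a θ, left_le_toIcoMod _ _ _, toIcoMod_lt_right _ _ _, ?_⟩
  have : toIcoMod Real.two_pi_pos a θ = θ + ((-toIcoDiv Real.two_pi_pos a θ : ℤ) : ℝ) * (2 * Real.pi) := by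
    rw [toIcoMod]; push_cast; simp only [zsmul_eq_mul]; ring
  rw [this, Ray_add_int]

lemma one_sub_merom (hm : MeromOn f P univ) : MeromOn (fun z => 1 - f z) P univ := by
  refine ⟨subset_univ _, ?_, ?_, hm.2.2.2⟩
  · intro z hz
    exact analyticAt_const.sub (hm.2.1 z hz)
  · intro p hp
    refine tendsto_atTop_mono (fun z => ?_) (tendsto_atTop_add_const_right _ (-1) (hm.2.2.1 p hp))
    have := norm_sub_norm_le (f z) 1
    rw [norm_one, norm_sub_rev] at this
    linarith

lemma one_sub_rat (h : RatF (fun z => 1 - f z)) : RatF f := by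
  obtain ⟨p, q, hq, h⟩ := h
  refine ⟨q - p, q, hq, fun z0 => ?_⟩
  filter_upwards [h z0] with z hz
  rw [Polynomial.eval_sub, ← hz]; ring

end

theorem no_transcendental_merom_three_rays_not_equally_spaced
    (θ₀ θ₁ θ₂ : ℝ)
    (hd01 : Ray θ₀ ≠ Ray θ₁) (hd02 : Ray θ₀ ≠ Ray θ₂) (hd12 : Ray θ₁ ≠ Ray θ₂)
    (hns : ¬ EquallySpaced (Ray θ₀) (Ray θ₁) (Ray θ₂)) :
    ¬ ∃ (f : ℂ → ℂ) (P : Set ℂ), MeromOn f P Set.univ ∧ ¬ IsRationalFn f P ∧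
      ({z : ℂ | z ∉ P ∧ f z = 0} \ Ray θ₀).Finite ∧
      ({z : ℂ | z ∉ P ∧ f z = 1} \ Ray θ₁).Finite ∧
      (P \ Ray θ₂).Finite := by
  rintro ⟨f, P, hm, hr, f0, f1, fp⟩
  have hr' : ¬ RatF f := fun h => hr (h.isRational hm)
  obtain ⟨s1, a1, a2, a3⟩ := exists_rep θ₀ θ₁
  obtain ⟨s2, b1, b2, b3⟩ := exists_rep θ₀ θ₂
  have n1 : θ₀ ≠ s1 := by rintro rfl; exact hd01 a3
  have n2 : θ₀ ≠ s2 := by rintro rfl; exact hd02 b3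
  have n3 : s1 ≠ s2 := by rintro rfl; exact hd12 (a3.symm.trans b3)
  have a1' := lt_of_le_of_ne a1 n1
  have b1' := lt_of_le_of_ne b1 n2
  rcases lt_or_gt_of_ne n3 with h | h
  · refine Cfg.false (f := f) (P := P) (t0 := θ₀) (t1 := s1) (t2 := s2)
      ⟨hm, hr', a1', h, b2, f0, by rwa [a3], by rwa [b3]⟩ ?_
    rintro ⟨e1, e2⟩
    apply hns
    refine ⟨θ₀, ?_⟩
    rw [← e1, ← e2, a3, b3]
  · refine Cfg.false (f := fun z => 1 - f z) (P := P) (t0 := s1) (t1 := θ₀ + 2 * Real.pi) (t2 := s2 + 2 * Real.pi)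
      ⟨one_sub_merom hm, fun h => hr' (one_sub_rat h), a2, by linarith, by linarith, ?_, ?_, by rwa [Ray_eq, b3]⟩ ?_
    · rw [a3]
      refine f1.subset ?_
      rintro z ⟨⟨q1, q2⟩, q3⟩
      exact ⟨⟨q1, (sub_eq_zero.1 q2).symm⟩, q3⟩
    · rw [Ray_eq]
      refine f0.subset ?_
      rintro z ⟨⟨q1, q2⟩, q3⟩
      exact ⟨⟨q1, by simpa using q2⟩, q3⟩
    rintro ⟨e1, e2⟩
    apply hns
    refine ⟨s1, ?_⟩
    rw [← e1, ← e2, Ray_eq, Ray_eq, a3, b3]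
    exact Set.insert_comm _ _ _
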